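/- Let G be a finite abelian group with G ≅ C_n^r, D(G) ≥ 4, and r ≥ n − 1. Assume that K(G, r−1) = 1 + s(r−1)/n for some s ∈ ℕ with gcd(s, n) = 1. If G' is a finite abelian group with 𝓛(G') = 𝓛(G), then G ≅ G'. -/

import Mathlib

/- Common definitions: zero-sum sequences over a finite abelian group,
   sets of lengths, the system of sets of lengths, the Davenport constant,
   sets of distances, elasticities, AAPs, Δ₁(G), ρ(G,d,k), ρ(G,d), ρ*(G,d),
   cross numbers, K(G₀), K(G,d), LCN-sets, Δ*(G). -/

open scoped Classical

section Defs

variable {G : Type*} [AddCommGroup G]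

/-- The support of a sequence (multiset) over `G`. -/
def suppSet (A : Multiset G) : Set G := {g | g ∈ A}

/-- `A` is a minimal zero-sum sequence (an atom of `𝓑(G₀)`) over `G₀ ⊆ G`:
a nontrivial zero-sum sequence with terms in `G₀` such that every proper
nontrivial subsequence has nonzero sum. -/
def IsMinZeroSum (G0 : Set G) (A : Multiset G) : Prop :=
  A ≠ 0 ∧ (∀ g ∈ A, g ∈ G0) ∧ A.sum = 0 ∧
    ∀ T : Multiset G, T ≤ A → T.sum = 0 → T = 0 ∨ T = A

/-- `B` is a zero-sum sequence over `G₀ ⊆ G` (an element of `𝓑(G₀)`). -/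
def IsZeroSumSeq (G0 : Set G) (B : Multiset G) : Prop :=
  (∀ g ∈ B, g ∈ G0) ∧ B.sum = 0

/-- The set of lengths `L(B)` of a zero-sum sequence `B` over `G₀`:
all `k` such that `B` is a product of `k` atoms of `𝓑(G₀)`.
(For the trivial sequence this is `{0}`.) -/
def lengthSet (G0 : Set G) (B : Multiset G) : Set ℕ :=
  {k | ∃ U : Fin k → Multiset G, (∀ i, IsMinZeroSum G0 (U i)) ∧ B = ∑ i, U i}

/-- The system of sets of lengths `𝓛(G₀)`. -/
def systemL (G0 : Set G) : Set (Set ℕ) :=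
  {L | ∃ B : Multiset G, IsZeroSumSeq G0 B ∧ L = lengthSet G0 B}

/-- The Davenport constant `D(G)`: the maximal length of a minimal zero-sum
sequence over `G`. -/
noncomputable def davenport (G : Type*) [AddCommGroup G] : ℕ :=
  sSup {m | ∃ A : Multiset G, IsMinZeroSum (Set.univ : Set G) A ∧ Multiset.card A = m}

/-- The set of successive distances `Δ(L)` of a set `L ⊆ ℕ`. -/
def deltaOf (L : Set ℕ) : Set ℕ :=
  {d | 0 < d ∧ ∃ a, a ∈ L ∧ a + d ∈ L ∧ ∀ c ∈ L, ¬(a < c ∧ c < a + d)}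

/-- `Δ(G₀) = ⋃_{L ∈ 𝓛(G₀)} Δ(L)`. -/
def deltaG0 (G0 : Set G) : Set ℕ := ⋃ L ∈ systemL G0, deltaOf L

/-- `Δ*(G) = {min Δ(G₀) : G₀ ⊆ G with Δ(G₀) ≠ ∅}`. -/
def deltaStar (G : Type*) [AddCommGroup G] : Set ℕ :=
  {d | ∃ G0 : Set G, deltaG0 G0 ≠ ∅ ∧ d = sInf (deltaG0 G0)}

/-- The elasticity `ρ(L) = max L / min L` of a (finite) set `L ⊆ ℕ`,
with the convention `ρ({0}) = 1`. -/
noncomputable def rhoL (L : Set ℕ) : ℝ :=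
  if sInf L = 0 then 1 else ((sSup L : ℕ) : ℝ) / ((sInf L : ℕ) : ℝ)

/-- The elasticity `ρ(G₀) = sup {ρ(L) : L ∈ 𝓛(G₀)}`. -/
noncomputable def rhoG0 (G0 : Set G) : ℝ := sSup (rhoL '' systemL G0)

/-- `L` (a set of naturals) is an almost arithmetical progression (AAP)
with difference `d`, length `ℓ` and bound `M`:
`L = y + (L' ∪ {0, d, …, ℓd} ∪ L'') ⊆ y + dℤ` with `L' ⊆ [−M, −1]` and
`L'' ⊆ ℓd + [1, M]`. -/
def IsAAP (L : Set ℕ) (d ℓ M : ℕ) : Prop :=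
  ∃ (y : ℤ) (L1 L2 : Set ℤ),
    L1 ⊆ Set.Icc (-(M : ℤ)) (-1) ∧
    L2 ⊆ Set.Icc ((ℓ : ℤ) * d + 1) ((ℓ : ℤ) * d + M) ∧
    ((fun x : ℕ => (x : ℤ)) '' L) =
      (fun x => y + x) '' (L1 ∪ (fun i : ℤ => (d : ℤ) * i) '' Set.Icc (0 : ℤ) (ℓ : ℤ) ∪ L2) ∧
    (∀ x ∈ L, (d : ℤ) ∣ ((x : ℤ) - y))

/-- `Δ₁(G)`: the set of `d ∈ ℕ` such that for every `k` there is some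
`L ∈ 𝓛(G)` which is an AAP with difference `d` and length at least `k`. -/
def delta1 (G : Type*) [AddCommGroup G] : Set ℕ :=
  {d | 0 < d ∧ ∀ k : ℕ, ∃ L ∈ systemL (Set.univ : Set G), ∃ ℓ ≥ k, ∃ M : ℕ, IsAAP L d ℓ M}

/-- `ρ(G, d, k)`: the supremum of elasticities of sets of lengths of `G` which
are AAPs with difference `d` and length at least `k`. -/
noncomputable def rhoGdk (G : Type*) [AddCommGroup G] (d k : ℕ) : ℝ :=
  sSup (rhoL '' {L | L ∈ systemL (Set.univ : Set G) ∧ ∃ ℓ ≥ k, ∃ M : ℕ, IsAAP L d ℓ M})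

/-- `ρ(G, d)`: the limit of the decreasing sequence `(ρ(G, d, k))_k`,
i.e. its infimum. -/
noncomputable def rhoGd (G : Type*) [AddCommGroup G] (d : ℕ) : ℝ :=
  ⨅ k : ℕ, rhoGdk G d k

/-- `ρ*(G, d) = max {ρ(G₀) : G₀ ⊆ G non-half-factorial with d ∣ min Δ(G₀)}`. -/
noncomputable def rhoStar (G : Type*) [AddCommGroup G] (d : ℕ) : ℝ :=
  sSup {x | ∃ G0 : Set G, deltaG0 G0 ≠ ∅ ∧ d ∣ sInf (deltaG0 G0) ∧ x = rhoG0 G0}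

/-- The cross number `k(S) = Σ_{g ∈ S} 1/ord(g)` of a sequence `S`. -/
noncomputable def crossNum (S : Multiset G) : ℝ :=
  (S.map (fun g => (1 : ℝ) / (addOrderOf g))).sum

/-- `K(G₀) = max {k(A) : A ∈ 𝓐(G₀)}`, the cross number of `G₀`. -/
noncomputable def KG0 (G0 : Set G) : ℝ :=
  sSup {x | ∃ A : Multiset G, IsMinZeroSum G0 A ∧ x = crossNum A}

/-- `K(G, d) = max {K(G₀) : G₀ ⊆ G non-half-factorial with d ∣ min Δ(G₀)}`. -/
noncomputable def KGd (G : Type*) [AddCommGroup G] (d : ℕ) : ℝ :=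
  sSup {x | ∃ G0 : Set G, deltaG0 G0 ≠ ∅ ∧ d ∣ sInf (deltaG0 G0) ∧ x = KG0 G0}

/-- `G₀` is an LCN-set: `k(A) ≥ 1` for every atom `A` of `𝓑(G₀)`. -/
def IsLCN (G0 : Set G) : Prop :=
  ∀ A : Multiset G, IsMinZeroSum G0 A → 1 ≤ crossNum A

end Defs


open scoped Classical
set_option linter.unusedSectionVars false

namespace ZS

section Basic
variable {Z : Type*} [AddCommGroup Z]

/-- atoms -/
def At (A : Multiset Z) : Prop :=
  A ≠ 0 ∧ A.sum = 0 ∧ ∀ T : Multiset Z, T ≤ A → T.sum = 0 → T = 0 ∨ T = A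

def Fac (f : Multiset (Multiset Z)) : Prop := ∀ A ∈ f, At A

def Over (S : Finset Z) (B : Multiset Z) : Prop := ∀ h ∈ B, h ∈ S

def Struct (d : ℕ) (S : Finset Z) : Prop :=
  ∀ f f' : Multiset (Multiset Z), Fac f → Fac f' → f.sum = f'.sum → Over S f.sum →
    f.card ≡ f'.card [MOD d]

lemma Over.mono {S S' : Finset Z} {B : Multiset Z} (h : Over S B) (hs : S ⊆ S') : Over S' B :=
  fun x hx => hs (h x hx)

lemma Over.le {S : Finset Z} {B C : Multiset Z} (h : Over S B) (hs : C ≤ B) : Over S C :=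
  fun x hx => h x (Multiset.mem_of_le hs hx)

lemma Over.add {S : Finset Z} {B C : Multiset Z} (h : Over S B) (h' : Over S C) :
    Over S (B + C) := by
  intro x hx
  rcases Multiset.mem_add.1 hx with h1 | h1
  exacts [h x h1, h' x h1]

lemma Over.nsmul {S : Finset Z} {B : Multiset Z} (h : Over S B) (n : ℕ) : Over S (n • B) :=
  fun x hx => h x (Multiset.mem_of_mem_nsmul hx)

lemma over_toFinset (B : Multiset Z) : Over B.toFinset B := fun _ hx => Multiset.mem_toFinset.2 hx

lemma over_sum {S : Finset Z} {f : Multiset (Multiset Z)} :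
    Over S f.sum ↔ ∀ A ∈ f, Over S A := by
  induction f using Multiset.induction with
  | empty => simp [Over]
  | cons A f ih =>
    rw [Multiset.sum_cons]
    constructor
    · intro h B hB
      rcases Multiset.mem_cons.1 hB with rfl | hB
      · exact h.le (Multiset.le_add_right _ _)
      · exact ih.1 (h.le (Multiset.le_add_left _ _)) B hB
    · intro h
      exact (h A (Multiset.mem_cons_self _ _)).add
        (ih.2 fun B hB => h B (Multiset.mem_cons_of_mem hB))

lemma Struct.mono {d : ℕ} {S S' : Finset Z} (h : Struct d S) (hs : S' ⊆ S) : Struct d S' :=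
  fun f f' hf hf' he ho => h f f' hf hf' he (ho.mono hs)

lemma Fac.add {f g : Multiset (Multiset Z)} (hf : Fac f) (hg : Fac g) : Fac (f + g) := by
  intro A hA
  rcases Multiset.mem_add.1 hA with h | h
  exacts [hf A h, hg A h]

lemma Fac.nsmul {f : Multiset (Multiset Z)} (hf : Fac f) (n : ℕ) : Fac (n • f) :=
  fun A hA => hf A (Multiset.mem_of_mem_nsmul hA)

lemma Fac.single {A : Multiset Z} (hA : At A) : Fac ({A} : Multiset (Multiset Z)) := by
  intro B hB; rw [Multiset.mem_singleton] at hB; rwa [hB]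

lemma fac_zero : Fac (0 : Multiset (Multiset Z)) := by intro A hA; simp at hA

lemma Fac.sum_zero {f : Multiset (Multiset Z)} (hf : Fac f) : f.sum.sum = 0 := by
  induction f using Multiset.induction with
  | empty => simp
  | cons A f ih =>
    rw [Multiset.sum_cons, Multiset.sum_add, (hf A (Multiset.mem_cons_self _ _)).2.1,
      ih fun B hB => hf B (Multiset.mem_cons_of_mem hB), add_zero]

lemma sub_sum {A B : Multiset Z} (h : A ≤ B) : (B - A).sum = B.sum - A.sum := by
  obtain ⟨C, rfl⟩ := Multiset.le_iff_exists_add.1 h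
  simp

lemma exists_fac (B : Multiset Z) (hB : B.sum = 0) : ∃ f, Fac f ∧ f.sum = B := by
  induction hn : B.card using Nat.strong_induction_on generalizing B with
  | _ n ih =>
    by_cases h0 : B = 0
    · exact ⟨0, fac_zero, by simp [h0]⟩
    by_cases hA : At B
    · exact ⟨{B}, Fac.single hA, by simp⟩
    have : ∃ T ≤ B, T.sum = 0 ∧ T ≠ 0 ∧ T ≠ B := by
      by_contra! hc
      exact hA ⟨h0, hB, fun T hT hs => by
        by_cases hT0 : T = 0
        · exact Or.inl hT0
        · exact Or.inr (hc T hT hs hT0)⟩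
    obtain ⟨T, hT, hs, hT0, hTB⟩ := this
    have hlt : T.card < B.card := Multiset.card_lt_card (lt_of_le_of_ne hT hTB)
    have hpos : 0 < T.card := Multiset.card_pos.2 hT0
    obtain ⟨f, hf, hfs⟩ := ih T.card (hn ▸ hlt) T hs rfl
    obtain ⟨g, hg, hgs⟩ := ih (B - T).card (by rw [Multiset.card_sub hT]; omega) (B - T)
      (by rw [sub_sum hT, hB, hs, sub_zero]) rfl
    exact ⟨f + g, hf.add hg, by rw [Multiset.sum_add, hfs, hgs, add_tsub_cancel_of_le hT]⟩

lemma fac_pos {f : Multiset (Multiset Z)} (h : f.sum ≠ 0) : 0 < f.card := by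
  rw [Multiset.card_pos]; rintro rfl; simp at h

lemma At.eq_of_le {A B : Multiset Z} (hA : At A) (hB : B ≤ A) (hs : B.sum = 0) (h0 : B ≠ 0) :
    B = A := (hA.2.2 B hB hs).resolve_left h0

/-- factorization of an atom -/
lemma At.fac_unique {A : Multiset Z} (hA : At A) {f : Multiset (Multiset Z)} (hf : Fac f)
    (h : f.sum = A) : f = {A} := by
  have hne : f ≠ 0 := by rintro rfl; exact hA.1 (by simpa using h.symm)
  obtain ⟨B, hB⟩ := Multiset.exists_mem_of_ne_zero hne
  obtain ⟨f', rfl⟩ := Multiset.exists_cons_of_mem hB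
  rw [Multiset.sum_cons] at h
  have hBA : B = A := hA.eq_of_le (h ▸ Multiset.le_add_right _ _) (hf B hB).2.1 (hf B hB).1
  subst hBA
  have h0 : f'.sum = 0 := by simpa using h
  have : f' = 0 := by
    by_contra hc
    obtain ⟨C, hC⟩ := Multiset.exists_mem_of_ne_zero hc
    exact (hf C (Multiset.mem_cons_of_mem hC)).1
      (Multiset.le_zero.1 (h0 ▸ Multiset.le_sum_of_mem hC))
  simp [this]

lemma at_of_fac_card_one {f : Multiset (Multiset Z)} (hf : Fac f) (h : f.card = 1) :
    At f.sum := by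
  obtain ⟨A, rfl⟩ := Multiset.card_eq_one.1 h
  simpa using hf A (by simp)

lemma At.zero_mem {A : Multiset Z} (hA : At A) (h : (0 : Z) ∈ A) : A = {0} :=
  (hA.eq_of_le (Multiset.singleton_le.2 h) (by simp) (by simp)).symm

lemma At.two_le_card {A : Multiset Z} (hA : At A) (h : A ≠ {0}) : 2 ≤ A.card := by
  by_contra hc
  have : A.card = 0 ∨ A.card = 1 := by omega
  rcases this with h0 | h1
  · exact hA.1 (Multiset.card_eq_zero.1 h0)
  · obtain ⟨a, rfl⟩ := Multiset.card_eq_one.1 h1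
    have := hA.2.1
    simp at this
    simp [this] at h

lemma at_zero : At ({0} : Multiset Z) := by
  refine ⟨by simp, by simp, fun T hT _ => ?_⟩
  rcases Multiset.le_singleton.1 hT with h | h
  exacts [Or.inl h, Or.inr h]

lemma At.neg_pair {A : Multiset Z} (hA : At A) {g : Z} (h1 : g ∈ A) (h2 : -g ∈ A)
    (hne : g ≠ -g) : A = {g, -g} := by
  have : ({g, -g} : Multiset Z) ≤ A := by
    rw [Multiset.insert_eq_cons, Multiset.cons_le_of_notMem (by simpa using hne)]
    simp [h1, h2]
  exact (hA.eq_of_le this (by simp) (by simp)).symm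

lemma at_pair {g : Z} (h0 : g ≠ 0) : At ({g, -g} : Multiset Z) := by
  refine ⟨by simp, by simp, fun T hT hs => ?_⟩
  have hc := Multiset.card_le_card hT
  by_cases h2 : T.card = 2
  · right; exact Multiset.eq_of_le_of_card_le hT (by simp [h2])
  have h3 : T.card = 0 ∨ T.card = 1 := by simp at hc; omega
  rcases h3 with h | h
  · left; exact Multiset.card_eq_zero.1 h
  · obtain ⟨a, rfl⟩ := Multiset.card_eq_one.1 h
    simp at hs hT
    rcases hT with rfl | rfl
    · exact absurd hs h0
    · exact absurd (neg_eq_zero.1 hs) h0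

/-- powers of a single element -/
lemma at_pow {h : Z} (ho : 0 < addOrderOf h) : At (addOrderOf h • ({h} : Multiset Z)) := by
  refine ⟨?_, by simp [Multiset.sum_nsmul, addOrderOf_nsmul_eq_zero], fun T hT hs => ?_⟩
  · intro hc; have := congrArg Multiset.card hc
    rw [Multiset.card_nsmul, Multiset.card_singleton, Multiset.card_zero] at this; omega
  · rw [Multiset.nsmul_singleton] at hT ⊢
    obtain ⟨m, hm, rfl⟩ := Multiset.le_replicate_iff.1 hT
    simp only [Multiset.sum_replicate] at hs
    have hd := addOrderOf_dvd_of_nsmul_eq_zero hs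
    rcases Nat.eq_zero_or_pos m with h0 | h0
    · left; rw [h0]; simp
    · right; rw [le_antisymm hm (Nat.le_of_dvd h0 hd)]

end Basic
end ZS

open scoped Classical
set_option linter.unusedSectionVars false

namespace ZS

section Fin
variable {Z : Type*} [AddCommGroup Z] [Fintype Z]

/-- exponent -/
noncomputable abbrev ex (Z : Type*) [AddCommGroup Z] : ℕ := AddMonoid.exponent Z

noncomputable def wt (h : Z) : ℕ := ex Z / addOrderOf h

/-- scaled cross number -/
noncomputable def ck (B : Multiset Z) : ℕ := (B.map wt).sum

lemma ex_pos : 0 < ex Z := Nat.pos_of_ne_zero AddMonoid.exponent_ne_zero_of_finite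

lemma ord_pos (h : Z) : 0 < addOrderOf h := addOrderOf_pos h

lemma ord_mul_wt (h : Z) : addOrderOf h * wt h = ex Z :=
  Nat.mul_div_cancel' (AddMonoid.addOrder_dvd_exponent h)

lemma ex_smul (h : Z) : ex Z • h = 0 := AddMonoid.exponent_nsmul_eq_zero h

lemma wt_pos (h : Z) : 0 < wt h := by
  have := ord_mul_wt h
  have h2 := ex_pos (Z := Z)
  refine Nat.pos_of_ne_zero fun hc => ?_
  rw [hc] at this; omega

lemma ord_le_ex (h : Z) : addOrderOf h ≤ ex Z :=
  Nat.le_of_dvd ex_pos (AddMonoid.addOrder_dvd_exponent h)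

@[simp] lemma ck_zero : ck (0 : Multiset Z) = 0 := rfl
@[simp] lemma ck_add (A B : Multiset Z) : ck (A + B) = ck A + ck B := by simp [ck]
@[simp] lemma ck_nsmul (n : ℕ) (A : Multiset Z) : ck (n • A) = n * ck A := by
  simp [ck, Multiset.map_nsmul, Multiset.sum_nsmul]
@[simp] lemma ck_singleton (h : Z) : ck ({h} : Multiset Z) = wt h := by simp [ck]
@[simp] lemma ck_cons (h : Z) (A : Multiset Z) : ck (h ::ₘ A) = wt h + ck A := by simp [ck]

lemma ck_sum (f : Multiset (Multiset Z)) : ck f.sum = (f.map ck).sum := by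
  induction f using Multiset.induction with
  | empty => simp
  | cons A f ih => simp [ih]

lemma ck_finset_sum {ι : Type*} (s : Finset ι) (f : ι → Multiset Z) :
    ck (∑ i ∈ s, f i) = ∑ i ∈ s, ck (f i) := by
  induction s using Finset.induction with
  | empty => simp
  | insert a s ha ih => simp [Finset.sum_insert ha, ih]

lemma card_le_ck (B : Multiset Z) : B.card ≤ ck B := by
  induction B using Multiset.induction with
  | empty => simp
  | cons a s ih => have := wt_pos a; simp; omega

lemma ck_real (B : Multiset Z) : (ck B : ℝ) = ex Z * crossNum B := by
  induction B using Multiset.induction with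
  | empty => simp [crossNum]
  | cons a s ih =>
    have h1 : crossNum (a ::ₘ s) = 1 / (addOrderOf a : ℝ) + crossNum s := by simp [crossNum]
    have h2 := ord_mul_wt a
    have h3 : (addOrderOf a : ℝ) ≠ 0 := by exact_mod_cast (ord_pos a).ne'
    rw [h1, ck_cons, Nat.cast_add, ih, ← h2]
    push_cast
    field_simp

/-- multiset with given multiplicities -/
noncomputable def mk (c : Z → ℕ) : Multiset Z := ∑ h, c h • ({h} : Multiset Z)

@[simp] lemma count_mk (c : Z → ℕ) (h : Z) : (mk c).count h = c h := by
  simp [mk, Multiset.count_sum', Multiset.count_singleton]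

lemma mk_count (B : Multiset Z) : mk (fun h => B.count h) = B := by
  ext h; simp

lemma sum_mk (c : Z → ℕ) : (mk c).sum = ∑ h, c h • h := by
  have : ∀ s : Finset Z, (∑ h ∈ s, c h • ({h} : Multiset Z)).sum = ∑ h ∈ s, c h • h := by
    intro s
    induction s using Finset.induction with
    | empty => simp
    | insert a s ha ih => rw [Finset.sum_insert ha, Finset.sum_insert ha, Multiset.sum_add, ih]; simp [Multiset.sum_nsmul]
  exact this _

lemma ck_mk (c : Z → ℕ) : ck (mk c) = ∑ h, c h * wt h := by
  simp [mk, ck_finset_sum]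

lemma sum_eq_count (B : Multiset Z) : B.sum = ∑ h, B.count h • h := by
  conv_lhs => rw [← mk_count B]
  rw [sum_mk]

lemma ck_eq_count (B : Multiset Z) : ck B = ∑ h, B.count h * wt h := by
  conv_lhs => rw [← mk_count B]
  rw [ck_mk]

lemma card_eq_count (B : Multiset Z) : B.card = ∑ h, B.count h := by
  rw [← Multiset.toFinset_sum_count_eq]
  exact Finset.sum_subset (Finset.subset_univ _) (by intro x _ hx; simpa using hx)

lemma mem_mk {c : Z → ℕ} {h : Z} : h ∈ mk c ↔ 0 < c h := by
  rw [← Multiset.count_pos, count_mk]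

lemma pow_le_iff {m : ℕ} {h : Z} {B : Multiset Z} :
    m • ({h} : Multiset Z) ≤ B ↔ m ≤ B.count h := by
  rw [Multiset.nsmul_singleton, Multiset.le_count_iff_replicate_le]

lemma At.count_le {A : Multiset Z} (hA : At A) (h : Z) : A.count h ≤ addOrderOf h := by
  by_contra hc
  push Not at hc
  have h1 := at_pow (ord_pos h)
  have := hA.eq_of_le (pow_le_iff.2 hc.le) h1.2.1 h1.1
  rw [← this, Multiset.count_nsmul, Multiset.count_singleton_self] at hc
  omega

lemma At.eq_pow {A : Multiset Z} (hA : At A) {h : Z} (hc : addOrderOf h ≤ A.count h) :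
    A = addOrderOf h • ({h} : Multiset Z) := by
  have h1 := at_pow (ord_pos h)
  exact (hA.eq_of_le (pow_le_iff.2 hc) h1.2.1 h1.1).symm

lemma ck_pow (h : Z) : ck (addOrderOf h • ({h} : Multiset Z)) = ex Z := by
  simp [ord_mul_wt]

lemma At.card_le {A : Multiset Z} (hA : At A) : A.card ≤ Fintype.card Z * ex Z := by
  rw [card_eq_count]
  calc _ ≤ ∑ h : Z, ex Z := Finset.sum_le_sum fun h _ => (hA.count_le h).trans (ord_le_ex h)
    _ = _ := by simp

lemma at_finite : {A : Multiset Z | At A}.Finite := by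
  apply Set.Finite.subset (Set.finite_range
    (fun c : Z → Fin (ex Z + 1) => mk (fun h => (c h : ℕ))))
  intro A hA
  refine ⟨fun h => ⟨A.count h, ?_⟩, mk_count A⟩
  have := (At.count_le hA h).trans (ord_le_ex h)
  omega

/-- half-factorial and LCN conditions -/
def HF (S : Finset Z) : Prop := ∀ A, At A → Over S A → ck A = ex Z
def LCN (S : Finset Z) : Prop := ∀ A, At A → Over S A → ex Z ≤ ck A

/-- A^N as product of powers -/
noncomputable def powFac (B : Multiset Z) : Multiset (Multiset Z) :=
  ∑ h, (B.count h * wt h) • ({addOrderOf h • ({h} : Multiset Z)} : Multiset (Multiset Z))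

lemma msum_finset {ι : Type*} (s : Finset ι) (f : ι → Multiset (Multiset Z)) :
    (∑ i ∈ s, f i).sum = ∑ i ∈ s, (f i).sum := by
  induction s using Finset.induction with
  | empty => simp
  | insert a s ha ih => simp [Finset.sum_insert ha, ih]

lemma mcard_finset {ι : Type*} {α : Type*} (s : Finset ι) (f : ι → Multiset α) :
    (∑ i ∈ s, f i).card = ∑ i ∈ s, (f i).card := by
  induction s using Finset.induction with
  | empty => simp
  | insert a s ha ih => simp [Finset.sum_insert ha, ih]

lemma powFac_fac (B : Multiset Z) : Fac (powFac B) := by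
  intro A hA
  rw [powFac, Multiset.mem_sum] at hA
  obtain ⟨h, _, hA⟩ := hA
  have := Multiset.mem_of_mem_nsmul hA
  rw [Multiset.mem_singleton] at this
  rw [this]; exact at_pow (ord_pos h)

lemma powFac_card (B : Multiset Z) : (powFac B).card = ck B := by
  rw [powFac, mcard_finset, ck_eq_count]; simp

lemma powFac_sum (B : Multiset Z) : (powFac B).sum = ex Z • B := by
  rw [powFac, msum_finset]
  ext x
  rw [Multiset.count_sum', Multiset.count_nsmul]
  rw [Finset.sum_eq_single x]
  · simp [Multiset.sum_nsmul]
    rw [← ord_mul_wt x]; ring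
  · intro b _ hb
    simp [Multiset.sum_nsmul, hb.symm]
  · simp

/-- for an atom, or any factorization, cross number mod d -/
lemma Struct.ck_modEq {d : ℕ} {S : Finset Z} (hS : Struct d S) {f : Multiset (Multiset Z)}
    (hf : Fac f) (ho : Over S f.sum) : ex Z * f.card ≡ ck f.sum [MOD d] := by
  have := hS (ex Z • f) (powFac f.sum) (hf.nsmul _) (powFac_fac _)
    (by rw [powFac_sum, Multiset.sum_nsmul]) (by rw [Multiset.sum_nsmul]; exact ho.nsmul _)
  rwa [Multiset.card_nsmul, powFac_card] at this

lemma Struct.atom {d : ℕ} {S : Finset Z} (hS : Struct d S) {A : Multiset Z}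
    (hA : At A) (ho : Over S A) : ∃ σ : ℤ, (ck A : ℤ) = ex Z + d * σ := by
  have := hS.ck_modEq (Fac.single hA) (by simpa using ho)
  simp at this
  obtain ⟨c, hc⟩ := this.dvd
  exact ⟨c, by linarith⟩

lemma ck_fac_lower {S : Finset Z} (hS : LCN S) {f : Multiset (Multiset Z)} (hf : Fac f)
    (ho : Over S f.sum) : ex Z * f.card ≤ ck f.sum := by
  induction f using Multiset.induction with
  | empty => simp
  | cons A f ih =>
    rw [Multiset.sum_cons] at ho ⊢
    have h1 := hS A (hf A (Multiset.mem_cons_self _ _)) (ho.le (Multiset.le_add_right _ _))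
    have h2 := ih (fun B hB => hf B (Multiset.mem_cons_of_mem hB)) (ho.le (Multiset.le_add_left _ _))
    simp; linarith

lemma LCN.mono {S S' : Finset Z} (h : LCN S) (hs : S' ⊆ S) : LCN S' :=
  fun A hA ho => h A hA (ho.mono hs)

lemma HF.mono {S S' : Finset Z} (h : HF S) (hs : S' ⊆ S) : HF S' :=
  fun A hA ho => h A hA (ho.mono hs)

/-- Atoms of small cross number -/
lemma ck_small {d : ℕ} {S : Finset Z} (hS : Struct d S) {A : Multiset Z}
    (hA : At A) (ho : Over S A) (hlt : ck A < ex Z) : d + 2 ≤ ex Z ∧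
      (ex Z = d + 2 → ∃ g, A = {g, -g} ∧ addOrderOf g = ex Z) := by
  obtain ⟨σ, hσ⟩ := hS.atom hA ho
  have h0 : A ≠ {0} := by
    rintro rfl
    have := ord_mul_wt (0 : Z)
    simp at this hlt; omega
  have h2 := hA.two_le_card h0
  have h3 := card_le_ck A
  have hσ0 : d * σ < 0 := by
    have : (ck A : ℤ) < ex Z := by exact_mod_cast hlt
    linarith
  have hneg : σ ≤ -1 := by
    by_contra hc
    have : 0 ≤ (d : ℤ) * σ := mul_nonneg (by positivity) (by omega)
    omega
  have h4 : (d : ℤ) * σ ≤ - d := by nlinarith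
  refine ⟨by omega, fun he => ?_⟩
  have h5 : A.card = 2 := by omega
  have h6 : ck A = 2 := by omega
  obtain ⟨a, b, rfl⟩ := Multiset.card_eq_two.1 h5
  have hs := hA.2.1
  simp at hs
  have hb : b = -a := by rw [eq_neg_iff_add_eq_zero, add_comm]; exact hs
  subst hb
  refine ⟨a, rfl, ?_⟩
  have h7 : wt a = 1 := by
    have := wt_pos a
    have := wt_pos (-a)
    simp at h6; omega
  have := ord_mul_wt a
  rw [h7] at this; omega

end Fin
end ZS

open scoped Classical
set_option linter.unusedSectionVars false

namespace ZS

section Rel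
variable {Z : Type*} [AddCommGroup Z] [Fintype Z]

/-- integer relations supported on S -/
def Q (S : Finset Z) : AddSubgroup (Z → ℤ) where
  carrier := {x | (∀ h, h ∉ S → x h = 0) ∧ ∑ h, x h • h = 0}
  zero_mem' := by simp
  add_mem' := by
    rintro x y ⟨hx, hx'⟩ ⟨hy, hy'⟩
    refine ⟨fun h hh => by simp [hx h hh, hy h hh], ?_⟩
    simp [add_smul, Finset.sum_add_distrib, hx', hy']
  neg_mem' := by
    rintro x ⟨hx, hx'⟩
    refine ⟨fun h hh => by simp [hx h hh], ?_⟩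
    simp [hx']

lemma mem_Q {S : Finset Z} {x : Z → ℤ} :
    x ∈ Q S ↔ (∀ h, h ∉ S → x h = 0) ∧ ∑ h, x h • h = 0 := Iff.rfl

lemma Q_mono {S S' : Finset Z} (h : S ⊆ S') : Q S ≤ Q S' :=
  fun _ hx => ⟨fun g hg => hx.1 g fun hc => hg (h hc), hx.2⟩

noncomputable def cnt (B : Multiset Z) : Z → ℤ := fun h => (B.count h : ℤ)

@[simp] lemma cnt_zero : cnt (0 : Multiset Z) = 0 := by ext; simp [cnt]
@[simp] lemma cnt_add (A B : Multiset Z) : cnt (A + B) = cnt A + cnt B := by ext; simp [cnt]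
@[simp] lemma cnt_nsmul (n : ℕ) (A : Multiset Z) : cnt (n • A) = n • cnt A := by
  ext; simp [cnt]

lemma cnt_mem {S : Finset Z} {B : Multiset Z} (ho : Over S B) (hs : B.sum = 0) : cnt B ∈ Q S := by
  refine ⟨fun h hh => ?_, ?_⟩
  · simp only [cnt, Nat.cast_eq_zero, Multiset.count_eq_zero]
    exact fun hc => hh (ho h hc)
  · rw [sum_eq_count] at hs
    simpa [cnt] using hs

noncomputable def sg (d : ℕ) (A : Multiset Z) : ℤ := ((ck A : ℤ) - ex Z) / d

lemma sg_eq {d : ℕ} (hd : 0 < d) {A : Multiset Z} {σ : ℤ} (h : (ck A : ℤ) = ex Z + d * σ) :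
    sg d A = σ := by
  rw [sg, h, add_sub_cancel_left, Int.mul_ediv_cancel_left]
  exact_mod_cast hd.ne'

lemma Struct.sg {d : ℕ} (hd : 0 < d) {S : Finset Z} (hS : Struct d S) {A : Multiset Z}
    (hA : At A) (ho : Over S A) : (ck A : ℤ) = ex Z + d * sg d A := by
  obtain ⟨σ, hσ⟩ := hS.atom hA ho
  rw [sg_eq hd hσ]; exact hσ

lemma Struct.sg_sum {d : ℕ} (hd : 0 < d) {S : Finset Z} (hS : Struct d S)
    {f : Multiset (Multiset Z)} (hf : Fac f) (ho : Over S f.sum) :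
    (ck f.sum : ℤ) = ex Z * f.card + d * (f.map (ZS.sg d)).sum := by
  induction f using Multiset.induction with
  | empty => simp
  | cons A f ih =>
    rw [Multiset.sum_cons] at ho ⊢
    have h1 := hS.sg hd (hf A (Multiset.mem_cons_self _ _)) (ho.le (Multiset.le_add_right _ _))
    have h2 := ih (fun B hB => hf B (Multiset.mem_cons_of_mem hB)) (ho.le (Multiset.le_add_left _ _))
    simp [h1, h2]; ring

noncomputable def tau (d : ℕ) (B : Multiset Z) : ZMod (ex Z) :=
  if h : B.sum = 0 then ((((exists_fac B h).choose.map (sg d)).sum : ℤ) : ZMod (ex Z)) else 0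

lemma Struct.tau_eq {d : ℕ} (hd : 0 < d) {S : Finset Z} (hS : Struct d S)
    {f : Multiset (Multiset Z)} (hf : Fac f) (ho : Over S f.sum) :
    tau d f.sum = (((f.map (ZS.sg d)).sum : ℤ) : ZMod (ex Z)) := by
  have h0 : f.sum.sum = 0 := hf.sum_zero
  rw [tau, dif_pos h0]
  obtain ⟨hg, hgs⟩ := (exists_fac f.sum h0).choose_spec
  set g := (exists_fac f.sum h0).choose
  have h1 := hS.sg_sum hd hf ho
  have h2 := hS.sg_sum hd hg (by rw [hgs]; exact ho)
  rw [hgs, h1] at h2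
  have h3 := hS f g hf hg hgs.symm ho
  obtain ⟨c, hc⟩ := h3.dvd
  rw [ZMod.intCast_eq_intCast_iff_dvd_sub]
  refine ⟨c, ?_⟩
  have hd' : (d : ℤ) ≠ 0 := by exact_mod_cast hd.ne'
  apply mul_left_cancel₀ hd'
  linear_combination h2 + (ex Z : ℤ) * hc

lemma Struct.tau_add {d : ℕ} (hd : 0 < d) {S : Finset Z} (hS : Struct d S) {A B : Multiset Z}
    (hA : A.sum = 0) (hB : B.sum = 0) (hoA : Over S A) (hoB : Over S B) :
    tau d (A + B) = tau d A + tau d B := by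
  obtain ⟨f, hf, rfl⟩ := exists_fac A hA
  obtain ⟨g, hg, rfl⟩ := exists_fac B hB
  rw [← Multiset.sum_add, hS.tau_eq hd (hf.add hg) (by rw [Multiset.sum_add]; exact hoA.add hoB),
    hS.tau_eq hd hf hoA, hS.tau_eq hd hg hoB]
  simp

lemma Struct.tau_ex {d : ℕ} (hd : 0 < d) {S : Finset Z} (hS : Struct d S) {M : Multiset Z}
    (hM : Over S M) : tau d (ex Z • M) = 0 := by
  rw [← powFac_sum, hS.tau_eq hd (powFac_fac M) (by rw [powFac_sum]; exact hM.nsmul _)]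
  rw [Multiset.sum_eq_zero]
  · simp
  intro y hy
  obtain ⟨A, hA, rfl⟩ := Multiset.mem_map.1 hy
  rw [powFac, Multiset.mem_sum] at hA
  obtain ⟨h, _, hA⟩ := hA
  have := Multiset.mem_of_mem_nsmul hA
  rw [Multiset.mem_singleton] at this
  rw [this]
  exact sg_eq hd (by rw [ck_pow]; simp)

/-- reduced representative of a relation -/
noncomputable def red (x : Z → ℤ) : Multiset Z := mk fun h => (x h % ex Z).toNat

lemma red_cnt (x : Z → ℤ) (h : Z) : ((red x).count h : ℤ) = x h % ex Z := by
  rw [red, count_mk, Int.toNat_of_nonneg]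
  exact Int.emod_nonneg _ (by exact_mod_cast (ex_pos (Z := Z)).ne')

lemma ex_zsmul_mul (a : ℤ) (h : Z) : ((ex Z : ℤ) * a) • h = 0 := by
  rw [mul_comm, mul_smul]; simp [ex_smul]

lemma red_sum (x : Z → ℤ) : (red x).sum = ∑ h, x h • h := by
  rw [sum_eq_count]
  refine Finset.sum_congr rfl fun h _ => ?_
  rw [← natCast_zsmul, red_cnt]
  conv_rhs => rw [← Int.emod_add_mul_ediv (x h) (ex Z)]
  rw [add_smul, ex_zsmul_mul, add_zero]

lemma red_over {S : Finset Z} {x : Z → ℤ} (hx : ∀ h, h ∉ S → x h = 0) : Over S (red x) := by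
  intro h hh
  by_contra hc
  have h1 := red_cnt x h
  rw [hx h hc] at h1
  have := Multiset.count_pos.2 hh
  rw [Int.zero_emod] at h1; omega

lemma red_sum_zero {S : Finset Z} {x : Z → ℤ} (hx : x ∈ Q S) : (red x).sum = 0 := by
  rw [red_sum]; exact hx.2

/-- two zero-sum sequences congruent mod the exponent -/
lemma Struct.tau_congr {d : ℕ} (hd : 0 < d) {S : Finset Z} (hS : Struct d S) {A B : Multiset Z}
    (hA : A.sum = 0) (hB : B.sum = 0) (hoA : Over S A) (hoB : Over S B)
    (h : ∀ g, (ex Z : ℤ) ∣ (A.count g : ℤ) - B.count g) : tau d A = tau d B := by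
  -- A + N•M = B + N•M'
  choose c hc using h
  let M := mk fun g => (-(c g)).toNat
  let M' := mk fun g => (c g).toNat
  have hcz : ∀ g, g ∉ S → c g = 0 := by
    intro g hg
    have h1 : A.count g = 0 := Multiset.count_eq_zero.2 fun hc => hg (hoA g hc)
    have h2 : B.count g = 0 := Multiset.count_eq_zero.2 fun hc => hg (hoB g hc)
    have := hc g
    rw [h1, h2] at this
    have h3 := ex_pos (Z := Z)
    simp only [Nat.cast_zero, sub_zero] at this
    rcases mul_eq_zero.1 this.symm with h | h
    · have : ex Z = 0 := by exact_mod_cast h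
      omega
    · exact h
  have hM : Over S M := by
    intro g hg
    by_contra hh
    have := mem_mk.1 hg
    rw [hcz g hh] at this; simp at this
  have hM' : Over S M' := by
    intro g hg
    by_contra hh
    have := mem_mk.1 hg
    rw [hcz g hh] at this; simp at this
  have e : A + ex Z • M = B + ex Z • M' := by
    ext g
    have h1 := hc g
    zify
    simp only [Multiset.count_add, Multiset.count_nsmul, M, M', count_mk]
    push_cast
    have h2 : ((c g).toNat : ℤ) - ((-(c g)).toNat : ℤ) = c g := Int.toNat_sub_toNat_neg _
    linear_combination h1 - (ex Z : ℤ) * h2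
  have hz : ∀ M : Multiset Z, (ex Z • M).sum = 0 := by
    intro M; rw [Multiset.sum_nsmul, ex_smul]
  have := congrArg (tau d) e
  rwa [hS.tau_add hd hA (hz _) hoA (hM.nsmul _), hS.tau_add hd hB (hz _) hoB (hM'.nsmul _),
    hS.tau_ex hd hM, hS.tau_ex hd hM', add_zero, add_zero] at this

structure SB (d : ℕ) (S : Finset Z) (s : (Z → ℤ) → ZMod (ex Z)) : Prop where
  add : ∀ x y, x ∈ Q S → y ∈ Q S → s (x + y) = s x + s y
  atom : ∀ A, At A → Over S A → s (cnt A) = (sg d A : ℤ)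

theorem Struct.exists_sb {d : ℕ} (hd : 0 < d) {S : Finset Z} (hS : Struct d S) :
    ∃ s, SB d S s := by
  refine ⟨fun x => tau d (red x), fun x y hx hy => ?_, fun A hA ho => ?_⟩
  · rw [← hS.tau_add hd (red_sum_zero hx) (red_sum_zero hy) (red_over hx.1) (red_over hy.1)]
    refine hS.tau_congr hd (red_sum_zero (add_mem hx hy)) ?_ (red_over (add_mem hx hy).1)
      ((red_over hx.1).add (red_over hy.1)) fun g => ?_
    · rw [Multiset.sum_add, red_sum_zero hx, red_sum_zero hy, add_zero]
    · rw [Multiset.count_add, Nat.cast_add, red_cnt, red_cnt, red_cnt, Pi.add_apply]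
      exact Int.ModEq.dvd ((Int.add_emod _ _ _).symm ▸ (Int.mod_modEq _ _).symm)
  · have h1 := cnt_mem ho hA.2.1
    have : tau d (red (cnt A)) = tau d A := by
      refine hS.tau_congr hd (red_sum_zero h1) hA.2.1 (red_over h1.1) ho fun g => ?_
      rw [red_cnt]
      exact Int.ModEq.dvd (Int.mod_modEq _ _).symm
    show tau d (red (cnt A)) = _
    rw [this]
    have := hS.tau_eq hd (Fac.single hA) (by simpa using ho)
    simpa using this

namespace SB
variable {d : ℕ} {S : Finset Z} {s : (Z → ℤ) → ZMod (ex Z)}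

lemma zero (h : SB d S s) : s 0 = 0 := by
  have := h.add 0 0 (zero_mem _) (zero_mem _)
  simpa using this

lemma neg (h : SB d S s) {x : Z → ℤ} (hx : x ∈ Q S) : s (-x) = - s x := by
  have := h.add x (-x) hx (neg_mem hx)
  rw [add_neg_cancel, h.zero] at this
  exact (neg_eq_of_add_eq_zero_right this.symm).symm

lemma sub (h : SB d S s) {x y : Z → ℤ} (hx : x ∈ Q S) (hy : y ∈ Q S) : s (x - y) = s x - s y := by
  rw [sub_eq_add_neg, h.add _ _ hx (neg_mem hy), h.neg hy, sub_eq_add_neg]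

lemma nsmul (h : SB d S s) {x : Z → ℤ} (hx : x ∈ Q S) (n : ℕ) : s (n • x) = n * s x := by
  induction n with
  | zero => simp [h.zero]
  | succ n ih => rw [succ_nsmul, h.add _ _ (nsmul_mem hx n) hx, ih]; push_cast; ring

lemma zsmul (h : SB d S s) {x : Z → ℤ} (hx : x ∈ Q S) (n : ℤ) : s (n • x) = n * s x := by
  cases n with
  | ofNat n => simpa using h.nsmul hx n
  | negSucc n =>
    rw [negSucc_zsmul, h.neg (nsmul_mem hx _), h.nsmul hx]
    push_cast
    ring

lemma mono (h : SB d S s) {S' : Finset Z} (hs : S' ⊆ S) : SB d S' s :=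
  ⟨fun x y hx hy => h.add x y (Q_mono hs hx) (Q_mono hs hy), fun A hA ho => h.atom A hA (ho.mono hs)⟩

lemma fac (h : SB d S s) {f : Multiset (Multiset Z)} (hf : Fac f) (ho : Over S f.sum) :
    s (cnt f.sum) = (((f.map (ZS.sg d)).sum : ℤ) : ZMod (ex Z)) := by
  induction f using Multiset.induction with
  | empty => simp [h.zero]
  | cons A f ih =>
    rw [Multiset.sum_cons] at ho ⊢
    have hA := hf A (Multiset.mem_cons_self _ _)
    have hf' : Fac f := fun B hB => hf B (Multiset.mem_cons_of_mem hB)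
    have o1 := ho.le (Multiset.le_add_right A f.sum)
    have o2 := ho.le (Multiset.le_add_left f.sum A)
    rw [cnt_add, h.add _ _ (cnt_mem o1 hA.2.1) (cnt_mem o2 hf'.sum_zero), h.atom A hA o1, ih hf' o2]
    simp

lemma pow (h : SB d S s) (hd : 0 < d) {g : Z} (hg : g ∈ S) :
    s (cnt (addOrderOf g • ({g} : Multiset Z))) = 0 := by
  rw [h.atom _ (at_pow (ord_pos g)), sg_eq (σ := 0) hd (by rw [ck_pow]; simp)]
  · simp
  · intro x hx
    have := Multiset.mem_of_mem_nsmul hx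
    rw [Multiset.mem_singleton] at this
    rwa [this]

/-- s only depends on x modulo orders -/
lemma congr (h : SB d S s) (hd : 0 < d) {x y : Z → ℤ} (hx : x ∈ Q S) (hy : y ∈ Q S)
    (hxy : ∀ g, (addOrderOf g : ℤ) ∣ x g - y g) : s x = s y := by
  choose c hc using hxy
  have hz : ∀ g, g ∉ S → c g = 0 := by
    intro g hg
    have := hc g
    rw [hx.1 g hg, hy.1 g hg] at this
    rcases mul_eq_zero.1 this.symm with h | h
    · have h3 := ord_pos g
      have : addOrderOf g = 0 := by exact_mod_cast h
      omega
    · exact h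
  have key : ∀ T : Finset Z, T ⊆ S →
      (∑ g ∈ T, c g • cnt (addOrderOf g • ({g} : Multiset Z))) ∈ Q S ∧
      s (∑ g ∈ T, c g • cnt (addOrderOf g • ({g} : Multiset Z))) = 0 := by
    intro T
    induction T using Finset.induction with
    | empty => intro _; simp [h.zero, zero_mem]
    | insert a T ha ih =>
      intro hT
      obtain ⟨h1, h2⟩ := ih fun x hx => hT (Finset.mem_insert_of_mem hx)
      have haS : a ∈ S := hT (Finset.mem_insert_self _ _)
      have h3 : cnt (addOrderOf a • ({a} : Multiset Z)) ∈ Q S := by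
        apply cnt_mem _ (at_pow (ord_pos a)).2.1
        intro x hx
        have := Multiset.mem_of_mem_nsmul hx
        rw [Multiset.mem_singleton] at this
        rwa [this]
      rw [Finset.sum_insert ha]
      refine ⟨add_mem (zsmul_mem h3 _) h1, ?_⟩
      rw [h.add _ _ (zsmul_mem h3 _) h1, h2, h.zsmul h3, h.pow hd haS]
      simp
  obtain ⟨h1, h2⟩ := key S (Finset.Subset.refl _)
  have e : x = y + ∑ g ∈ S, c g • cnt (addOrderOf g • ({g} : Multiset Z)) := by
    ext g
    rw [Pi.add_apply, Finset.sum_apply]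
    by_cases hg : g ∈ S
    · rw [Finset.sum_eq_single g]
      · simp [cnt]; linarith [hc g]
      · intro b _ hb; simp [cnt, hb.symm]
      · intro hc; exact absurd hg hc
    · rw [hx.1 g hg, hy.1 g hg, Finset.sum_eq_zero]
      · simp
      · intro b hb
        have : g ≠ b := fun hc => hg (hc ▸ hb)
        simp [cnt, this]
  rw [e, h.add _ _ hy h1, h2, add_zero]

lemma red_eq (h : SB d S s) (hd : 0 < d) {x : Z → ℤ} (hx : x ∈ Q S) :
    s (cnt (red x)) = s x := by
  refine h.congr hd (cnt_mem (red_over hx.1) (red_sum_zero hx)) hx fun g => ?_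
  simp only [cnt, red_cnt]
  refine dvd_trans ?_ (Int.ModEq.dvd (Int.mod_modEq (x g) (ex Z)).symm)
  exact_mod_cast AddMonoid.addOrder_dvd_exponent g

lemma hf_zero (h : SB d S s) (hd : 0 < d) (hS : HF S) {x : Z → ℤ} (hx : x ∈ Q S) : s x = 0 := by
  rw [← h.red_eq hd hx]
  obtain ⟨f, hf, hfs⟩ := exists_fac (red x) (red_sum_zero hx)
  have ho : Over S f.sum := by rw [hfs]; exact red_over hx.1
  rw [← hfs, h.fac hf ho, Multiset.sum_eq_zero]
  · simp
  intro y hy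
  obtain ⟨A, hA, rfl⟩ := Multiset.mem_map.1 hy
  exact sg_eq hd (by rw [hS A (hf A hA) (over_sum.1 ho A hA)]; simp)

end SB

end Rel
end ZS

open scoped Classical
set_option linter.unusedSectionVars false

namespace ZS

section Gen
variable {Z : Type*} [AddCommGroup Z] [Fintype Z]

/-- all p-ranks are at most r -/
def RkLe (r : ℕ) (Z : Type*) [AddCommGroup Z] [Fintype Z] : Prop :=
  ∀ p : ℕ, p.Prime → (Finset.univ.filter fun x : Z => p • x = 0).card ≤ p ^ r

lemma closure_rep {B : Finset Z} {z : Z} (hz : z ∈ AddSubgroup.closure (B : Set Z)) :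
    ∃ c : Z → ℤ, (∀ h, h ∉ B → c h = 0) ∧ ∑ h, c h • h = z := by
  induction hz using AddSubgroup.closure_induction with
  | mem x hx =>
    refine ⟨Pi.single x 1, fun h hh => ?_, ?_⟩
    · have : h ≠ x := fun hc => hh (hc ▸ hx)
      simp [this]
    · rw [Finset.sum_eq_single x]
      · simp
      · intro b _ hb; simp [hb]
      · simp
  | zero => exact ⟨0, by simp, by simp⟩
  | add x y _ _ hx hy =>
    obtain ⟨c, hc, rfl⟩ := hx
    obtain ⟨e, he, rfl⟩ := hy
    exact ⟨c + e, fun h hh => by simp [hc h hh, he h hh], by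
      simp [add_smul, Finset.sum_add_distrib]⟩
  | neg x _ hx =>
    obtain ⟨c, hc, rfl⟩ := hx
    exact ⟨-c, fun h hh => by simp [hc h hh], by simp⟩

lemma rep_closure {B : Finset Z} {c : Z → ℤ} (hc : ∀ h, h ∉ B → c h = 0) :
    ∑ h, c h • h ∈ AddSubgroup.closure (B : Set Z) := by
  refine sum_mem fun h _ => ?_
  by_cases hh : h ∈ B
  · exact zsmul_mem (AddSubgroup.subset_closure hh) _
  · rw [hc h hh, zero_smul]; exact zero_mem _

/-- independent modulo p in the subgroup generated by T -/
def PInd (p : ℕ) (T B : Finset Z) : Prop :=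
  ∀ c : Z → ℤ, (∀ h, h ∉ B → c h = 0) →
    (∃ y ∈ AddSubgroup.closure (T : Set Z), ∑ h, c h • h = p • y) → ∀ h, (p : ℤ) ∣ c h

lemma card_quot_eq {H : Type*} [AddCommGroup H] [Finite H] (p : ℕ) :
    Nat.card (H ⧸ (nsmulAddMonoidHom p : H →+ H).range) =
      Nat.card (nsmulAddMonoidHom p : H →+ H).ker := by
  have h1 := AddSubgroup.card_eq_card_quotient_mul_card_addSubgroup (nsmulAddMonoidHom p : H →+ H).range
  have h2 := AddSubgroup.card_eq_card_quotient_mul_card_addSubgroup (nsmulAddMonoidHom p : H →+ H).ker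
  have h3 : Nat.card (H ⧸ (nsmulAddMonoidHom p : H →+ H).ker) =
      Nat.card (nsmulAddMonoidHom p : H →+ H).range :=
    Nat.card_congr (QuotientAddGroup.quotientKerEquivRange _).toEquiv
  rw [h3] at h2
  rw [h2, mul_comm] at h1
  have hpos : 0 < Nat.card (nsmulAddMonoidHom p : H →+ H).range := Nat.card_pos
  exact (Nat.eq_of_mul_eq_mul_right hpos (by linarith)).symm

lemma card_ker_le (p : ℕ) (H : AddSubgroup Z) :
    Nat.card (nsmulAddMonoidHom p : H →+ H).ker ≤
      (Finset.univ.filter fun x : Z => p • x = 0).card := by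
  have h1 : (Finset.univ.filter fun x : Z => p • x = 0).card =
      Nat.card {x : Z // p • x = 0} := by
    rw [Nat.card_eq_fintype_card, Fintype.card_subtype]
  rw [h1]
  refine Nat.card_le_card_of_injective
    (fun x : (nsmulAddMonoidHom p : H →+ H).ker => (⟨((x : H) : Z), ?_⟩ : {x : Z // p • x = 0})) ?_
  · have := x.2
    rw [AddMonoidHom.mem_ker] at this
    have := congrArg (Subtype.val) this
    simpa using this
  · intro x y hxy
    simpa using hxy

lemma PInd.card_le {p r : ℕ} (hp : p.Prime) (hR : RkLe r Z) {T B : Finset Z} (hBT : B ⊆ T)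
    (hi : PInd p T B) : B.card ≤ r := by
  let H := AddSubgroup.closure (T : Set Z)
  let φ : (B → Fin p) → H ⧸ (nsmulAddMonoidHom p : H →+ H).range := fun c =>
    ((∑ b : B, (c b : ℕ) • (⟨b.1, AddSubgroup.subset_closure (hBT b.2)⟩ : H) : H) :
      H ⧸ (nsmulAddMonoidHom p : H →+ H).range)
  have hφ : Function.Injective φ := by
    intro c c' hcc
    rw [QuotientAddGroup.eq] at hcc
    obtain ⟨y, hy⟩ := hcc
    have h2 := hi (fun h => if hb : h ∈ B then ((c' ⟨h, hb⟩ : ℕ) : ℤ) - (c ⟨h, hb⟩ : ℕ) else 0)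
      (fun h hh => by simp [hh]) ⟨y, y.2, ?_⟩
    · funext b
      have h3 := h2 b.1
      rw [dif_pos b.2] at h3
      have h4 : ((c b : ℕ)) ≡ (c' b : ℕ) [MOD p] := (Nat.modEq_iff_dvd).2 h3
      exact Fin.ext (Nat.ModEq.eq_of_lt_of_lt h4 (c b).2 (c' b).2)
    · have h5 := congrArg Subtype.val hy
      simp only [nsmulAddMonoidHom_apply, AddSubgroup.coe_nsmul, AddSubgroup.coe_add,
        AddSubgroup.coe_neg, AddSubgroup.val_finset_sum] at h5
      rw [h5, ← Finset.sum_subset (Finset.subset_univ B) (by intro x _ hx; simp [hx])]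
      rw [← Finset.sum_coe_sort B, neg_add_eq_sub, ← Finset.sum_sub_distrib]
      refine Finset.sum_congr rfl fun b _ => ?_
      rw [dif_pos b.2, sub_smul]; simp
  have h1 := Nat.card_le_card_of_injective φ hφ
  rw [card_quot_eq] at h1
  have h2 := (h1.trans (card_ker_le p H)).trans (hR p hp)
  rw [Nat.card_eq_fintype_card, Fintype.card_fun, Fintype.card_fin, Fintype.card_coe] at h2
  exact (Nat.pow_le_pow_iff_right hp.one_lt).1 h2

lemma gen {p r : ℕ} (hp : p.Prime) (hR : RkLe r Z) {T B0 : Finset Z} (hB0 : B0 ⊆ T)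
    (hi : PInd p T B0) : ∃ B, B0 ⊆ B ∧ B ⊆ T ∧ B.card ≤ r ∧ ∃ m : ℕ, m.Coprime p ∧
      ∀ x ∈ AddSubgroup.closure (T : Set Z), m • x ∈ AddSubgroup.closure (B : Set Z) := by
  obtain ⟨B, hB, hmax⟩ := Finset.exists_max_image
    (T.powerset.filter fun B => B0 ⊆ B ∧ PInd p T B) Finset.card ⟨B0, by simp [hB0, hi]⟩
  simp only [Finset.mem_filter, Finset.mem_powerset] at hB hmax
  obtain ⟨hBT, hB0B, hBi⟩ := hB
  refine ⟨B, hB0B, hBT, hBi.card_le hp hR hBT, ordCompl[p] (ex Z),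
    (Nat.coprime_ordCompl hp (ex_pos (Z := Z)).ne').symm, ?_⟩
  have step1 : ∀ t ∈ T, ∃ b ∈ AddSubgroup.closure (B : Set Z),
      ∃ y ∈ AddSubgroup.closure (T : Set Z), t = b + p • y := by
    intro t ht
    by_cases htB : t ∈ B
    · exact ⟨t, AddSubgroup.subset_closure htB, 0, zero_mem _, by simp⟩
    have hni : ¬ PInd p T (insert t B) := by
      intro hc
      have := hmax (insert t B) ⟨Finset.insert_subset ht hBT,
        hB0B.trans (Finset.subset_insert _ _), hc⟩
      rw [Finset.card_insert_of_notMem htB] at this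
      omega
    unfold PInd at hni
    push Not at hni
    obtain ⟨c, hc, ⟨y, hy, hcy⟩, h0, hh0⟩ := hni
    have hsplit : ∑ h, c h • h = c t • t + ∑ h, (Function.update c t 0) h • h := by
      rw [← Finset.add_sum_erase _ _ (Finset.mem_univ t),
        ← Finset.add_sum_erase _ (fun h => (Function.update c t 0) h • h) (Finset.mem_univ t)]
      simp only [Function.update_self, zero_smul, zero_add]
      congr 1
      refine Finset.sum_congr rfl fun h hh => ?_
      rw [Function.update_of_ne (Finset.ne_of_mem_erase hh)]
    have hsupp : ∀ h, h ∉ B → Function.update c t 0 h = 0 := by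
      intro h hh
      by_cases hht : h = t
      · subst hht; simp
      · rw [Function.update_of_ne hht]; exact hc h (by simp [hh, hht])
    have hct : ¬ (p : ℤ) ∣ c t := by
      rintro ⟨k, hk⟩
      have := hBi (Function.update c t 0) hsupp ⟨y - k • t,
        sub_mem hy (zsmul_mem (AddSubgroup.subset_closure ht) _), by
          rw [hsplit] at hcy
          rw [smul_sub, ← hcy, hk, mul_smul]; simp⟩
      by_cases hht : h0 = t
      · subst hht; exact hh0 ⟨k, hk⟩
      · have := this h0; rw [Function.update_of_ne hht] at this; exact hh0 this
    have hcop : IsCoprime (c t) (p : ℤ) :=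
      ((Nat.prime_iff_prime_int.1 hp).coprime_iff_not_dvd.2 hct).symm
    obtain ⟨u, v, huv⟩ := hcop
    refine ⟨-(u • ∑ h, (Function.update c t 0) h • h), neg_mem (zsmul_mem (rep_closure hsupp) _),
      u • y + v • t, add_mem (zsmul_mem hy _) (zsmul_mem (AddSubgroup.subset_closure ht) _), ?_⟩
    have e1 : t = (u * c t + v * p) • t := by rw [huv, one_smul]
    rw [hsplit] at hcy
    have e2 : c t • t = p • y - ∑ h, (Function.update c t 0) h • h := by rw [← hcy]; abel
    conv_lhs => rw [e1]
    rw [add_smul, mul_smul, e2, smul_sub, smul_add, mul_smul, smul_comm u p y]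
    rw [natCast_zsmul, smul_comm v p t]
    abel
  have step2 : ∀ x ∈ AddSubgroup.closure (T : Set Z), ∃ b ∈ AddSubgroup.closure (B : Set Z),
      ∃ y ∈ AddSubgroup.closure (T : Set Z), x = b + p • y := by
    intro x hx
    induction hx using AddSubgroup.closure_induction with
    | mem x hx => exact step1 x hx
    | zero => exact ⟨0, zero_mem _, 0, zero_mem _, by simp⟩
    | add x y _ _ hx hy =>
      obtain ⟨b, hb, y1, hy1, rfl⟩ := hx
      obtain ⟨b', hb', y2, hy2, rfl⟩ := hy
      exact ⟨b + b', add_mem hb hb', y1 + y2, add_mem hy1 hy2, by rw [smul_add]; abel⟩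
    | neg x _ hx =>
      obtain ⟨b, hb, y1, hy1, rfl⟩ := hx
      exact ⟨-b, neg_mem hb, -y1, neg_mem hy1, by rw [smul_neg]; abel⟩
  have step3 : ∀ k : ℕ, ∀ x ∈ AddSubgroup.closure (T : Set Z),
      ∃ b ∈ AddSubgroup.closure (B : Set Z),
      ∃ y ∈ AddSubgroup.closure (T : Set Z), x = b + p ^ k • y := by
    intro k
    induction k with
    | zero => intro x hx; exact ⟨0, zero_mem _, x, hx, by simp⟩
    | succ k ih =>
      intro x hx
      obtain ⟨b, hb, y, hy, rfl⟩ := ih x hx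
      obtain ⟨b', hb', y', hy', rfl⟩ := step2 y hy
      exact ⟨b + p ^ k • b', add_mem hb (nsmul_mem hb' _), y', hy', by
        rw [smul_add, pow_succ, mul_smul]; abel⟩
  intro x hx
  obtain ⟨b, hb, y, _, rfl⟩ := step3 ((ex Z).factorization p) x hx
  have : ordCompl[p] (ex Z) • (p ^ (ex Z).factorization p • y) = 0 := by
    rw [← mul_smul, mul_comm, Nat.ordProj_mul_ordCompl_eq_self, ex_smul]
  rw [smul_add, this, add_zero]
  exact nsmul_mem hb _

lemma pind_empty (p : ℕ) (T : Finset Z) : PInd p T ∅ := by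
  intro c hc _ h
  rw [hc h (by simp)]; exact dvd_zero _

lemma pind_single {p : ℕ} (hp : p.Prime) (hpe : p ∣ ex Z) {g : Z} (hg : addOrderOf g = ex Z)
    (T : Finset Z) : PInd p T {g} := by
  rintro c hc ⟨y, _, hy⟩ h
  by_cases hh : h = g
  · subst hh
    rw [Finset.sum_eq_single h (by intro b _ hb; rw [hc b (by simpa using hb), zero_smul])
      (by simp)] at hy
    obtain ⟨k, hk⟩ := hpe
    have h1 : ((k : ℤ) * c h) • h = 0 := by
      rw [mul_smul, hy, natCast_zsmul, ← mul_smul, mul_comm, ← hk, ex_smul]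
    have h2 := addOrderOf_dvd_iff_zsmul_eq_zero.2 h1
    rw [hg, hk] at h2
    have hk0 : (k : ℤ) ≠ 0 := by
      rintro h0
      have := ex_pos (Z := Z)
      rw [hk] at this
      simp_all
    push_cast at h2
    rw [mul_comm] at h2
    exact Int.dvd_of_mul_dvd_mul_left hk0 h2
  · rw [hc h (by simpa using hh)]; exact dvd_zero _

lemma gen_rel {p r : ℕ} (hp : p.Prime) (hR : RkLe r Z) {S B0 : Finset Z} {h : Z} (hh : h ∈ S)
    (hB0 : B0 ⊆ S.erase h) (hi : PInd p (S.erase h) B0) {x : Z → ℤ} (hx : x ∈ Q S) :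
    ∃ B, B0 ⊆ B ∧ B ⊆ S.erase h ∧ B.card ≤ r ∧ ∃ m : ℕ, m.Coprime p ∧
      ∃ y ∈ Q (insert h B), ∃ z ∈ Q (S.erase h), m • x = y + z := by
  obtain ⟨B, h1, h2, h3, m, hm, hgen⟩ := gen hp hR hB0 hi
  refine ⟨B, h1, h2, h3, m, hm, ?_⟩
  have hB : h ∉ B := fun hc => by simpa using h2 hc
  have hx2 : x h • h = - ∑ g, (Function.update x h 0) g • g := by
    have := hx.2
    rw [← Finset.add_sum_erase _ _ (Finset.mem_univ h)] at this
    rw [← Finset.add_sum_erase _ (fun g => (Function.update x h 0) g • g) (Finset.mem_univ h)]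
    simp only [Function.update_self, zero_smul, zero_add]
    rw [eq_neg_iff_add_eq_zero, ← this]
    congr 1
    refine Finset.sum_congr rfl fun g hg => ?_
    rw [Function.update_of_ne (Finset.ne_of_mem_erase hg)]
  have hmem : x h • h ∈ AddSubgroup.closure ((S.erase h : Finset Z) : Set Z) := by
    rw [hx2]
    refine neg_mem (rep_closure fun g hg => ?_)
    by_cases hgh : g = h
    · subst hgh; simp
    · rw [Function.update_of_ne hgh]; exact hx.1 g fun hc => hg (by simp [hgh, hc])
  obtain ⟨c, hc, hcs⟩ := closure_rep (hgen _ hmem)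
  have hy : (Pi.single h (m * x h) - c : Z → ℤ) ∈ Q (insert h B) := by
    refine ⟨fun g hg => ?_, ?_⟩
    · rw [Finset.mem_insert, not_or] at hg
      simp [hg.1, hc g hg.2]
    · simp only [Pi.sub_apply, sub_smul, Finset.sum_sub_distrib, hcs]
      rw [Finset.sum_eq_single h (by intro b _ hb; simp [hb]) (by simp)]
      simp [mul_smul]
  refine ⟨_, hy, m • x - (Pi.single h (m * x h) - c), ⟨fun g hg => ?_, ?_⟩, by abel⟩
  · by_cases hgh : g = h
    · subst hgh; simp [hc g hB]
    · have : g ∉ S := fun hc => hg (by simp [hgh, hc])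
      have : g ∉ B := fun hc => hg (h2 hc)
      simp [hgh, hc g this, hx.1 g ‹_›]
  · have h4 := (nsmul_mem hx m).2
    have h5 := hy.2
    simp only [Pi.sub_apply, sub_smul, Finset.sum_sub_distrib] at h5 ⊢
    rw [h4, h5, sub_zero]

end Gen
end ZS

open scoped Classical
set_option linter.unusedSectionVars false

namespace ZS

section MinSec
variable {Z : Type*} [AddCommGroup Z] [Fintype Z]

def MinNH (E : Finset Z) : Prop := ¬ HF E ∧ ∀ h ∈ E, HF (E.erase h)

lemma exists_minNH {S : Finset Z} (h : ¬ HF S) : ∃ E ⊆ S, MinNH E := by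
  induction S using Finset.strongInduction with
  | _ S ih =>
    by_cases hm : ∀ h ∈ S, HF (S.erase h)
    · exact ⟨S, Finset.Subset.refl _, h, hm⟩
    · push Not at hm
      obtain ⟨g, hg, hn⟩ := hm
      obtain ⟨E, hE, hE'⟩ := ih _ (Finset.erase_ssubset hg) hn
      exact ⟨E, hE.trans (Finset.erase_subset _ _), hE'⟩

lemma over_pow {S : Finset Z} {g : Z} (hg : g ∈ S) (n : ℕ) : Over S (n • ({g} : Multiset Z)) := by
  intro x hx
  have := Multiset.mem_of_mem_nsmul hx
  rw [Multiset.mem_singleton] at this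
  rwa [this]

lemma over_erase {E : Finset Z} {B : Multiset Z} {h : Z} (ho : Over E B) (h0 : B.count h = 0) :
    Over (E.erase h) B := by
  intro x hx
  refine Finset.mem_erase.2 ⟨?_, ho x hx⟩
  rintro rfl
  exact (Multiset.count_eq_zero.1 h0) hx

lemma MinNH.count {E : Finset Z} (hE : MinNH E) {A : Multiset Z} (hA : At A) (ho : Over E A)
    (hk : ck A ≠ ex Z) : ∀ h ∈ E, 0 < A.count h ∧ A.count h < addOrderOf h := by
  intro h hh
  constructor
  · by_contra hc
    exact hk (hE.2 h hh A hA (over_erase ho (by omega)))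
  · by_contra hc
    have := hA.eq_pow (not_lt.1 hc)
    exact hk (by rw [this, ck_pow])

/-- complementary sequence -/
noncomputable def cpl (E : Finset Z) (B : Multiset Z) : Multiset Z :=
  mk fun h => if h ∈ E then addOrderOf h - B.count h else 0

lemma cpl_over (E : Finset Z) (B : Multiset Z) : Over E (cpl E B) := by
  intro x hx
  rw [cpl, mem_mk] at hx
  by_contra hc
  simp [hc] at hx

lemma cpl_add {E : Finset Z} {B : Multiset Z} (ho : Over E B)
    (hc : ∀ h ∈ E, B.count h ≤ addOrderOf h) :
    B + cpl E B = ∑ h ∈ E, addOrderOf h • ({h} : Multiset Z) := by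
  ext x
  rw [Multiset.count_add, cpl, count_mk, Multiset.count_sum']
  simp only [Multiset.count_nsmul, Multiset.count_singleton, mul_ite, mul_one, mul_zero]
  rw [Finset.sum_ite_eq E x]
  split_ifs with h
  · have := hc x h; omega
  · simpa using fun hx => h (ho x hx)

noncomputable def powE (E : Finset Z) : Multiset (Multiset Z) :=
  ∑ h ∈ E, {addOrderOf h • ({h} : Multiset Z)}

lemma powE_fac (E : Finset Z) : Fac (powE E) := by
  intro A hA
  rw [powE, Multiset.mem_sum] at hA
  obtain ⟨h, _, hA⟩ := hA
  rw [Multiset.mem_singleton] at hA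
  rw [hA]; exact at_pow (ord_pos h)

lemma powE_card (E : Finset Z) : (powE E).card = E.card := by
  rw [powE, mcard_finset]; simp

lemma powE_sum (E : Finset Z) : (powE E).sum = ∑ h ∈ E, addOrderOf h • ({h} : Multiset Z) := by
  rw [powE, msum_finset]; simp

lemma powE_ck (E : Finset Z) : ck (powE E).sum = ex Z * E.card := by
  rw [powE_sum, ck_finset_sum]
  simp [ord_mul_wt, mul_comm]

lemma cpl_sum {E : Finset Z} {B : Multiset Z} (ho : Over E B)
    (hc : ∀ h ∈ E, B.count h ≤ addOrderOf h) (hs : B.sum = 0) : (cpl E B).sum = 0 := by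
  have h1 := congrArg Multiset.sum (cpl_add ho hc)
  rw [← powE_sum, (powE_fac E).sum_zero, Multiset.sum_add, hs, zero_add] at h1
  exact h1

lemma cpl_ck {E : Finset Z} {B : Multiset Z} (ho : Over E B)
    (hc : ∀ h ∈ E, B.count h ≤ addOrderOf h) : ck B + ck (cpl E B) = ex Z * E.card := by
  rw [← ck_add, cpl_add ho hc, ← powE_sum, powE_ck]

lemma cpl_count {E : Finset Z} {B : Multiset Z} {h : Z} (hh : h ∈ E) :
    (cpl E B).count h = addOrderOf h - B.count h := by
  simp [cpl, hh]

lemma cpl_comp {d : ℕ} {E : Finset Z} (hS : Struct d E) (hL : LCN E) {f f' : Multiset (Multiset Z)}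
    (hf : Fac f) (hf' : Fac f') (ho : Over E f.sum)
    (hc : ∀ h ∈ E, f.sum.count h ≤ addOrderOf h) (he : f'.sum = cpl E f.sum)
    (hgt : ex Z * f.card < ck f.sum) : f.card + f'.card + d ≤ E.card := by
  have h1 := hS (f + f') (powE E) (hf.add hf') (powE_fac E)
    (by rw [Multiset.sum_add, he, cpl_add ho hc, powE_sum])
    (by rw [Multiset.sum_add, he]; exact ho.add (cpl_over _ _))
  rw [Multiset.card_add, powE_card] at h1
  have h2 := cpl_ck ho hc
  have h3 := ck_fac_lower hL hf' (by rw [he]; exact cpl_over _ _)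
  rw [he] at h3
  have h4 : f.card + f'.card < E.card := by
    have : ex Z * (f.card + f'.card) < ex Z * E.card := by rw [mul_add]; omega
    exact Nat.lt_of_mul_lt_mul_left this
  obtain ⟨c, hc⟩ := (Nat.modEq_iff_dvd' h4.le).1 h1
  have : c ≠ 0 := by rintro rfl; omega
  have : d ≤ d * c := Nat.le_mul_of_pos_right d (Nat.pos_of_ne_zero this)
  omega

lemma MinNH.exists_atom {E : Finset Z} (hE : MinNH E) : ∃ A, At A ∧ Over E A ∧ ck A ≠ ex Z := by
  have := hE.1
  unfold HF at this
  push Not at this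
  exact this

lemma MinNH.nonempty {E : Finset Z} (hE : MinNH E) : E.Nonempty := by
  obtain ⟨A, hA, ho, _⟩ := hE.exists_atom
  obtain ⟨x, hx⟩ := Multiset.exists_mem_of_ne_zero hA.1
  exact ⟨x, ho x hx⟩

lemma cpl_ne {E : Finset Z} {B : Multiset Z} {h : Z} (hh : h ∈ E) (hc : B.count h < addOrderOf h) :
    cpl E B ≠ 0 := by
  intro h0
  have := cpl_count (B := B) hh
  rw [h0] at this; simp at this; omega

lemma MinNH.card_ge {d : ℕ} {E : Finset Z} (hE : MinNH E) (hS : Struct d E) (hL : LCN E) :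
    d + 2 ≤ E.card := by
  obtain ⟨A, hA, ho, hk⟩ := hE.exists_atom
  have hc := hE.count hA ho hk
  obtain ⟨h, hh⟩ := hE.nonempty
  obtain ⟨f', hf', he⟩ := exists_fac _ (cpl_sum ho (fun h hh => (hc h hh).2.le) hA.2.1)
  have := cpl_comp (f := {A}) hS hL (Fac.single hA) hf' (by simpa using ho)
    (by simpa using fun h hh => (hc h hh).2.le) (by simpa using he)
    (by simp; exact lt_of_le_of_ne (hL A hA ho) (Ne.symm hk))
  have h2 : 0 < f'.card := fac_pos (by rw [he]; exact cpl_ne hh (hc h hh).2)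
  simp at this
  omega

/-- adding a power increases the maximal length by at most one -/
lemma claim {d : ℕ} (hd : 0 < d) (hex : ex Z ≤ 2 * d + 2) {E : Finset Z} (hS : Struct d E)
    (hL : LCN E) (hE : ∀ h ∈ E, HF (E.erase h)) {h : Z} (hh : h ∈ E) (n : ℕ) :
    ∀ B : Multiset Z, B.card = n → Over E B → B.sum = 0 → ∀ f, Fac f →
      f.sum = B + addOrderOf h • ({h} : Multiset Z) →
      ∃ f', Fac f' ∧ f'.sum = B ∧ f.card ≤ f'.card + 1 := by
  induction n using Nat.strong_induction_on with
  | _ n ih =>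
    intro B hBn ho hs f hf hfs
    by_contra hcon
    push Not at hcon
    obtain ⟨f', hf', hfs'⟩ := exists_fac B hs
    have h1 := hcon f' hf' hfs'
    have hoP : Over E (B + addOrderOf h • ({h} : Multiset Z)) := ho.add (over_pow hh _)
    have h2 := hS (f' + {addOrderOf h • ({h} : Multiset Z)}) f
      (hf'.add (Fac.single (at_pow (ord_pos h)))) hf (by simp [hfs, hfs']) (by
        rw [Multiset.sum_add, hfs']; simpa using hoP)
    rw [Multiset.card_add, Multiset.card_singleton] at h2
    have h3 : f'.card + 1 + d ≤ f.card := by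
      obtain ⟨c, hc⟩ := (Nat.modEq_iff_dvd' h1.le).1 h2
      have : c ≠ 0 := by rintro rfl; omega
      have : d ≤ d * c := Nat.le_mul_of_pos_right d (Nat.pos_of_ne_zero this)
      omega
    by_cases hV : ∃ V ∈ f, V ≤ B
    · obtain ⟨V, hVf, hVB⟩ := hV
      obtain ⟨C, rfl⟩ := Multiset.le_iff_exists_add.1 hVB
      obtain ⟨f1, rfl⟩ := Multiset.exists_cons_of_mem hVf
      have hVA := hf V hVf
      rw [Multiset.sum_cons, add_assoc] at hfs
      have hV0 : 0 < V.card := Multiset.card_pos.2 hVA.1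
      rw [Multiset.card_add] at hBn
      obtain ⟨f2, hf2, hs2, hc2⟩ := ih C.card (by omega) C rfl
        (ho.le (Multiset.le_add_left _ _)) (by rw [Multiset.sum_add, hVA.2.1, zero_add] at hs; exact hs)
        f1 (fun A hA => hf A (Multiset.mem_cons_of_mem hA)) (add_left_cancel hfs)
      have := hcon (V ::ₘ f2) (by
        intro A hA
        rcases Multiset.mem_cons.1 hA with rfl | hA
        exacts [hVA, hf2 A hA]) (by simp [hs2])
      simp at this
      omega
    · push Not at hV
      have h4 : ∀ V ∈ f, B.count h + 1 ≤ V.count h := by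
        intro V hVf
        by_contra hc
        refine hV V hVf (Multiset.le_iff_count.2 fun g => ?_)
        by_cases hg : g = h
        · subst hg; omega
        · have := Multiset.count_le_of_le g (Multiset.single_le_sum (fun _ _ => Multiset.zero_le _) V hVf)
          rw [hfs, Multiset.count_add, Multiset.count_nsmul, Multiset.count_singleton, if_neg hg] at this
          simpa using this
      have h5 : f.card * (B.count h + 1) ≤ f.sum.count h := by
        clear h3 h2 hfs h1 hcon hf hV
        induction f using Multiset.induction with
        | empty => simp
        | cons V f ihf =>
          have a1 := ihf fun W hW => h4 W (Multiset.mem_cons_of_mem hW)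
          have a2 := h4 V (Multiset.mem_cons_self _ _)
          rw [Multiset.sum_cons, Multiset.card_cons, Multiset.count_add, add_mul]
          omega
      rw [hfs, Multiset.count_add, Multiset.count_nsmul, Multiset.count_singleton_self] at h5
      by_cases hu : B.count h = 0
      · have hHF := hE h hh
        have h6 : ck f'.sum = ex Z * f'.card := by
          have ho' : ∀ A ∈ f', Over (E.erase h) A :=
            over_sum.1 (by rw [hfs']; exact over_erase ho hu)
          rw [ck_sum, Multiset.map_congr rfl (fun A hA => hHF A (hf' A hA) (ho' A hA))]
          simp [mul_comm]
        have h7 := ck_fac_lower hL hf (by rw [hfs]; exact hoP)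
        rw [hfs, ck_add, ck_pow, ← hfs', h6] at h7
        have : ex Z * f.card ≤ ex Z * (f'.card + 1) := by rw [mul_add]; omega
        have := Nat.le_of_mul_le_mul_left this ex_pos
        omega
      · have h6 : 0 < f'.card := fac_pos (by rw [hfs']; rintro rfl; simp at hu)
        have h7 := ord_le_ex h
        have h8 : (d + 2) * (B.count h + 1) ≤ f.card * (B.count h + 1) :=
          Nat.mul_le_mul_right _ (by omega)
        have h9 : d + 2 ≤ f.card := by omega
        have h10 : 1 ≤ B.count h := by omega
        nlinarith

lemma claim_iter {d : ℕ} (hd : 0 < d) (hex : ex Z ≤ 2 * d + 2) {E : Finset Z} (hS : Struct d E)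
    (hL : LCN E) (hE : ∀ h ∈ E, HF (E.erase h)) (M : Multiset Z) (hM : Over E M) :
    ∀ B : Multiset Z, Over E B → B.sum = 0 → ∀ f, Fac f →
      f.sum = B + ex Z • M → ∃ f', Fac f' ∧ f'.sum = B ∧ f.card ≤ f'.card + ck M := by
  induction M using Multiset.induction with
  | empty => intro B _ _ f hf hfs; exact ⟨f, hf, by simpa using hfs, by simp⟩
  | cons h M ih =>
    have hh : h ∈ E := hM h (Multiset.mem_cons_self _ _)
    have key : ∀ k : ℕ, ∀ B : Multiset Z, Over E B → B.sum = 0 → ∀ f, Fac f →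
      f.sum = B + k • (addOrderOf h • ({h} : Multiset Z)) →
        ∃ f', Fac f' ∧ f'.sum = B ∧ f.card ≤ f'.card + k := by
      intro k
      induction k with
      | zero => intro B _ _ f hf hfs; exact ⟨f, hf, by simpa using hfs, by simp⟩
      | succ k ihk =>
        intro B ho hs f hf hfs
        have hop : Over E (addOrderOf h • ({h} : Multiset Z)) := over_pow hh _
        obtain ⟨f1, hf1, hs1, hc1⟩ := ihk (B + addOrderOf h • ({h} : Multiset Z)) (ho.add hop)
          (by rw [Multiset.sum_add, hs, (at_pow (ord_pos h)).2.1, add_zero]) f hf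
          (by rw [hfs, succ_nsmul, add_assoc, add_comm (k • _)])
        obtain ⟨f2, hf2, hs2, hc2⟩ := claim hd hex hS hL hE hh _ B rfl ho hs f1 hf1 hs1
        exact ⟨f2, hf2, hs2, by omega⟩
    intro B ho hs f hf hfs
    have e : ex Z • (h ::ₘ M) = wt h • (addOrderOf h • ({h} : Multiset Z)) + ex Z • M := by
      rw [← Multiset.singleton_add, nsmul_add, ← mul_smul, mul_comm, ord_mul_wt]
    rw [e, ← add_assoc] at hfs
    obtain ⟨f1, hf1, hs1, hc1⟩ := ih (fun x hx => hM x (Multiset.mem_cons_of_mem hx))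
      (B + wt h • (addOrderOf h • ({h} : Multiset Z))) (ho.add ((over_pow hh _).nsmul _))
      (by rw [Multiset.sum_add, hs, Multiset.sum_nsmul, (at_pow (ord_pos h)).2.1]; simp) f hf hfs
    obtain ⟨f2, hf2, hs2, hc2⟩ := key _ B ho hs f1 hf1 hs1
    refine ⟨f2, hf2, hs2, ?_⟩
    rw [ck_cons]; omega

/-- group of relations generated by atoms of cross number one -/
def Gd (E : Finset Z) : AddSubgroup (Z → ℤ) where
  carrier := {x | ∃ f : Multiset (Multiset Z), ∃ M : Multiset Z, Fac f ∧ Over E f.sum ∧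
    (∀ A ∈ f, ck A = ex Z) ∧ Over E M ∧ cnt f.sum = x + ex Z • cnt M}
  zero_mem' := ⟨0, 0, fac_zero, by simp [Over], by simp, by simp [Over], by simp⟩
  add_mem' := by
    rintro x y ⟨f, M, h1, h2, h3, h4, h5⟩ ⟨f', M', h1', h2', h3', h4', h5'⟩
    refine ⟨f + f', M + M', h1.add h1', by rw [Multiset.sum_add]; exact h2.add h2', ?_,
      h4.add h4', by rw [Multiset.sum_add, cnt_add, cnt_add, h5, h5', smul_add]; abel⟩
    intro A hA
    rcases Multiset.mem_add.1 hA with h | h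
    exacts [h3 A h, h3' A h]
  neg_mem' := by
    rintro x ⟨f, M, h1, h2, h3, h4, h5⟩
    refine ⟨(ex Z - 1) • f + powFac M, f.sum, (h1.nsmul _).add (powFac_fac _), ?_, ?_, h2, ?_⟩
    · rw [Multiset.sum_add, powFac_sum, Multiset.sum_nsmul]
      exact (h2.nsmul _).add (h4.nsmul _)
    · intro A hA
      rcases Multiset.mem_add.1 hA with h | h
      · exact h3 A (Multiset.mem_of_mem_nsmul h)
      · rw [powFac, Multiset.mem_sum] at h
        obtain ⟨g, _, hg⟩ := h
        have := Multiset.mem_of_mem_nsmul hg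
        rw [Multiset.mem_singleton] at this
        rw [this, ck_pow]
    · rw [Multiset.sum_add, powFac_sum, Multiset.sum_nsmul, cnt_add, cnt_nsmul, cnt_nsmul]
      have e : ex Z • cnt f.sum = (ex Z - 1) • cnt f.sum + cnt f.sum := by
        rw [← succ_nsmul, Nat.sub_add_cancel ex_pos]
      rw [e, h5]; abel

lemma mem_Gd {E : Finset Z} {x : Z → ℤ} : x ∈ Gd E ↔
  ∃ f : Multiset (Multiset Z), ∃ M : Multiset Z, Fac f ∧ Over E f.sum ∧
    (∀ A ∈ f, ck A = ex Z) ∧ Over E M ∧ cnt f.sum = x + ex Z • cnt M := Iff.rfl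

lemma Q_le_Gd {E E' : Finset Z} (h : E' ⊆ E) (hHF : HF E') : Q E' ≤ Gd E := by
  intro x hx
  let M := mk fun g => (x g).natAbs
  let B := mk fun g => (x g + ex Z * (x g).natAbs).toNat
  have hN : (1 : ℤ) ≤ ex Z := by exact_mod_cast ex_pos (Z := Z)
  have hB : cnt B = x + ex Z • cnt M := by
    ext g
    rw [Pi.add_apply, Pi.smul_apply, nsmul_eq_mul]
    simp only [B, M, cnt, count_mk]
    rw [Int.toNat_of_nonneg]
    have h1 : -((x g).natAbs : ℤ) ≤ x g := by omega
    have h2 : (0 : ℤ) ≤ (x g).natAbs := by omega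
    nlinarith
  have hMo : Over E' M := by
    intro g hg
    by_contra hc
    rw [mem_mk, hx.1 g hc] at hg; simp at hg
  have hBo : Over E' B := by
    intro g hg
    by_contra hc
    rw [mem_mk, hx.1 g hc] at hg; simp at hg
  have hBs : B.sum = 0 := by
    have h1 : ∑ g, cnt B g • g = 0 := by
      rw [hB]
      simp only [Pi.add_apply, add_smul, Finset.sum_add_distrib, hx.2, zero_add]
      refine Finset.sum_eq_zero fun g _ => ?_
      simp only [Pi.smul_apply, nsmul_eq_mul]
      exact ex_zsmul_mul _ _
    rw [sum_eq_count]
    simpa [cnt] using h1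
  obtain ⟨f, hf, hfs⟩ := exists_fac B hBs
  have ho : ∀ A ∈ f, Over E' A := over_sum.1 (by rw [hfs]; exact hBo)
  exact ⟨f, M, hf, by rw [hfs]; exact hBo.mono h, fun A hA => hHF A (hf A hA) (ho A hA),
    hMo.mono h, by rw [hfs, hB]⟩

lemma cnt_inj {A B : Multiset Z} (h : cnt A = cnt B) : A = B := by
  ext g
  have := congrFun h g
  simpa [cnt] using this

lemma Gd_atom {d : ℕ} (hd : 0 < d) (hex : ex Z ≤ 2 * d + 2) {E : Finset Z} (hS : Struct d E)
    (hL : LCN E) (hE : ∀ h ∈ E, HF (E.erase h)) {A : Multiset Z} (hA : At A) (ho : Over E A)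
    (h : cnt A ∈ Gd E) : ck A = ex Z := by
  obtain ⟨f, M, h1, h2, h3, h4, h5⟩ := h
  rw [← cnt_nsmul, ← cnt_add] at h5
  have h6 := cnt_inj h5
  obtain ⟨f', hf', hs', hc'⟩ := claim_iter hd hex hS hL hE M h4 A ho hA.2.1 f h1 h6
  rw [hA.fac_unique hf' hs', Multiset.card_singleton] at hc'
  have h7 : ck f.sum = ex Z * f.card := by
    rw [ck_sum, Multiset.map_congr rfl h3]; simp [mul_comm]
  rw [h6, ck_add, ck_nsmul] at h7
  have h8 := hL A hA ho
  have : ex Z * f.card ≤ ex Z * (1 + ck M) := Nat.mul_le_mul_left _ hc'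
  rw [mul_add] at this
  omega

lemma mem_of_coprime {K : Type*} [AddCommGroup K] (H : AddSubgroup K) {x : K}
    (h : ∀ p : ℕ, p.Prime → ∃ m : ℕ, m.Coprime p ∧ m • x ∈ H) : x ∈ H := by
  have h1 : addOrderOf (x : K ⧸ H) = 1 := by
    by_contra hc
    obtain ⟨p, hp, hpd⟩ := Nat.exists_prime_and_dvd hc
    obtain ⟨m, hm, hmH⟩ := h p hp
    have : m • (x : K ⧸ H) = 0 := by
      rw [← QuotientAddGroup.mk_nsmul]; exact (QuotientAddGroup.eq_zero_iff _).2 hmH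
    have h2 := hpd.trans (addOrderOf_dvd_of_nsmul_eq_zero this)
    have := Nat.Coprime.eq_one_of_dvd hm.symm h2
    exact hp.one_lt.ne' this
  rw [AddMonoid.addOrderOf_eq_one_iff] at h1
  exact (QuotientAddGroup.eq_zero_iff x).1 h1

theorem MinNH.card_le {d r : ℕ} (hd : 0 < d) (hex : ex Z ≤ 2 * d + 2) (hR : RkLe r Z)
    {E : Finset Z} (hE : MinNH E) (hS : Struct d E) (hL : LCN E) : E.card ≤ r + 1 := by
  by_contra hc
  obtain ⟨A, hA, ho, hk⟩ := hE.exists_atom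
  obtain ⟨h, hh⟩ := hE.nonempty
  refine hk (Gd_atom hd hex hS hL hE.2 hA ho (mem_of_coprime _ fun p hp => ?_))
  obtain ⟨B, _, hB, hBc, m, hm, y, hy, z, hz, he⟩ := gen_rel hp hR hh (Finset.empty_subset _)
    (pind_empty p _) (cnt_mem ho hA.2.1)
  refine ⟨m, hm, ?_⟩
  rw [he]
  refine add_mem ?_ (Q_le_Gd (Finset.erase_subset _ _) (hE.2 h hh) hz)
  have h1 : (insert h B).card < E.card := by
    have := Finset.card_insert_le h B; omega
  obtain ⟨h', hh', hn⟩ := Finset.exists_mem_notMem_of_card_lt_card h1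
  refine Q_le_Gd (Finset.erase_subset _ _) (hE.2 h' hh') (Q_mono ?_ hy)
  intro g hg
  refine Finset.mem_erase.2 ⟨fun hc => hn (hc ▸ hg), ?_⟩
  rcases Finset.mem_insert.1 hg with rfl | hg
  exacts [hh, (Finset.mem_erase.1 (hB hg)).2]

theorem hf_of_rank {d r : ℕ} (hd : 0 < d) (hex : ex Z ≤ 2 * d + 2) (hR : RkLe r Z) (hr : r ≤ d)
    {S : Finset Z} (hS : Struct d S) (hL : LCN S) : HF S := by
  by_contra hc
  obtain ⟨E, hES, hE⟩ := exists_minNH hc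
  have h1 := hE.card_le hd hex hR (hS.mono hES) (hL.mono hES)
  have h2 := hE.card_ge (hS.mono hES) (hL.mono hES)
  omega

end MinSec
end ZS

open scoped Classical
set_option linter.unusedSectionVars false

namespace ZS

section PF
variable {Z : Type*} [AddCommGroup Z] [Fintype Z]

def PP {N : ℕ} (p b : ℕ) (w : ZMod N) : Prop := ∃ m : ℕ, m.Coprime p ∧ ((m * p ^ b : ℕ) : ZMod N) * w = 0

lemma PP.zero {N p b : ℕ} : PP p b (0 : ZMod N) := ⟨1, by simp, by simp⟩

lemma PP.add {N p b : ℕ} {w w' : ZMod N} (h : PP p b w) (h' : PP p b w') : PP p b (w + w') := by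
  obtain ⟨m, hm, e⟩ := h
  obtain ⟨m', hm', e'⟩ := h'
  refine ⟨m * m', Nat.Coprime.mul_left hm hm', ?_⟩
  push_cast at e e' ⊢
  linear_combination (m' : ZMod N) * e + (m : ZMod N) * e'

lemma PP.of_mul {N p b m : ℕ} (hm : m.Coprime p) {w : ZMod N} (h : PP p b ((m : ZMod N) * w)) :
    PP p b w := by
  obtain ⟨m', hm', e⟩ := h
  refine ⟨m * m', Nat.Coprime.mul_left hm hm', ?_⟩
  push_cast at e ⊢
  linear_combination e

lemma exists_pmin {d r p b : ℕ} (hd : 0 < d) (hrd : r = d + 1) (hp : p.Prime)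
    (hR : RkLe r Z) {S : Finset Z} (hS : Struct d S) (hL : LCN S)
    {s : (Z → ℤ) → ZMod (ex Z)} (hs : SB d S s) {x : Z → ℤ} (hx : x ∈ Q S) (hn : ¬ PP p b (s x)) :
    ∃ E ⊆ S, MinNH E ∧ E.card = r + 1 ∧ ∃ x ∈ Q E, ¬ PP p b (s x) := by
  induction S using Finset.strongInduction generalizing x with
  | _ S ih =>
    by_cases hsm : ∃ S' : Finset Z, S' ⊂ S ∧ ∃ x' ∈ Q S', ¬ PP p b (s x')
    · obtain ⟨S', hS', x', hx', hn'⟩ := hsm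
      obtain ⟨E, hE, hE'⟩ := ih S' hS' (hS.mono hS'.1) (hL.mono hS'.1) (hs.mono hS'.1) hx' hn'
      exact ⟨E, hE.trans hS'.1, hE'⟩
    push Not at hsm
    have hnh : ¬ HF S := fun hc => hn (by rw [hs.hf_zero hd hc hx]; exact PP.zero)
    obtain ⟨E, hES, hE⟩ := exists_minNH hnh
    have h1 := hE.card_ge (hS.mono hES) (hL.mono hES)
    have h2 : S.card ≤ r + 1 := by
      by_contra hc
      obtain ⟨h, hh⟩ := hE.nonempty
      have hh := hES hh
      obtain ⟨B, _, hB, hBc, m, hm, y, hy, z, hz, he⟩ := gen_rel hp hR hh (Finset.empty_subset _)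
        (pind_empty p _) hx
      have hBS : insert h B ⊆ S := by
        intro g hg
        rcases Finset.mem_insert.1 hg with rfl | hg
        exacts [hh, (Finset.mem_erase.1 (hB hg)).2]
      have h3 : insert h B ⊂ S := by
        refine Finset.ssubset_iff_subset_ne.2 ⟨hBS, fun hc' => ?_⟩
        have := Finset.card_insert_le h B
        rw [hc'] at this; omega
      have h4 := hsm _ h3 y hy
      have h5 := hsm _ (Finset.erase_ssubset hh) z hz
      have h6 := h4.add h5
      rw [← hs.add y z (Q_mono hBS hy) (Q_mono (Finset.erase_subset _ _) hz), ← he,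
        hs.nsmul hx] at h6
      exact hn (h6.of_mul hm)
    have h3 : E = S := Finset.eq_of_subset_of_card_le hES (by omega)
    subst h3
    exact ⟨E, Finset.Subset.refl _, hE, by omega, x, hx, hn⟩

lemma pdvd {d p b : ℕ} (hd : 0 < d) (hp : p.Prime) {E : Finset Z}
    (hE : ∀ h ∈ E, HF (E.erase h)) {s : (Z → ℤ) → ZMod (ex Z)} (hs : SB d E s)
    {x : Z → ℤ} (hx : x ∈ Q E) (hn : ¬ PP p b (s x)) {q : Z → ℤ} (hq : q ∈ Q E) (hq0 : s q = 0) :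
    ∀ h, ((p ^ (b + 1) : ℕ) : ℤ) ∣ q h := by
  intro h
  by_cases hh : h ∈ E
  swap
  · rw [hq.1 h hh]; exact dvd_zero _
  set i : ℕ := Int.gcd (q h) (addOrderOf h) with hi
  have hi0 : i ≠ 0 := by
    intro hc
    rw [hi, Int.gcd_eq_zero_iff] at hc
    have := ord_pos h
    omega
  have hbez : (i : ℤ) = q h * Int.gcdA (q h) (addOrderOf h) +
      addOrderOf h * Int.gcdB (q h) (addOrderOf h) := Int.gcd_eq_gcd_ab _ _
  set α := Int.gcdA (q h) (addOrderOf h)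
  set β := Int.gcdB (q h) (addOrderOf h)
  set P := cnt (addOrderOf h • ({h} : Multiset Z)) with hP
  have hPQ : P ∈ Q E := cnt_mem (over_pow hh _) (at_pow (ord_pos h)).2.1
  have hPh : P h = addOrderOf h := by simp [hP, cnt]
  have hy : (i : ℤ) • x - x h • (α • q + β • P) ∈ Q (E.erase h) := by
    have h1 : (i : ℤ) • x - x h • (α • q + β • P) ∈ Q E :=
      sub_mem (zsmul_mem hx _) (zsmul_mem (add_mem (zsmul_mem hq _) (zsmul_mem hPQ _)) _)
    refine ⟨fun g hg => ?_, h1.2⟩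
    by_cases hgh : g = h
    · subst hgh
      simp only [Pi.sub_apply, Pi.smul_apply, Pi.add_apply, smul_eq_mul, hPh, hbez]
      ring
    · exact h1.1 g fun hc => hg (by simp [hgh, hc])
  have h0 := (hs.mono (Finset.erase_subset h E)).hf_zero hd (hE h hh) hy
  rw [hs.sub (zsmul_mem hx _) (zsmul_mem (add_mem (zsmul_mem hq _) (zsmul_mem hPQ _)) _),
    hs.zsmul hx, hs.zsmul (add_mem (zsmul_mem hq _) (zsmul_mem hPQ _)),
    hs.add _ _ (zsmul_mem hq _) (zsmul_mem hPQ _), hs.zsmul hq, hs.zsmul hPQ, hq0,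
    hs.pow hd hh] at h0
  simp only [mul_zero, add_zero, sub_zero, Int.cast_natCast] at h0
  have hdvd : p ^ (b + 1) ∣ i := by
    by_contra hc
    obtain ⟨c, m, hm, hcm⟩ := Nat.exists_eq_pow_mul_and_not_dvd hi0 p hp.ne_one
    have hcb : c ≤ b := by
      by_contra hcb
      exact hc ((pow_dvd_pow p (by omega)).trans ⟨m, hcm⟩)
    refine hn ⟨m, ((Nat.Prime.coprime_iff_not_dvd hp).2 hm).symm, ?_⟩
    have : m * p ^ b = p ^ (b - c) * i := by
      rw [hcm, ← mul_assoc, ← pow_add, Nat.sub_add_cancel hcb, mul_comm]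
    rw [this]; push_cast; rw [mul_assoc, h0, mul_zero]
  have : ((p ^ (b + 1) : ℕ) : ℤ) ∣ (i : ℤ) := by exact_mod_cast hdvd
  exact this.trans (Int.gcd_dvd_left _ _)

theorem pcount {d r p b : ℕ} (hd : 0 < d) (hp : p.Prime) {E : Finset Z}
    (hE : ∀ h ∈ E, HF (E.erase h)) (hEc : E.card = r + 1)
    {s : (Z → ℤ) → ZMod (ex Z)} (hs : SB d E s)
    {x : Z → ℤ} (hx : x ∈ Q E) (hn : ¬ PP p b (s x)) :
    (p ^ (b + 1)) ^ r ≤ (Finset.univ.filter fun x : Z => p ^ (b + 1) • x = 0).card := by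
  set P := p ^ (b + 1) with hPdef
  have hPpos : 0 < P := pow_pos hp.pos _
  haveI : NeZero P := ⟨hPpos.ne'⟩
  let H := AddSubgroup.closure (E : Set Z)
  let R := (nsmulAddMonoidHom P : H →+ H).range
  let e : E → H := fun b => ⟨b.1, AddSubgroup.subset_closure b.2⟩
  have hPq : ∀ y : H ⧸ R, P • y = 0 := by
    intro y
    obtain ⟨y, rfl⟩ := QuotientAddGroup.mk_surjective y
    rw [← QuotientAddGroup.mk_nsmul]
    exact (QuotientAddGroup.eq_zero_iff _).2 ⟨y, rfl⟩
  let φ : (E → ZMod P) →+ H ⧸ R := ∑ b : E, (ZMod.lift P ⟨zmultiplesHom (H ⧸ R) (e b : H ⧸ R), by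
    simpa using hPq (e b)⟩).comp (Pi.evalAddMonoidHom _ b)
  have hφ : ∀ c : E → ℤ, φ (fun b => (c b : ZMod P)) = ((∑ b, c b • e b : H) : H ⧸ R) := by
    intro c
    simp only [φ, AddMonoidHom.finset_sum_apply, AddMonoidHom.comp_apply,
      Pi.evalAddMonoidHom_apply, ZMod.lift_coe, zmultiplesHom_apply]
    rw [QuotientAddGroup.mk_sum]
    rfl
  -- generator
  let K : AddSubgroup (ZMod (ex Z)) :=
    { carrier := {w | ∃ x ∈ Q E, s x = w}
      zero_mem' := ⟨0, zero_mem _, hs.zero⟩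
      add_mem' := by
        rintro _ _ ⟨x, hx, rfl⟩ ⟨y, hy, rfl⟩
        exact ⟨x + y, add_mem hx hy, hs.add x y hx hy⟩
      neg_mem' := by
        rintro _ ⟨x, hx, rfl⟩
        exact ⟨-x, neg_mem hx, hs.neg hx⟩ }
  obtain ⟨⟨w, q0, hq0, hw⟩, hgen⟩ := IsAddCyclic.exists_generator (α := K)
  have hgen' : ∀ y ∈ Q E, ∃ k : ℤ, s y = k * s q0 := by
    intro y hy
    obtain ⟨k, hk⟩ := hgen ⟨s y, y, hy, rfl⟩
    refine ⟨k, ?_⟩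
    have := congrArg Subtype.val hk
    simp only [AddSubgroup.coe_zsmul] at this
    rw [← this, hw, zsmul_eq_mul]
  let qb : E → ZMod P := fun b => (q0 b.1 : ZMod P)
  have hker : φ.ker ≤ AddSubgroup.zmultiples qb := by
    intro c hc
    rw [AddMonoidHom.mem_ker] at hc
    let c' : E → ℤ := fun b => ((c b).val : ℤ)
    have hcc : c = fun b => (c' b : ZMod P) := by funext b; simp [c']
    rw [hcc, hφ, QuotientAddGroup.eq_zero_iff] at hc
    obtain ⟨y, hy⟩ := hc
    obtain ⟨y', hy', hys⟩ := closure_rep y.2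
    let z : Z → ℤ := fun h => (if hb : h ∈ E then c' ⟨h, hb⟩ else 0) - P * y' h
    have hz : z ∈ Q E := by
      refine ⟨fun h hh => by simp [z, hh, hy' h hh], ?_⟩
      simp only [z, sub_smul, Finset.sum_sub_distrib, mul_smul]
      rw [← Finset.smul_sum, hys, natCast_zsmul, sub_eq_zero]
      have h5 := congrArg Subtype.val hy
      simp only [nsmulAddMonoidHom_apply, AddSubgroup.coe_nsmul, AddSubgroup.val_finsetSum] at h5
      rw [h5, ← Finset.sum_subset (Finset.subset_univ E) (by intro x _ hx; simp [hx])]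
      rw [← Finset.sum_coe_sort E]
      refine Finset.sum_congr rfl fun b _ => ?_
      rw [dif_pos b.2]; simp [e]
    obtain ⟨k, hk⟩ := hgen' z hz
    have hz0 : s (z - k • q0) = 0 := by
      rw [hs.sub hz (zsmul_mem hq0 _), hs.zsmul hq0, hk, sub_self]
    have hdv := pdvd hd hp hE hs hx hn (sub_mem hz (zsmul_mem hq0 k)) hz0
    refine ⟨k, ?_⟩
    funext b
    have h1 := hdv b.1
    simp only [z, Pi.sub_apply, Pi.smul_apply, smul_eq_mul, dif_pos b.2] at h1
    have h2 := (ZMod.intCast_zmod_eq_zero_iff_dvd _ P).2 h1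
    push_cast at h2
    simp only [CharP.cast_eq_zero, zero_mul, sub_zero] at h2
    rw [hcc]
    simp only [qb, Pi.smul_apply, zsmul_eq_mul]
    exact (sub_eq_zero.1 h2).symm
  have hkc : Nat.card φ.ker ≤ P := by
    have h1 : Nat.card φ.ker ≤ Nat.card (AddSubgroup.zmultiples qb) :=
      Nat.card_le_card_of_injective (AddSubgroup.inclusion hker) (AddSubgroup.inclusion_injective hker)
    rw [Nat.card_zmultiples] at h1
    refine h1.trans (addOrderOf_le_of_nsmul_eq_zero hPpos ?_)
    funext b; simp
  have h1 := AddSubgroup.card_eq_card_quotient_mul_card_addSubgroup φ.ker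
  have h2 : Nat.card ((E → ZMod P) ⧸ φ.ker) ≤ Nat.card (H ⧸ R) := by
    rw [Nat.card_congr (QuotientAddGroup.quotientKerEquivRange φ).toEquiv]
    exact Nat.card_le_card_of_injective _ Subtype.val_injective
  have h3 : Nat.card (E → ZMod P) = P ^ (r + 1) := by
    rw [Nat.card_fun, Nat.card_eq_fintype_card (α := ZMod P), ZMod.card,
      Nat.card_eq_fintype_card, Fintype.card_coe, hEc]
  rw [h3] at h1
  have h4 : Nat.card (H ⧸ R) ≤ (Finset.univ.filter fun x : Z => P • x = 0).card := by
    rw [card_quot_eq]; exact card_ker_le P H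
  have h5 : P ^ r * P ≤ (Finset.univ.filter fun x : Z => P • x = 0).card * P := by
    rw [← pow_succ, h1]
    exact Nat.mul_le_mul (h2.trans h4) hkc
  exact Nat.le_of_mul_le_mul_right h5 hPpos

/-- Lemma P -/
theorem lemmaP {d r n s0 : ℕ} (hd : 0 < d) (hrd : r = d + 1)
    (hR : RkLe r Z) {A : Multiset Z} (hA : At A) (hS : Struct d A.toFinset) (hL : LCN A.toFinset)
    (hn : 0 < n) (hk : ck A * n = ex Z * (n + s0 * d)) (hg : Nat.gcd s0 n = 1) :
    ∀ p a : ℕ, p.Prime → 0 < a → p ^ a ∣ n →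
      (p ^ a) ^ r ≤ (Finset.univ.filter fun x : Z => p ^ a • x = 0).card := by
  intro p a hp ha hpa
  obtain ⟨b, rfl⟩ : ∃ b, a = b + 1 := ⟨a - 1, by omega⟩
  obtain ⟨s, hs⟩ := hS.exists_sb hd
  have h1 := hS.sg hd hA (over_toFinset A)
  have h2 : (n : ℤ) * sg d A = ex Z * s0 := by
    have h3 : (ck A : ℤ) * n = ex Z * (n + s0 * d) := by exact_mod_cast hk
    rw [h1] at h3
    have hd0 : (d : ℤ) ≠ 0 := by exact_mod_cast hd.ne'
    refine mul_left_cancel₀ hd0 ?_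
    linear_combination h3
  have hsA := hs.atom A hA (over_toFinset A)
  have hnp : ¬ PP p b (s (cnt A)) := by
    rintro ⟨m, hm, e⟩
    rw [hsA] at e
    have e2 : (((m * p ^ b : ℕ) * sg d A : ℤ) : ZMod (ex Z)) = 0 := by push_cast at e ⊢; exact e
    obtain ⟨k, hk⟩ := (ZMod.intCast_zmod_eq_zero_iff_dvd _ _).1 e2
    have hN0 : (ex Z : ℤ) ≠ 0 := by exact_mod_cast (ex_pos (Z := Z)).ne'
    have h4 : ((m * p ^ b : ℕ) : ℤ) * s0 = n * k := by
      refine mul_left_cancel₀ hN0 ?_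
      linear_combination (-((m * p ^ b : ℕ) : ℤ)) * h2 + (n : ℤ) * hk
    have h5 : n ∣ m * p ^ b * s0 := by
      have : (n : ℤ) ∣ ((m * p ^ b * s0 : ℕ) : ℤ) := ⟨k, by push_cast at h4 ⊢; exact h4⟩
      exact_mod_cast this
    have h6 : p ^ (b + 1) ∣ p ^ b * (m * s0) := by
      refine hpa.trans (h5.trans (dvd_of_eq (by ring)))
    rw [pow_succ] at h6
    have h7 := Nat.dvd_of_mul_dvd_mul_left (pow_pos hp.pos b) h6
    rcases (Nat.Prime.dvd_mul hp).1 h7 with h8 | h8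
    · have := Nat.Coprime.eq_one_of_dvd hm.symm h8
      exact hp.one_lt.ne' this
    · have h9 : p ∣ n := (dvd_pow_self p (by omega)).trans hpa
      have := Nat.dvd_gcd h8 h9
      rw [hg] at this
      exact hp.one_lt.ne' (Nat.dvd_one.1 this)
  obtain ⟨E, hES, hE, hEc, x, hx, hxn⟩ := exists_pmin hd hrd hp hR hS hL hs
    (cnt_mem (over_toFinset A) hA.2.1) hnp
  exact pcount hd hp hE.2 hEc (hs.mono hES) hx hxn

end PF
end ZS

open scoped Classical
set_option linter.unusedSectionVars false

namespace ZS

section Struc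
variable {Z : Type*} [AddCommGroup Z] [Fintype Z]

lemma card_tors_zmod (m P : ℕ) [NeZero m] : Nat.card {x : ZMod m // P • x = 0} = m.gcd P := by
  have h := IsAddCyclic.card_nsmulAddMonoidHom_ker (G := ZMod m) P
  rw [Nat.card_zmod] at h
  rw [← h]
  rfl

lemma card_tors_pi {ι : Type*} [Fintype ι] (m : ι → ℕ) (hm : ∀ i, 0 < m i)
    (e : Z ≃+ (∀ i, ZMod (m i))) (P : ℕ) :
    (Finset.univ.filter fun x : Z => P • x = 0).card = ∏ i, (m i).gcd P := by
  have hne : ∀ i, NeZero (m i) := fun i => ⟨(hm i).ne'⟩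
  have h1 : (Finset.univ.filter fun x : Z => P • x = 0).card =
      Nat.card {x : Z // P • x = 0} := by
    rw [Nat.card_eq_fintype_card, Fintype.card_subtype]
  let E : {x : Z // P • x = 0} ≃ ∀ i, {x : ZMod (m i) // P • x = 0} :=
    { toFun := fun x i => ⟨e x.1 i, by
        have := congrFun (congrArg e x.2) i
        rw [map_nsmul, map_zero] at this
        exact this⟩
      invFun := fun y => ⟨e.symm fun i => (y i).1, by
        rw [← map_nsmul, AddEquiv.map_eq_zero_iff]
        funext i
        exact (y i).2⟩
      left_inv := fun x => by simp
      right_inv := fun y => by simp }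
  rw [h1, Nat.card_congr E, Nat.card_pi]
  exact Finset.prod_congr rfl fun i _ => card_tors_zmod _ _

lemma rkLe_of_equiv {r : ℕ} (m : Fin r → ℕ) (hm : ∀ i, 0 < m i)
    (e : Z ≃+ (∀ i, ZMod (m i))) : RkLe r Z := by
  intro p hp
  rw [card_tors_pi m hm e]
  calc _ ≤ ∏ _i : Fin r, p := Finset.prod_le_prod' fun i _ => Nat.gcd_le_right _ hp.pos
    _ = _ := by simp

theorem exists_decomp {r : ℕ} (hR : RkLe r Z) : ∃ m : Fin r → ℕ, (∀ i, 0 < m i) ∧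
    Nonempty (Z ≃+ (∀ i, ZMod (m i))) := by
  obtain ⟨ι, hι, p, hp, n, ⟨e0⟩⟩ := AddCommGroup.equiv_directSum_zmod_of_finite Z
  let κ := {i : ι // n i ≠ 0}
  let q : κ → ℕ := fun i => p i.1 ^ n i.1
  have hq : ∀ i, 0 < q i := fun i => pow_pos (hp i.1).pos _
  let er : (∀ i : ι, ZMod (p i ^ n i)) ≃+ (∀ i : κ, ZMod (q i)) :=
    { toFun := fun f i => f i.1
      invFun := fun g i => if h : n i ≠ 0 then g ⟨i, h⟩ else 0
      left_inv := fun f => by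
        funext i
        by_cases h : n i ≠ 0
        · simp [h]
        · push Not at h
          have : Subsingleton (ZMod (p i ^ n i)) := by rw [h, pow_zero]; infer_instance
          exact Subsingleton.elim _ _
      right_inv := fun g => by
        funext i
        exact dif_pos i.2
      map_add' := fun f g => rfl }
  let e1 : Z ≃+ (∀ i : κ, ZMod (q i)) := (e0.trans (DirectSum.addEquivProd _)).trans er
  have hcard : ∀ t : ℕ, t.Prime → (Finset.univ.filter fun i : κ => p i.1 = t).card ≤ r := by
    intro t ht
    have h1 := hR t ht
    rw [card_tors_pi q hq e1] at h1
    have h2 : t ^ (Finset.univ.filter fun i : κ => p i.1 = t).card ≤ ∏ i, (q i).gcd t := by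
      rw [← Finset.prod_const, Finset.prod_filter]
      refine Finset.prod_le_prod' fun i _ => ?_
      split_ifs with h
      · refine Nat.le_of_dvd (Nat.gcd_pos_of_pos_left _ (hq i)) (Nat.dvd_gcd ?_ dvd_rfl)
        rw [← h]; exact dvd_pow_self _ i.2
      · exact Nat.gcd_pos_of_pos_left _ (hq i)
    exact (Nat.pow_le_pow_iff_right ht.one_lt).1 (h2.trans h1)
  have hcol : ∀ t : ℕ, ∃ c : {i : κ // p i.1 = t} → Fin r, Function.Injective c := by
    intro t
    by_cases ht : t.Prime
    · have h1 := hcard t ht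
      rw [← Fintype.card_subtype, ← Fintype.card_fin r] at h1
      obtain ⟨f⟩ := Function.Embedding.nonempty_of_card_le h1
      exact ⟨f, f.injective⟩
    · haveI : IsEmpty {i : κ // p i.1 = t} := ⟨fun i => ht (i.2 ▸ hp i.1.1)⟩
      exact ⟨fun i => isEmptyElim i, Function.injective_of_subsingleton _⟩
  choose c hc using hcol
  let col : κ → Fin r := fun i => c (p i.1) ⟨i, rfl⟩
  have hcol : ∀ i j : κ, p i.1 = p j.1 → col i = col j → i = j := by
    have aux : ∀ t, ∀ i j : κ, ∀ hi : p i.1 = t, ∀ hj : p j.1 = t, c t ⟨i, hi⟩ = c t ⟨j, hj⟩ → i = j := by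
      intro t i j hi hj h
      have := hc t h
      simpa using this
    intro i j hij h
    refine aux (p i.1) i j rfl hij.symm (h.trans ?_)
    simp only [col]
    congr 1
    · exact hij.symm
    · congr 1
      · funext k; rw [hij]
      · exact proof_irrel_heq _ _
  let e2 : (∀ i : κ, ZMod (q i)) ≃+ (∀ j : Fin r, ∀ i : {i : κ // col i = j}, ZMod (q i.1)) :=
    { toFun := fun f j i => f i.1
      invFun := fun g i => g (col i) ⟨i, rfl⟩
      left_inv := fun f => rfl
      right_inv := fun g => by
        funext j ⟨i, hi⟩
        subst hi; rfl
      map_add' := fun f g => rfl }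
  have hco : ∀ j : Fin r, Pairwise (Function.onFun Nat.Coprime fun i : {i : κ // col i = j} => q i.1) := by
    intro j i i' hne
    refine Nat.Coprime.pow _ _ ((Nat.coprime_primes (hp _) (hp _)).2 fun h => hne ?_)
    exact Subtype.ext (hcol _ _ h (i.2.trans i'.2.symm))
  refine ⟨fun j => ∏ i : {i : κ // col i = j}, q i.1, fun j => Finset.prod_pos fun i _ => hq _,
    ⟨(e1.trans e2).trans (AddEquiv.piCongrRight fun j => (ZMod.prodEquivPi _ (hco j)).symm.toAddEquiv)⟩⟩

lemma ex_decomp {r : ℕ} (m : Fin r → ℕ) (e : Z ≃+ (∀ i, ZMod (m i))) (i : Fin r) :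
    m i ∣ ex Z := by
  have h : ex Z • (Pi.single i 1 : ∀ i, ZMod (m i)) = 0 := by
    rw [← e.apply_symm_apply (Pi.single i 1), ← map_nsmul, ex_smul, map_zero]
  have h2 := congrFun h i
  simp only [Pi.smul_apply, Pi.single_eq_same, nsmul_eq_mul, mul_one, Pi.zero_apply] at h2
  exact (ZMod.natCast_eq_zero_iff _ _).1 h2

lemma card_le_of_rk {r : ℕ} (hR : RkLe r Z) : Fintype.card Z ≤ ex Z ^ r := by
  obtain ⟨m, hm, ⟨e⟩⟩ := exists_decomp hR
  have : ∀ i, NeZero (m i) := fun i => ⟨(hm i).ne'⟩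
  rw [← Nat.card_eq_fintype_card, Nat.card_congr e.toEquiv, Nat.card_pi]
  calc _ ≤ ∏ _i : Fin r, ex Z := Finset.prod_le_prod' fun i _ => by
          rw [Nat.card_zmod]; exact Nat.le_of_dvd ex_pos (ex_decomp m e i)
    _ = _ := by simp

lemma zmod_embed {m n : ℕ} (hm : 0 < m) (hn : 0 < n) (h : m ∣ n) :
    ∃ f : ZMod m →+ ZMod n, Function.Injective f := by
  obtain ⟨k, rfl⟩ := h
  have : NeZero m := ⟨hm.ne'⟩
  refine ⟨ZMod.lift m ⟨zmultiplesHom _ (k : ZMod (m * k)), ?_⟩, ?_⟩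
  · simp only [zmultiplesHom_apply, natCast_zsmul, nsmul_eq_mul]
    exact_mod_cast ZMod.natCast_self (m * k)
  · rw [injective_iff_map_eq_zero]
    intro a ha
    obtain ⟨a, rfl⟩ := ZMod.intCast_surjective a
    rw [ZMod.lift_coe] at ha
    simp only [zmultiplesHom_apply, zsmul_eq_mul] at ha
    have h1 : ((a * k : ℤ) : ZMod (m * k)) = 0 := by push_cast; exact ha
    rw [ZMod.intCast_zmod_eq_zero_iff_dvd] at h1 ⊢
    push_cast at h1
    have hk : (k : ℤ) ≠ 0 := by
      rintro h0
      have : k = 0 := by exact_mod_cast h0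
      subst this; simp at hn
    exact Int.dvd_of_mul_dvd_mul_right hk h1

lemma pi_embed {r : ℕ} {m n : Fin r → ℕ} (hm : ∀ i, 0 < m i) (hn : ∀ i, 0 < n i)
    (h : ∀ i, m i ∣ n i) : ∃ f : (∀ i, ZMod (m i)) →+ (∀ i, ZMod (n i)), Function.Injective f := by
  choose f hf using fun i => zmod_embed (hm i) (hn i) (h i)
  refine ⟨AddMonoidHom.mk' (fun x i => f i (x i)) (fun x y => by funext i; simp), ?_⟩
  intro x y hxy
  funext i
  exact hf i (congrFun hxy i)

lemma embed_into {r n : ℕ} (hn : 0 < n) (hR : RkLe r Z) (he : ex Z ∣ n) :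
    ∃ f : Z →+ (Fin r → ZMod n), Function.Injective f := by
  obtain ⟨m, hm, ⟨e⟩⟩ := exists_decomp hR
  obtain ⟨f, hf⟩ := pi_embed (n := fun _ => n) hm (fun _ => hn) (fun i => (ex_decomp m e i).trans he)
  exact ⟨f.comp e.toAddMonoidHom, hf.comp e.injective⟩

lemma embed_from {r n : ℕ} (hn : 0 < n) (hR : RkLe r Z)
    (h : ∀ p a : ℕ, p.Prime → 0 < a → p ^ a ∣ n →
      (p ^ a) ^ r ≤ (Finset.univ.filter fun x : Z => p ^ a • x = 0).card) :
    ∃ f : (Fin r → ZMod n) →+ Z, Function.Injective f := by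
  obtain ⟨m, hm, ⟨e⟩⟩ := exists_decomp hR
  have key : ∀ i, n ∣ m i := by
    intro i
    rw [Nat.dvd_iff_prime_pow_dvd_dvd]
    intro p a hp ha
    rcases Nat.eq_zero_or_pos a with rfl | ha0
    · simp
    have h1 := h p a hp ha0 ha
    rw [card_tors_pi m hm e] at h1
    have hP : 0 < p ^ a := pow_pos hp.pos _
    by_contra hc
    have h2 : (m i).gcd (p ^ a) < p ^ a := by
      refine lt_of_le_of_ne (Nat.gcd_le_right _ hP) fun hg => hc ?_
      rw [← hg]; exact Nat.gcd_dvd_left _ _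
    have h3 : ∏ j, (m j).gcd (p ^ a) < ∏ _j : Fin r, p ^ a :=
      Finset.prod_lt_prod (fun j _ => Nat.gcd_pos_of_pos_left _ (hm j))
        (fun j _ => Nat.gcd_le_right _ hP) ⟨i, Finset.mem_univ _, h2⟩
    simp at h3
    omega
  obtain ⟨f, hf⟩ := pi_embed (m := fun _ => n) (fun _ => hn) hm key
  exact ⟨e.symm.toAddMonoidHom.comp f, e.symm.injective.comp hf⟩

/-- many independent elements of order p -/
lemma exists_indep_of_not_rk {r : ℕ} (h : ¬ RkLe r Z) : ∃ p : ℕ, p.Prime ∧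
    ∃ e : Fin (r + 1) → Z, (∀ i, p • e i = 0) ∧
      ∀ c : Fin (r + 1) → ℤ, ∑ i, c i • e i = 0 → ∀ i, (p : ℤ) ∣ c i := by
  unfold RkLe at h
  push Not at h
  obtain ⟨p, hp, hc⟩ := h
  refine ⟨p, hp, ?_⟩
  haveI : Fact p.Prime := ⟨hp⟩
  let V := (nsmulAddMonoidHom p : Z →+ Z).ker
  have hV : ∀ x : V, p • x = 0 := by
    intro x
    have := x.2
    rw [AddMonoidHom.mem_ker] at this
    exact Subtype.ext this
  letI : Module (ZMod p) V := AddCommGroup.zmodModule hV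
  have hcard : Fintype.card V = (Finset.univ.filter fun x : Z => p • x = 0).card := by
    rw [← Fintype.card_subtype]
    exact Fintype.card_congr (Equiv.refl _)
  rw [← hcard, Module.card_eq_pow_finrank (K := ZMod p) (V := V), ZMod.card] at hc
  have hfr : r + 1 ≤ Module.finrank (ZMod p) V := (Nat.pow_lt_pow_iff_right hp.one_lt).1 hc
  let b := Module.finBasis (ZMod p) V
  refine ⟨fun i => (b (Fin.castLE hfr i) : Z), fun i => ?_, ?_⟩
  · have := congrArg Subtype.val (hV (b (Fin.castLE hfr i)))
    simpa using this
  · intro c hcs i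
    have hli := b.linearIndependent.comp _ (Fin.castLE_injective hfr)
    rw [Fintype.linearIndependent_iff] at hli
    have := hli (fun i => (c i : ZMod p)) ?_ i
    · exact (ZMod.intCast_zmod_eq_zero_iff_dvd _ _).1 this
    · apply Subtype.ext
      simp only [Function.comp]
      rw [AddSubgroup.val_finsetSum]
      refine Eq.trans (Finset.sum_congr rfl fun j _ => ?_) hcs
      have : ((c j : ZMod p)) • b (Fin.castLE hfr j) = c j • b (Fin.castLE hfr j) := by
        rw [← Int.cast_smul_eq_zsmul (ZMod p)]
      rw [this]; rfl

end Struc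
end ZS

open scoped Classical
set_option linter.unusedSectionVars false

namespace ZS

section Bridge
variable {Z : Type*} [AddCommGroup Z]

def Len (B : Multiset Z) (k : ℕ) : Prop := ∃ f, Fac f ∧ f.sum = B ∧ f.card = k

lemma isMin_iff {S : Set Z} {A : Multiset Z} : IsMinZeroSum S A ↔ At A ∧ ∀ g ∈ A, g ∈ S := by
  unfold IsMinZeroSum At; tauto

lemma mem_lengthSet {S : Set Z} {B : Multiset Z} {k : ℕ} (hB : ∀ g ∈ B, g ∈ S) :
    k ∈ lengthSet S B ↔ Len B k := by
  constructor
  · rintro ⟨U, hU, rfl⟩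
    refine ⟨Multiset.map U Finset.univ.val, ?_, rfl, by simp⟩
    intro A hA
    obtain ⟨i, _, rfl⟩ := Multiset.mem_map.1 hA
    exact (isMin_iff.1 (hU i)).1
  · rintro ⟨f, hf, hs, rfl⟩
    have h1 : f.toList.length = f.card := Multiset.length_toList f
    refine ⟨fun i => f.toList.get (Fin.cast h1.symm i), fun i => isMin_iff.2 ⟨?_, ?_⟩, ?_⟩
    · exact hf _ (Multiset.mem_toList.1 (List.get_mem _ _))
    · intro g hg
      refine hB g ?_
      rw [← hs]
      exact Multiset.mem_of_le (Multiset.single_le_sum (fun _ _ => Multiset.zero_le _) _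
        (Multiset.mem_toList.1 (List.get_mem _ _))) hg
    · rw [← hs]
      conv_lhs => rw [← Multiset.coe_toList f]
      rw [Multiset.sum_coe]
      conv_lhs => rw [← List.ofFn_get f.toList]
      rw [List.sum_ofFn]
      exact Fintype.sum_equiv (finCongr h1) _ _ (fun i => by simp)

def SameL (Z Z' : Type*) [AddCommGroup Z] [AddCommGroup Z'] : Prop :=
  ∀ B : Multiset Z, B.sum = 0 → ∃ B' : Multiset Z', B'.sum = 0 ∧ ∀ k, Len B k ↔ Len B' k

lemma sameL_of {Z' : Type*} [AddCommGroup Z']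
    (h : systemL (Set.univ : Set Z) = systemL (Set.univ : Set Z')) : SameL Z Z' := by
  intro B hB
  have h1 : lengthSet Set.univ B ∈ systemL (Set.univ : Set Z) := ⟨B, ⟨by simp, hB⟩, rfl⟩
  rw [h] at h1
  obtain ⟨B', hB', he⟩ := h1
  refine ⟨B', hB'.2, fun k => ?_⟩
  rw [← mem_lengthSet (S := Set.univ) (by simp), he, mem_lengthSet (by simp)]

lemma dav_bdd [Fintype Z] : BddAbove
    {m | ∃ A : Multiset Z, IsMinZeroSum (Set.univ : Set Z) A ∧ Multiset.card A = m} := by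
  refine ⟨Fintype.card Z * ex Z, ?_⟩
  rintro m ⟨A, hA, rfl⟩
  exact (isMin_iff.1 hA).1.card_le

lemma At.card_le_dav [Fintype Z] {A : Multiset Z} (hA : At A) : A.card ≤ davenport Z :=
  le_csSup dav_bdd ⟨A, isMin_iff.2 ⟨hA, by simp⟩, rfl⟩

lemma exists_dav [Fintype Z] : ∃ A : Multiset Z, At A ∧ A.card = davenport Z := by
  have h := Nat.sSup_mem (s := {m | ∃ A : Multiset Z, IsMinZeroSum (Set.univ : Set Z) A ∧
    Multiset.card A = m}) ⟨1, {0}, isMin_iff.2 ⟨at_zero, by simp⟩, by simp⟩ dav_bdd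
  obtain ⟨A, hA, hc⟩ := h
  exact ⟨A, (isMin_iff.1 hA).1, hc⟩

lemma At.neg {A : Multiset Z} (hA : At A) : At (A.map Neg.neg) := by
  refine ⟨by simpa using hA.1, by rw [Multiset.sum_map_neg', hA.2.1, neg_zero], fun T hT hs => ?_⟩
  have h1 : T.map Neg.neg ≤ A := by
    have := Multiset.map_le_map (f := Neg.neg) hT
    simpa using this
  rcases hA.2.2 _ h1 (by rw [Multiset.sum_map_neg', hs, neg_zero]) with h | h
  · left; simpa using h
  · right; rw [← h]; simp

lemma At.no_zero {A : Multiset Z} (hA : At A) (h : 2 ≤ A.card) : (0 : Z) ∉ A := by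
  intro h0
  rw [hA.zero_mem h0] at h; simp at h

lemma pairs_fac (A : Multiset Z) (h0 : (0 : Z) ∉ A) :
    ∃ f, Fac f ∧ f.sum = A + A.map Neg.neg ∧ f.card = A.card := by
  induction A using Multiset.induction with
  | empty => exact ⟨0, fac_zero, by simp, by simp⟩
  | cons a A ih =>
    rw [Multiset.mem_cons, not_or] at h0
    obtain ⟨f, hf, hs, hc⟩ := ih h0.2
    refine ⟨{({a, -a} : Multiset Z)} + f, (Fac.single (at_pair (Ne.symm h0.1))).add hf, ?_, by simp [hc]⟩
    rw [Multiset.sum_add, hs, Multiset.sum_singleton, Multiset.map_cons]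
    simp only [Multiset.insert_eq_cons, ← Multiset.singleton_add]
    abel

lemma card_ge_of_fac {f : Multiset (Multiset Z)} (hf : Fac f) (h0 : (0 : Z) ∉ f.sum) :
    2 * f.card ≤ f.sum.card := by
  induction f using Multiset.induction with
  | empty => simp
  | cons A f ih =>
    rw [Multiset.sum_cons] at h0 ⊢
    rw [Multiset.mem_add, not_or] at h0
    have h1 := ih (fun B hB => hf B (Multiset.mem_cons_of_mem hB)) h0.2
    have h2 := (hf A (Multiset.mem_cons_self _ _)).two_le_card (by rintro rfl; simp at h0)
    rw [Multiset.card_add, Multiset.card_cons]; omega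

/-- removing zeros -/
lemma zero_mem_fac {f : Multiset (Multiset Z)} (hf : Fac f) (h0 : (0 : Z) ∈ f.sum) :
    ∃ f', f = {0} ::ₘ f' := by
  obtain ⟨A, hA, h⟩ : ∃ A ∈ f, (0 : Z) ∈ A := by
    clear hf
    induction f using Multiset.induction with
    | empty => simp at h0
    | cons B f ih =>
      rw [Multiset.sum_cons, Multiset.mem_add] at h0
      rcases h0 with h | h
      · exact ⟨B, by simp, h⟩
      · obtain ⟨A, hA, h⟩ := ih h
        exact ⟨A, Multiset.mem_cons_of_mem hA, h⟩
  rw [(hf A hA).zero_mem h] at hA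
  exact Multiset.exists_cons_of_mem hA

lemma dav_le_of_sameL {Z' : Type*} [AddCommGroup Z'] [Fintype Z] [Fintype Z'] (h : SameL Z Z')
    (h3 : 3 ≤ davenport Z) : davenport Z ≤ davenport Z' := by
  obtain ⟨A, hA, hc⟩ := exists_dav (Z := Z)
  obtain ⟨f, hf, hs, hfc⟩ := pairs_fac A (hA.no_zero (by omega))
  obtain ⟨B', hB', hL⟩ := h (A + A.map Neg.neg) (by
    rw [Multiset.sum_add, hA.2.1, hA.neg.2.1, add_zero])
  obtain ⟨g, hg, hgs, hgc⟩ := (hL 2).1 ⟨{A, A.map Neg.neg}, by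
    intro B hB
    simp only [Multiset.insert_eq_cons, Multiset.mem_cons, Multiset.mem_singleton] at hB
    rcases hB with rfl | rfl
    exacts [hA, hA.neg], by simp, by simp⟩
  obtain ⟨g', hg', hgs', hgc'⟩ := (hL A.card).1 ⟨f, hf, hs, hfc⟩
  obtain ⟨U, V, rfl⟩ := Multiset.card_eq_two.1 hgc
  have hU := hg U (by simp)
  have hV := hg V (by simp)
  have hUV : U + V = B' := by simpa using hgs
  have aux : ∀ U V : Multiset Z', At V → U + V = B' → U ≠ {0} := by
    rintro U V hV hUV rfl
    obtain ⟨g1, rfl⟩ := zero_mem_fac hg' (by rw [hgs', ← hUV]; simp)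
    rw [← hUV, Multiset.sum_cons] at hgs'
    have := hV.fac_unique (fun A hA => hg' A (Multiset.mem_cons_of_mem hA)) (add_left_cancel hgs')
    rw [this] at hgc'
    simp at hgc'; omega
  have h0 : (0 : Z') ∉ g'.sum := by
    rw [hgs', ← hUV, Multiset.mem_add, not_or]
    exact ⟨fun hc => aux U V hV hUV (hU.zero_mem hc),
      fun hc => aux V U hU (by rw [add_comm, hUV]) (hV.zero_mem hc)⟩
  have h1 := card_ge_of_fac hg' h0
  rw [hgs', ← hUV, Multiset.card_add] at h1
  have := hU.card_le_dav
  have := hV.card_le_dav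
  omega

lemma filter_le_of {P : Z → Prop} [DecidablePred P] {T C D : Multiset Z} (hT : T ≤ C + D) (hC : ∀ x ∈ C, ¬ P x) :
    T.filter P ≤ D := by
  have h1 := Multiset.filter_le_filter P hT
  rw [Multiset.filter_add, Multiset.filter_eq_nil.2 hC, zero_add] at h1
  exact h1.trans (Multiset.filter_le _ _)

lemma surj_of_dav {H : Type*} [AddCommGroup H] [Fintype H] [Fintype Z] (f : H →+ Z)
    (hf : Function.Injective f) (hD : davenport Z ≤ davenport H) : Function.Surjective f := by
  by_contra hns
  unfold Function.Surjective at hns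
  push Not at hns
  obtain ⟨x, hx⟩ := hns
  obtain ⟨A, hA, hc⟩ := exists_dav (Z := H)
  obtain ⟨g, hg⟩ := Multiset.exists_mem_of_ne_zero hA.1
  obtain ⟨A', rfl⟩ := Multiset.exists_cons_of_mem hg
  have hsA : g + A'.sum = 0 := by simpa using hA.2.1
  have hx2 : ∀ a, f a ≠ f g - x := fun a ha => hx (g - a) (by rw [map_sub, ha]; abel)
  have hC : At (({x, f g - x} : Multiset Z) + A'.map f) := by
    refine ⟨by simp [Multiset.insert_eq_cons], ?_, fun T hT hs => ?_⟩
    · rw [Multiset.sum_add, Multiset.sum_hom]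
      have := congrArg f hsA
      rw [map_add, map_zero] at this
      simpa [Multiset.insert_eq_cons] using this
    · have hin : T.filter (fun y => y ∈ Set.range f) ≤ A'.map f := by
        refine filter_le_of hT ?_
        simp only [Multiset.insert_eq_cons, Multiset.mem_cons, Multiset.mem_singleton, Set.mem_range,
          not_exists]
        rintro y (rfl | rfl)
        exacts [hx, hx2]
      have hout : T.filter (fun y => ¬ y ∈ Set.range f) ≤ {x, f g - x} := by
        rw [add_comm] at hT
        refine filter_le_of hT ?_
        intro y hy
        obtain ⟨a, _, rfl⟩ := Multiset.mem_map.1 hy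
        simp
      have hsplit := Multiset.filter_add_not (fun y => y ∈ Set.range f) T
      obtain ⟨A2, hA2, hA2e⟩ : ∃ A2 ≤ A', A2.map f = T.filter (fun y => y ∈ Set.range f) := by
        obtain ⟨u, hu⟩ := Multiset.le_iff_exists_add.1 hin
        have hmem : ∀ y ∈ T.filter (fun y => y ∈ Set.range f), ∃ a, f a = y := by
          intro y hy; exact (Multiset.mem_filter.1 hy).2
        let inv : Z → H := Function.invFun f
        refine ⟨(T.filter (fun y => y ∈ Set.range f)).map inv, ?_, ?_⟩
        · have := Multiset.map_le_map (f := inv) hin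
          rw [Multiset.map_map] at this
          simpa [inv, Function.comp_def, Function.leftInverse_invFun hf _] using this
        · rw [Multiset.map_map]
          conv_rhs => rw [← Multiset.map_id (T.filter (fun y => y ∈ Set.range f))]
          refine Multiset.map_congr rfl fun y hy => ?_
          exact Function.invFun_eq (hmem y hy)
      rw [← hA2e] at hsplit
      set T1 := T.filter (fun y => ¬ y ∈ Set.range f) with hT1
      have hs1 : f A2.sum + T1.sum = 0 := by
        rw [← hs, ← hsplit, Multiset.sum_add, Multiset.sum_hom]
      have hcase : T1 = 0 ∨ T1 = {x} ∨ T1 = {f g - x} ∨ T1 = {x, f g - x} := by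
        have hm : T1 ∈ Multiset.powerset ({x, f g - x} : Multiset Z) := Multiset.mem_powerset.2 hout
        rw [Multiset.insert_eq_cons, Multiset.powerset_cons] at hm
        rw [← Multiset.cons_zero (f g - x), Multiset.powerset_cons] at hm
        simp only [Multiset.powerset_zero, Multiset.map_singleton, Multiset.mem_add,
          Multiset.mem_singleton, Multiset.map_add] at hm
        rcases hm with (h | h) | (h | h)
        · exact Or.inl h
        · exact Or.inr (Or.inr (Or.inl h))
        · exact Or.inr (Or.inl h)
        · exact Or.inr (Or.inr (Or.inr h))
      rcases hcase with h | h | h | h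
      · left
        rw [h, Multiset.sum_zero, add_zero, map_eq_zero_iff f hf] at hs1
        rcases hA.2.2 A2 (hA2.trans (Multiset.le_cons_self _ _)) hs1 with h2 | h2
        · rw [← hsplit, h, h2]; simp
        · have := Multiset.card_le_card hA2
          rw [h2] at this; simp at this
      · exfalso
        rw [h, Multiset.sum_singleton] at hs1
        exact hx (-A2.sum) (by rw [map_neg]; exact neg_eq_of_add_eq_zero_right hs1)
      · exfalso
        rw [h, Multiset.sum_singleton] at hs1
        exact hx2 (-A2.sum) (by rw [map_neg]; exact neg_eq_of_add_eq_zero_right hs1)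
      · right
        rw [h] at hs1
        have h2 : g + A2.sum = 0 := by
          rw [← map_eq_zero_iff f hf, map_add, ← hs1]
          simp [Multiset.insert_eq_cons]; abel
        have h3 := hA.eq_of_le (B := g ::ₘ A2) (Multiset.cons_le_cons _ hA2) (by simpa using h2) (by simp)
        rw [← hsplit, h, (Multiset.cons_inj_right _).1 h3, add_comm]
  have := hC.card_le_dav
  rw [Multiset.card_add] at this
  simp [Multiset.insert_eq_cons] at this hc
  omega

lemma dav_two [Fintype Z] {r : ℕ} (h2 : ∀ z : Z, z + z = 0) (hr : 1 ≤ r)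
    (hc : Fintype.card Z ≤ 2 ^ r) : davenport Z ≤ r + 1 := by
  obtain ⟨A, hA, hcA⟩ := exists_dav (Z := Z)
  by_contra hcon
  have hnd : A.Nodup := by
    rw [Multiset.nodup_iff_count_le_one]
    intro a
    by_contra hc
    have h1 : 2 • ({a} : Multiset Z) ≤ A := pow_le_iff.2 (by omega)
    have := hA.eq_of_le h1 (by simp [Multiset.sum_nsmul, two_nsmul, h2]) (by
      intro h; have := congrArg Multiset.card h; simp at this)
    rw [← this] at hcA; simp at hcA; omega
  obtain ⟨g, hg⟩ := Multiset.exists_mem_of_ne_zero hA.1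
  let F := A.toFinset.erase g
  have hF : F.card + 1 = A.card := by
    have h1 : A.toFinset.card = A.card := Multiset.toFinset_card_of_nodup hnd
    have := Finset.card_erase_add_one (Multiset.mem_toFinset.2 hg)
    simp only [F]; omega
  have hpig : Fintype.card Z < F.powerset.card := by
    rw [Finset.card_powerset]
    exact hc.trans_lt (Nat.pow_lt_pow_right (by norm_num) (by omega))
  obtain ⟨X, hX, Y, hY, hXY, hs⟩ := Finset.exists_ne_map_eq_of_card_lt_of_maps_to (s := F.powerset)
    (t := Finset.univ) (by rw [Finset.card_univ]; exact hpig) (f := fun X : Finset Z => ∑ x ∈ X, x) (by simp)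
  have hsd : ∑ x ∈ symmDiff X Y, x = 0 := by
    have e1 : ∑ x ∈ symmDiff X Y, x = ∑ x ∈ X \ Y, x + ∑ x ∈ Y \ X, x := by
      rw [symmDiff_def, Finset.sup_eq_union, Finset.sum_union]
      exact disjoint_sdiff_sdiff
    have e2 := Finset.sum_sdiff_sub_sum_sdiff (s₁ := X) (s₂ := Y) (f := fun x : Z => x)
    have hs' : ∑ x ∈ X, x = ∑ x ∈ Y, x := hs
    rw [hs', sub_self] at e2
    have e3 : ∑ x ∈ X \ Y, x = ∑ x ∈ Y \ X, x := by
      have := sub_eq_zero.1 e2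
      first | exact this | exact this.symm
    rw [e1, e3, h2]
  have hle : (symmDiff X Y).val ≤ A := by
    rw [Multiset.le_iff_subset (symmDiff X Y).nodup]
    intro x hx
    have : x ∈ symmDiff X Y := hx
    rw [Finset.mem_symmDiff] at this
    have hx' : x ∈ F := by
      rcases this with h | h
      exacts [Finset.mem_powerset.1 hX h.1, Finset.mem_powerset.1 hY h.1]
    exact Multiset.mem_toFinset.1 (Finset.mem_of_mem_erase hx')
  have hne : (symmDiff X Y).val ≠ 0 := by
    rw [Ne, Finset.val_eq_zero]
    intro h
    exact hXY (symmDiff_eq_bot.1 h)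
  have := hA.eq_of_le hle (by rw [← hsd, Finset.sum_val]; rfl) hne
  have hgm : g ∈ symmDiff X Y := by show g ∈ (symmDiff X Y).val; rw [this]; exact hg
  rw [Finset.mem_symmDiff] at hgm
  have hx' : g ∈ F := by
    rcases hgm with h | h
    exacts [Finset.mem_powerset.1 hX h.1, Finset.mem_powerset.1 hY h.1]
  simp [F] at hx'

end Bridge
end ZS

open scoped Classical
set_option linter.unusedSectionVars false

namespace ZS

section BdSec
variable {Z : Type*} [AddCommGroup Z]

def Bd (Z : Type*) [AddCommGroup Z] (d : ℕ) (β : ℝ) : Prop :=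
  ∃ C : ℝ, ∀ B : Multiset Z, B.sum = 0 → (∀ k l, Len B k → Len B l → k ≡ l [MOD d]) →
    ∀ a b, Len B a → Len B b → (b : ℝ) ≤ β * a + C

lemma Bd.transfer {Z' : Type*} [AddCommGroup Z'] {d : ℕ} {β : ℝ} (h : SameL Z Z')
    (hb : Bd Z' d β) : Bd Z d β := by
  obtain ⟨C, hC⟩ := hb
  refine ⟨C, fun B hB hm a b ha hb => ?_⟩
  obtain ⟨B', hB', hL⟩ := h B hB
  exact hC B' hB' (fun k l hk hl => hm k l ((hL k).2 hk) ((hL l).2 hl)) a b ((hL a).1 ha) ((hL b).1 hb)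

lemma Bd.lower {d : ℕ} {β : ℝ} (hb : Bd Z d β) {S : Finset Z} (hS : Struct d S)
    {f f' : Multiset (Multiset Z)} (hf : Fac f) (hf' : Fac f') (he : f.sum = f'.sum)
    (ho : Over S f.sum) : (f'.card : ℝ) ≤ β * f.card := by
  obtain ⟨C, hC⟩ := hb
  have key : ∀ n : ℕ, (n : ℝ) * ((f'.card : ℝ) - β * f.card) ≤ C := by
    intro n
    have := hC (n • f).sum ((hf.nsmul n).sum_zero) ?_ (n * f.card) (n * f'.card)
      ⟨n • f, hf.nsmul n, rfl, by simp⟩ ⟨n • f', hf'.nsmul n, by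
        rw [Multiset.sum_nsmul, Multiset.sum_nsmul, he], by simp⟩
    · push_cast at this; nlinarith
    · rintro k l ⟨u, hu, hus, rfl⟩ ⟨v, hv, hvs, rfl⟩
      exact hS u v hu hv (by rw [hus, hvs]) (by rw [hus, Multiset.sum_nsmul]; exact ho.nsmul n)
  by_contra hc
  push Not at hc
  obtain ⟨n, hn⟩ := exists_nat_gt (C / ((f'.card : ℝ) - β * f.card))
  rw [div_lt_iff₀ (by linarith)] at hn
  linarith [key n]

lemma Bd.ck [Fintype Z] {d : ℕ} {β : ℝ} (hb : Bd Z d β) {A : Multiset Z} (hA : At A)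
    (hS : Struct d A.toFinset) : (ck A : ℝ) ≤ β * ex Z := by
  have := hb.lower hS (f := ex Z • {A}) (f' := powFac A) ((Fac.single hA).nsmul _) (powFac_fac _)
    (by rw [powFac_sum, Multiset.sum_nsmul, Multiset.sum_singleton])
    (by rw [Multiset.sum_nsmul, Multiset.sum_singleton]; exact (over_toFinset A).nsmul _)
  rw [powFac_card] at this
  simpa using this

noncomputable def omg (ω : Z → ℝ) (B : Multiset Z) : ℝ := (B.map ω).sum

lemma omg_zero (ω : Z → ℝ) : omg ω 0 = 0 := rfl
lemma omg_add (ω : Z → ℝ) (A B : Multiset Z) : omg ω (A + B) = omg ω A + omg ω B := by simp [omg]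
lemma omg_nonneg {ω : Z → ℝ} (h : ∀ z, 0 ≤ ω z) (B : Multiset Z) : 0 ≤ omg ω B := by
  apply Multiset.sum_nonneg
  intro x hx
  obtain ⟨z, _, rfl⟩ := Multiset.mem_map.1 hx
  exact h z
lemma omg_count [Fintype Z] (ω : Z → ℝ) (B : Multiset Z) : omg ω B = ∑ h, (B.count h : ℝ) * ω h := by
  induction B using Multiset.induction with
  | empty => simp [omg]
  | cons a B ih =>
    have : omg ω (a ::ₘ B) = ω a + omg ω B := by simp [omg]
    rw [this, ih]
    have h2 : ∀ h, ((a ::ₘ B).count h : ℝ) * ω h = (if h = a then ω a else 0) + B.count h * ω h := by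
      intro h
      rw [Multiset.count_cons]
      split_ifs with hh
      · subst hh; push_cast; ring
      · push_cast; ring
    simp_rw [h2, Finset.sum_add_distrib]
    simp

lemma fac_ind {P : Multiset Z → ℕ → Prop} (h0 : P 0 0)
    (hs : ∀ A B k, At A → P B k → P (A + B) (k + 1)) {f : Multiset (Multiset Z)} (hf : Fac f) :
    P f.sum f.card := by
  induction f using Multiset.induction with
  | empty => simpa using h0
  | cons A f ih =>
    rw [Multiset.sum_cons, Multiset.card_cons]
    exact hs _ _ _ (hf A (by simp)) (ih fun B hB => hf B (Multiset.mem_cons_of_mem hB))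

lemma bd_of_weights [Fintype Z] {d : ℕ} {β : ℝ} (hβ : 0 ≤ β)
    (H : ∀ S : Finset Z, Struct d S → ∃ ω : Z → ℝ, (∀ z, 0 ≤ ω z) ∧
      ∀ A, At A → Over S A → 1 ≤ omg ω A ∧ omg ω A ≤ β) : Bd Z d β := by
  by_contra hc
  unfold Bd at hc
  push Not at hc
  choose B hB hm a b ha hb hlt using fun n : ℕ => hc (n : ℝ)
  obtain ⟨φ, hφ⟩ := (wellQuasiOrdered_le (α := Z → ℕ)).exists_monotone_subseq
    (fun n h => (B n).count h)
  let S : Finset Z := Finset.univ.filter fun h => ∀ K, ∃ m, K ≤ (B (φ m)).count h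
  have hS : Struct d S := by
    intro f f' hf hf' he ho
    have h1 : ∀ h : Z, ∃ m, f.sum.count h ≤ (B (φ m)).count h := by
      intro h
      by_cases hh : h ∈ S
      · exact (Finset.mem_filter.1 hh).2 _
      · refine ⟨0, ?_⟩
        rw [Multiset.count_eq_zero_of_notMem fun hx => hh (ho h hx)]; omega
    choose m hmm using h1
    obtain ⟨M, hM⟩ := (Set.finite_range m).bddAbove
    have hle : f.sum ≤ B (φ M) := by
      rw [Multiset.le_iff_count]
      intro h
      exact (hmm h).trans (hφ _ _ (hM ⟨h, rfl⟩) h)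
    obtain ⟨g, hg, hgs⟩ := exists_fac (B (φ M) - f.sum) (by rw [sub_sum hle, hB, hf.sum_zero, sub_zero])
    have := hm (φ M) (f.card + g.card) (f'.card + g.card)
      ⟨f + g, hf.add hg, by rw [Multiset.sum_add, hgs, add_tsub_cancel_of_le hle], by simp⟩
      ⟨f' + g, hf'.add hg, by rw [Multiset.sum_add, hgs, ← he, add_tsub_cancel_of_le hle], by simp⟩
    exact Nat.ModEq.add_right_cancel' _ this
  obtain ⟨ω, hω0, hω⟩ := H S hS
  let ωS : Z → ℝ := fun z => if z ∈ S then ω z else 0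
  let bad : Z → ℝ := fun z => if z ∈ S then 0 else 1
  have hωS0 : ∀ z, 0 ≤ ωS z := by intro z; simp only [ωS]; split_ifs; exacts [hω0 z, le_rfl]
  have hbad0 : ∀ z, 0 ≤ bad z := by intro z; simp only [bad]; split_ifs <;> norm_num
  obtain ⟨K, hK⟩ : ∃ K : ℝ, ∀ m, omg bad (B (φ m)) ≤ K := by
    have : ∀ h : Z, ∃ K : ℝ, ∀ m, ((B (φ m)).count h : ℝ) * bad h ≤ K := by
      intro h
      by_cases hh : h ∈ S
      · exact ⟨0, fun m => by simp [bad, hh]⟩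
      · have : ¬ ∀ K, ∃ m, K ≤ (B (φ m)).count h := fun hx => hh (Finset.mem_filter.2 ⟨Finset.mem_univ _, hx⟩)
        push Not at this
        obtain ⟨K, hK⟩ := this
        exact ⟨K, fun m => by simp only [bad, hh, if_false, mul_one]; exact_mod_cast (hK m).le⟩
    choose K hK using this
    exact ⟨∑ h, K h, fun m => by rw [omg_count]; exact Finset.sum_le_sum fun h _ => hK h m⟩
  obtain ⟨W, hW⟩ : ∃ W : ℝ, ∀ A, At A → omg ωS A ≤ W := by
    obtain ⟨W, hW⟩ := (at_finite (Z := Z)).image (omg ωS) |>.bddAbove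
    exact ⟨W, fun A hA => hW ⟨A, hA, rfl⟩⟩
  have hW0 : 0 ≤ W := (omg_nonneg hωS0 _).trans (hW _ at_zero)
  have hover : ∀ A, Over S A → omg ωS A = omg ω A := by
    intro A hA
    unfold omg
    congr 1
    exact Multiset.map_congr rfl fun x hx => by simp [ωS, hA x hx]
  have hnot : ∀ A, ¬ Over S A → 1 ≤ omg bad A := by
    intro A hA
    unfold Over at hA
    push Not at hA
    obtain ⟨h, hh, hS⟩ := hA
    obtain ⟨A', rfl⟩ := Multiset.exists_cons_of_mem hh
    have : omg bad (h ::ₘ A') = bad h + omg bad A' := by simp [omg]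
    rw [this]
    have := omg_nonneg hbad0 A'
    simp only [bad, hS, if_false]
    linarith
  have e1 : ∀ f, Fac f → (f.card : ℝ) ≤ omg ωS f.sum + omg bad f.sum := by
    intro f hf
    refine fac_ind (P := fun B k => (k : ℝ) ≤ omg ωS B + omg bad B) (by simp [omg]) ?_ hf
    intro A B k hA hk
    rw [omg_add, omg_add]
    push_cast
    have : 1 ≤ omg ωS A + omg bad A := by
      by_cases ho : Over S A
      · have := (hω A hA ho).1
        rw [hover A ho]
        linarith [omg_nonneg hbad0 A]
      · linarith [hnot A ho, omg_nonneg hωS0 A]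
    linarith
  have e2 : ∀ f, Fac f → omg ωS f.sum ≤ β * f.card + W * omg bad f.sum := by
    intro f hf
    refine fac_ind (P := fun B k => omg ωS B ≤ β * k + W * omg bad B) (by simp [omg]) ?_ hf
    intro A B k hA hk
    rw [omg_add, omg_add]
    push_cast
    have : omg ωS A ≤ β + W * omg bad A := by
      by_cases ho : Over S A
      · have := (hω A hA ho).2
        rw [hover A ho]
        have := mul_nonneg hW0 (omg_nonneg hbad0 A)
        linarith
      · have h1 := mul_le_mul_of_nonneg_left (hnot A ho) hW0
        linarith [hW A hA]
    linarith
  obtain ⟨n, hn⟩ := exists_nat_gt (W * K + K)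
  obtain ⟨f, hf, hfs, hfc⟩ := ha (φ n)
  obtain ⟨f', hf', hfs', hfc'⟩ := hb (φ n)
  have h1 := e1 f' hf'
  have h2 := e2 f hf
  have h3 := hlt (φ n)
  rw [hfs', hfc'] at h1
  rw [hfs, hfc] at h2
  have h4 := hK n
  have h5 : (n : ℝ) ≤ (φ n : ℝ) := by exact_mod_cast φ.strictMono.le_apply
  have h6 := mul_le_mul_of_nonneg_left h4 hW0
  linarith

lemma struct_of {d : ℕ} {S : Finset Z} (F : Z → ℤ) {c : ℤ} (hc : c ≠ 0)
    (h : ∀ A, At A → Over S A → ∃ t : ℤ, (A.map F).sum = c + d * c * t) : Struct d S := by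
  have key : ∀ f, Fac f → Over S f.sum → ∃ t : ℤ, (f.sum.map F).sum = c * f.card + d * c * t := by
    intro f hf ho
    induction f using Multiset.induction with
    | empty => exact ⟨0, by simp⟩
    | cons A f ih =>
      rw [over_sum] at ho
      obtain ⟨t, ht⟩ := ih (fun B hB => hf B (Multiset.mem_cons_of_mem hB))
        (over_sum.2 fun B hB => ho B (Multiset.mem_cons_of_mem hB))
      obtain ⟨t', ht'⟩ := h A (hf A (by simp)) (ho A (by simp))
      refine ⟨t + t', ?_⟩
      rw [Multiset.sum_cons, Multiset.map_add, Multiset.sum_add, ht, ht', Multiset.card_cons]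
      push_cast; ring
  intro f f' hf hf' he ho
  obtain ⟨t, ht⟩ := key f hf ho
  obtain ⟨t', ht'⟩ := key f' hf' (he ▸ ho)
  rw [he, ht'] at ht
  have : (f'.card : ℤ) - f.card = d * (t - t') := by
    apply mul_left_cancel₀ hc
    linarith
  exact (Nat.modEq_iff_dvd).2 ⟨_, this⟩

end BdSec

section Cm
variable {Z : Type*} [AddCommGroup Z] {ι : Type*} [Fintype ι]

noncomputable def cm (e : ι → Z) (c : ι → ℕ) : Multiset Z := ∑ i, c i • ({e i} : Multiset Z)

lemma cm_sum (e : ι → Z) (c : ι → ℕ) : (cm e c).sum = ∑ i, c i • e i := by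
  unfold cm
  have : ∀ s : Finset ι, (∑ i ∈ s, c i • ({e i} : Multiset Z)).sum = ∑ i ∈ s, c i • e i := by
    intro s
    induction s using Finset.induction with
    | empty => simp
    | insert a s ha ih => rw [Finset.sum_insert ha, Finset.sum_insert ha, Multiset.sum_add, ih]; simp [Multiset.sum_nsmul, Multiset.map_nsmul]
  exact this _

lemma cm_count {e : ι → Z} (he : Function.Injective e) (c : ι → ℕ) (j : ι) :
    (cm e c).count (e j) = c j := by
  unfold cm
  rw [Multiset.count_sum']
  simp [Multiset.count_singleton, he.eq_iff]

lemma cm_over (e : ι → Z) (c : ι → ℕ) : Over (Finset.univ.image e) (cm e c) := by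
  intro x hx
  unfold cm at hx
  rw [Multiset.mem_sum] at hx
  obtain ⟨i, _, hi⟩ := hx
  have := Multiset.mem_singleton.1 (Multiset.mem_of_mem_nsmul hi)
  rw [this]; simp

lemma cm_rep {e : ι → Z} (he : Function.Injective e) {A : Multiset Z}
    (ho : Over (Finset.univ.image e) A) : A = cm e (fun i => A.count (e i)) := by
  ext x
  by_cases hx : x ∈ Finset.univ.image e
  · obtain ⟨i, _, rfl⟩ := Finset.mem_image.1 hx
    rw [cm_count he]
  · rw [Multiset.count_eq_zero_of_notMem fun h => hx (ho _ h),
      Multiset.count_eq_zero_of_notMem fun h => hx (cm_over _ _ _ h)]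

lemma cm_zero (e : ι → Z) : cm e (fun _ => 0) = 0 := by simp [cm]

lemma cm_le {e : ι → Z} (he : Function.Injective e) {T : Multiset Z} {c : ι → ℕ}
    (h : T ≤ cm e c) : ∃ c', T = cm e c' ∧ ∀ i, c' i ≤ c i := by
  refine ⟨_, cm_rep he ((cm_over e c).le h), fun i => ?_⟩
  rw [← cm_count he c i]
  exact Multiset.count_le_of_le _ h

lemma cm_map (e : ι → Z) (c : ι → ℕ) (F : Z → ℤ) : ((cm e c).map F).sum = ∑ i, (c i : ℤ) * F (e i) := by
  unfold cm
  have : ∀ s : Finset ι, ((∑ i ∈ s, c i • ({e i} : Multiset Z)).map F).sum = ∑ i ∈ s, (c i : ℤ) * F (e i) := by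
    intro s
    induction s using Finset.induction with
    | empty => simp
    | insert a s ha ih =>
      rw [Finset.sum_insert ha, Finset.sum_insert ha, Multiset.map_add, Multiset.sum_add, ih]; simp [Multiset.sum_nsmul, Multiset.map_nsmul]
  exact this _

lemma cm_omg (e : ι → Z) (c : ι → ℕ) (F : Z → ℝ) : omg F (cm e c) = ∑ i, (c i : ℝ) * F (e i) := by
  unfold cm omg
  have : ∀ s : Finset ι, ((∑ i ∈ s, c i • ({e i} : Multiset Z)).map F).sum = ∑ i ∈ s, (c i : ℝ) * F (e i) := by
    intro s
    induction s using Finset.induction with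
    | empty => simp
    | insert a s ha ih =>
      rw [Finset.sum_insert ha, Finset.sum_insert ha, Multiset.map_add, Multiset.sum_add, ih]; simp [Multiset.sum_nsmul, Multiset.map_nsmul]
  exact this _

/-- criterion for a combination to be an atom -/
lemma cm_at {e : ι → Z} (he : Function.Injective e) {c : ι → ℕ} (h0 : c ≠ 0)
    (hs : ∑ i, c i • e i = 0)
    (h : ∀ c' : ι → ℕ, (∀ i, c' i ≤ c i) → ∑ i, c' i • e i = 0 → (∀ i, c' i = 0) ∨ ∀ i, c' i = c i) :
    At (cm e c) := by
  refine ⟨fun hc => h0 ?_, by rw [cm_sum, hs], fun T hT hTs => ?_⟩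
  · ext i; rw [← cm_count he c i, hc]; simp
  · obtain ⟨c', rfl, hle⟩ := cm_le he hT
    rw [cm_sum] at hTs
    rcases h c' hle hTs with h | h
    · left; rw [show c' = fun _ => 0 from funext h, cm_zero]
    · right; rw [show c' = c from funext h]

/-- consequences of being an atom -/
lemma cm_at_eq {e : ι → Z} (he : Function.Injective e) {c c' : ι → ℕ} (hA : At (cm e c))
    (hle : ∀ i, c' i ≤ c i) (hs : ∑ i, c' i • e i = 0) (h0 : c' ≠ 0) : c' = c := by
  have h1 : cm e c' ≤ cm e c := Finset.sum_le_sum fun i _ => nsmul_le_nsmul_left (Multiset.zero_le _) (hle i)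
  have := hA.eq_of_le h1 (by rw [cm_sum, hs]) (fun hc => h0 (by
    ext i; rw [← cm_count he c' i, hc]; simp))
  ext i
  rw [← cm_count he c' i, this, cm_count he]

lemma struct_cm {e : ι → Z} (he : Function.Injective e) {d : ℕ} (F : ι → ℤ) {c0 : ℤ} (hc : c0 ≠ 0)
    (h : ∀ c, At (cm e c) → ∃ t : ℤ, ∑ i, (c i : ℤ) * F i = c0 + d * c0 * t) :
    Struct d (Finset.univ.image e) := by
  apply struct_of (Function.extend e F 0) hc
  intro A hA ho
  rw [cm_rep he ho] at hA ⊢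
  obtain ⟨t, ht⟩ := h _ hA
  refine ⟨t, ?_⟩
  rw [cm_map, ← ht]
  simp [he.extend_apply]

end Cm
end ZS

open scoped Classical
set_option linter.unusedSectionVars false

namespace ZS

section Ex
variable {Z : Type*} [AddCommGroup Z]

lemma Bd.pair {g : Z} {N : ℕ} (hN : 3 ≤ N) (hg : addOrderOf g = N) {β : ℝ} (hb : Bd Z (N - 2) β) :
    (N : ℝ) ≤ β * 2 := by
  have hgm : addOrderOf (-g) = N := by rw [addOrderOf_neg, hg]
  have hgne : g ≠ -g := by
    intro h
    have : 2 • g = 0 := by rw [two_nsmul]; nth_rw 2 [h]; simp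
    have := addOrderOf_dvd_of_nsmul_eq_zero this
    rw [hg] at this
    have := Nat.le_of_dvd (by norm_num) this
    omega
  have hg0 : g ≠ 0 := by rintro rfl; simp at hg; omega
  let e : Bool → Z := fun b => if b then g else -g
  have he : Function.Injective e := by
    intro a b h
    cases a <;> cases b <;> simp [e] at h ⊢
    · exact hgne h.symm
    · exact hgne h
  have hp := at_pow (h := g) (by omega)
  have hm := at_pow (h := -g) (by omega)
  rw [hg] at hp; rw [hgm] at hm
  have hS : Struct (N - 2) (Finset.univ.image e) := by
    refine struct_cm he (fun b => if b then 1 else (N : ℤ) - 1) (c0 := N) (by omega) ?_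
    intro c hA
    have hNN : ((N - 2 : ℕ) : ℤ) = N - 2 := by omega
    simp only [Fintype.sum_bool, if_true, hNN]
    by_cases h1 : 1 ≤ c true ∧ 1 ≤ c false
    · have := cm_at_eq he hA (c' := fun _ => 1) (by intro i; cases i; exacts [h1.2, h1.1])
        (by simp [e]) (by intro h; simpa using congrFun h true)
      exact ⟨0, by rw [← this]; simp⟩
    · have hs := hA.2.1
      rw [cm_sum] at hs
      simp only [Fintype.sum_bool, e, if_true, Bool.false_eq_true, if_false] at hs
      by_cases h2 : c true = 0
      · rw [h2, zero_smul, zero_add] at hs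
        have h3 := addOrderOf_dvd_of_nsmul_eq_zero hs
        rw [hgm] at h3
        have h4 : c false ≠ 0 := by
          intro h4; apply hA.1
          rw [show c = fun _ => 0 by ext i; cases i <;> simp [h2, h4], cm_zero]
        have := cm_at_eq he hA (c' := fun b => if b then 0 else N) (by
          intro i; cases i
          · simpa using Nat.le_of_dvd (by omega) h3
          · simp) (by simp [e, ← hg]) (by intro h; have := congrFun h false; simp at this; omega)
        exact ⟨1, by rw [← this]; simp; ring⟩
      · have h4 : c false = 0 := by omega
        rw [h4, zero_smul, add_zero] at hs
        have h3 := addOrderOf_dvd_of_nsmul_eq_zero hs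
        rw [hg] at h3
        have := cm_at_eq he hA (c' := fun b => if b then N else 0) (by
          intro i; cases i
          · simp
          · simpa using Nat.le_of_dvd (by omega) h3) (by simp [e, ← hg])
          (by intro h; have := congrFun h true; simp at this; omega)
        exact ⟨0, by rw [← this]; simp⟩
  have hin : g ∈ Finset.univ.image e := Finset.mem_image.2 ⟨true, by simp, by simp [e]⟩
  have hin' : -g ∈ Finset.univ.image e := Finset.mem_image.2 ⟨false, by simp, by simp [e]⟩
  have := hb.lower hS (f := {N • {g}} + {N • {-g}}) (f' := N • {({g, -g} : Multiset Z)})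
    ((Fac.single hp).add (Fac.single hm)) ((Fac.single (at_pair hg0)).nsmul _) (by
      rw [Multiset.sum_nsmul, Multiset.sum_add, Multiset.sum_singleton, Multiset.sum_singleton,
        Multiset.sum_singleton, Multiset.insert_eq_cons, ← Multiset.singleton_add, nsmul_add]) (by
      rw [Multiset.sum_add, Multiset.sum_singleton, Multiset.sum_singleton]
      refine Over.add (Over.nsmul ?_ _) (Over.nsmul ?_ _)
      · intro x hx; rw [Multiset.mem_singleton.1 hx]; exact hin
      · intro x hx; rw [Multiset.mem_singleton.1 hx]; exact hin')
  simpa [one_add_one_eq_two] using this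

variable {κ : Type*} [Fintype κ]

structure Ind (m : ℕ) (e : κ → Z) : Prop where
  tor : ∀ i, m • e i = 0
  ind : ∀ c : κ → ℕ, ∑ i, c i • e i = 0 → ∀ i, m ∣ c i

def std (e : κ → Z) : Option κ → Z := fun o => o.elim (∑ i, e i) e

lemma std_sum (e : κ → Z) (c : Option κ → ℕ) :
    ∑ o, c o • std e o = ∑ i, (c none + c (some i)) • e i := by
  rw [Fintype.sum_option]
  simp [std, Finset.smul_sum, add_smul, Finset.sum_add_distrib]

lemma Ind.sum_zero {m : ℕ} {e : κ → Z} (h : Ind m e) {c : κ → ℕ} (hc : ∀ i, m ∣ c i) :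
    ∑ i, c i • e i = 0 := by
  refine Finset.sum_eq_zero fun i _ => ?_
  obtain ⟨k, hk⟩ := hc i
  rw [hk, mul_comm, mul_smul, h.tor, smul_zero]

lemma Ind.inj {m : ℕ} {e : κ → Z} (h : Ind m e) (hm : 2 ≤ m) : Function.Injective e := by
  intro i j hij
  by_contra hne
  have := h.ind (fun k => (if k = i then 1 else 0) + if k = j then m - 1 else 0) (by
    simp only [add_smul, ite_smul, zero_smul, Finset.sum_add_distrib, Finset.sum_ite_eq',
      Finset.mem_univ, if_true]
    rw [hij, ← add_smul, show 1 + (m - 1) = m by omega, h.tor]) i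
  simp [hne] at this
  omega

lemma Ind.std_inj {m : ℕ} {e : κ → Z} (h : Ind m e) (hm : 2 ≤ m) (hR : 2 ≤ Fintype.card κ) :
    Function.Injective (std e) := by
  have aux : ∀ j, ∑ i, e i ≠ e j := by
    intro j hj
    obtain ⟨i, hi⟩ : ∃ i, i ≠ j := by
      by_contra hc; push Not at hc
      have := Fintype.card_le_one_iff_subsingleton.2 ⟨fun a b => (hc a).trans (hc b).symm⟩
      omega
    have := h.ind (fun k => 1 + if k = j then m - 1 else 0) (by
      simp only [add_smul, one_smul, ite_smul, zero_smul, Finset.sum_add_distrib,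
        Finset.sum_ite_eq', Finset.mem_univ, if_true]
      rw [hj]; nth_rw 1 [← one_smul ℕ (e j)]
      rw [← add_smul, show 1 + (m - 1) = m by omega, h.tor]) i
    simp [hi] at this; omega
  intro a b hab
  cases a <;> cases b
  · rfl
  · exact absurd hab (aux _)
  · exact absurd hab.symm (aux _)
  · exact congrArg _ (h.inj hm hab)

lemma Ind.std_atom {m : ℕ} {e : κ → Z} (h : Ind m e) (hm : 2 ≤ m) (hR : 2 ≤ Fintype.card κ)
    {c : Option κ → ℕ} (hA : At (cm (std e) c)) :
    (1 ≤ c none ∧ ∀ i, c none + c (some i) = m) ∨ ∃ j, c = fun o => if o = some j then m else 0 := by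
  have hinj := h.std_inj hm hR
  have hs := hA.2.1
  rw [cm_sum, std_sum] at hs
  have hd := h.ind _ hs
  by_cases h1 : m ≤ c none
  · left
    have := cm_at_eq hinj hA (c' := fun o => if o = none then m else 0) (by
      intro o; cases o <;> simp [h1]) (by rw [std_sum]; exact h.sum_zero (by simp))
      (by intro hh; have := congrFun hh none; simp at this; omega)
    refine ⟨by omega, fun i => ?_⟩; rw [← this]; simp
  by_cases h2 : ∃ j, m ≤ c (some j)
  · right
    obtain ⟨j, hj⟩ := h2
    refine ⟨j, (cm_at_eq hinj hA (c' := fun o => if o = some j then m else 0) (by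
      intro o; split_ifs with ho
      · rw [ho]; exact hj
      · omega) (by rw [std_sum]; refine h.sum_zero (fun i => ?_); simp only [reduceCtorEq, if_false]
                   split_ifs <;> simp) 
      (by intro hh; have := congrFun hh (some j); simp at this; omega)).symm⟩
  · left
    push Not at h2
    have hn : 1 ≤ c none := by
      by_contra hn
      apply hA.1
      have : c = fun _ => 0 := by
        ext o; cases o
        · omega
        · rename_i i
          have h3 := hd i
          have h4 := h2 i
          rw [show c none = 0 by omega, zero_add] at h3
          exact Nat.eq_zero_of_dvd_of_lt h3 h4
      rw [this, cm_zero]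
    refine ⟨hn, fun i => ?_⟩
    obtain ⟨k, hk⟩ := hd i
    have h3 := h2 i
    have : k = 1 := by
      rcases k with _ | _ | k
      · omega
      · rfl
      · exfalso; have : m * (k + 1 + 1) = m * k + 2 * m := by ring
        nlinarith [Nat.zero_le (m * k)]
    rw [hk, this, mul_one]

lemma Ind.std_F {m : ℕ} {e : κ → Z} (h : Ind m e) (hm : 2 ≤ m) (hR : 2 ≤ Fintype.card κ)
    {c : Option κ → ℕ} (hA : At (cm (std e) c)) :
    ∃ t : ℤ, (c none : ℤ) * Fintype.card κ + ∑ i, (c (some i) : ℤ) = m + (Fintype.card κ - 1 : ℕ) * m * t := by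
  have e0 : (c none : ℤ) * Fintype.card κ + ∑ i, (c (some i) : ℤ) = ∑ i, ((c none : ℤ) + c (some i)) := by
    rw [Finset.sum_add_distrib]; simp; ring
  rcases h.std_atom hm hR hA with ⟨-, h1⟩ | ⟨j, rfl⟩
  · refine ⟨1, ?_⟩
    rw [e0]
    have : ∀ i, ((c none : ℤ) + c (some i)) = m := fun i => by exact_mod_cast h1 i
    simp only [this]
    rw [Nat.cast_sub (by omega)]
    simp; ring
  · refine ⟨0, ?_⟩
    simp

lemma Ind.std_struct {m : ℕ} {e : κ → Z} (h : Ind m e) (hm : 2 ≤ m) (hR : 2 ≤ Fintype.card κ) :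
    Struct (Fintype.card κ - 1) (Finset.univ.image (std e)) := by
  refine struct_cm (h.std_inj hm hR) (fun o => o.elim (Fintype.card κ : ℤ) (fun _ => 1)) (c0 := m)
    (by omega) ?_
  intro c hA
  obtain ⟨t, ht⟩ := h.std_F hm hR hA
  refine ⟨t, ?_⟩
  rw [← ht, Fintype.sum_option]
  simp

lemma Ind.std_V {m : ℕ} {e : κ → Z} (h : Ind m e) (hm : 2 ≤ m) (hR : 2 ≤ Fintype.card κ) :
    At (cm (std e) (fun o => if o = none then 1 else m - 1)) := by
  refine cm_at (h.std_inj hm hR) (fun hc => by simpa using congrFun hc none) ?_ ?_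
  · rw [std_sum]
    refine h.sum_zero fun i => ?_
    simp only [if_true, reduceCtorEq, if_false]
    rw [show 1 + (m - 1) = m by omega]
  · intro c' hle hs
    rw [std_sum] at hs
    have hd := h.ind _ hs
    have h0 := hle none
    simp only [if_true] at h0
    have h1 : ∀ i, c' (some i) ≤ m - 1 := fun i => by simpa using hle (some i)
    by_cases hn : c' none = 0
    · left
      intro o; cases o
      · exact hn
      · rename_i i
        have h3 := hd i; have := h1 i
        rw [hn, zero_add] at h3
        exact Nat.eq_zero_of_dvd_of_lt h3 (by omega)
    · right
      have hn1 : c' none = 1 := by omega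
      intro o; cases o
      · simp [hn1]
      · rename_i i
        have h3 := hd i; have := h1 i
        rw [hn1] at h3
        have := Nat.le_of_dvd (by omega) h3
        simp; omega

lemma at_pow' {x : Z} {m : ℕ} (hm : 1 ≤ m) (h : addOrderOf x = m) : At (m • ({x} : Multiset Z)) := by
  rw [← h]; exact at_pow (by omega)

lemma Ind.ord {m : ℕ} {e : κ → Z} (h : Ind m e) (i : κ) : addOrderOf (e i) = m := by
  apply Nat.dvd_antisymm (addOrderOf_dvd_of_nsmul_eq_zero (h.tor i))
  have := h.ind (fun k => if k = i then addOrderOf (e i) else 0) (by simp) i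
  simpa using this

lemma Ind.ord_sum {m : ℕ} {e : κ → Z} [Nonempty κ] (h : Ind m e) : addOrderOf (∑ i, e i) = m := by
  apply Nat.dvd_antisymm (addOrderOf_dvd_of_nsmul_eq_zero (by
    rw [Finset.smul_sum]; simp [h.tor]))
  have := h.ind (fun k => addOrderOf (∑ i, e i)) (by rw [← Finset.smul_sum, addOrderOf_nsmul_eq_zero])
    (Classical.arbitrary κ)
  simpa using this

lemma Bd.std [Fintype Z] {m : ℕ} {e : κ → Z} (h : Ind m e) (hm : 2 ≤ m) (hR : 2 ≤ Fintype.card κ) {β : ℝ}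
    (hb : Bd Z (Fintype.card κ - 1) β) : 1 + (Fintype.card κ : ℝ) * ((m : ℝ) - 1) ≤ β * m := by
  have : Nonempty κ := Fintype.card_pos_iff.1 (by omega)
  have hV := h.std_V hm hR
  have hg := at_pow' (by omega) h.ord_sum
  have hee := fun i => at_pow' (by omega) (h.ord i)
  have := hb.lower (h.std_struct hm hR) (f := m • {cm (ZS.std e) (fun o => if o = none then 1 else m - 1)})
    (f' := {m • {∑ i, e i}} + ∑ i, (m - 1) • {m • {e i}}) ((Fac.single hV).nsmul _) (by
      refine (Fac.single hg).add ?_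
      intro A hA
      rw [Multiset.mem_sum] at hA
      obtain ⟨i, _, hi⟩ := hA
      rw [Multiset.mem_singleton.1 (Multiset.mem_of_mem_nsmul hi)]
      exact hee i) (by
      rw [Multiset.sum_add, msum_finset, Multiset.sum_nsmul, Multiset.sum_singleton,
        Multiset.sum_singleton, cm, Fintype.sum_option, nsmul_add, Finset.smul_sum]
      simp only [Multiset.sum_nsmul, Multiset.sum_singleton, if_true, reduceCtorEq, if_false, one_smul]
      congr 1
      exact Finset.sum_congr rfl fun i _ => by rw [smul_comm]; rfl) (by
      rw [Multiset.sum_nsmul, Multiset.sum_singleton]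
      exact (cm_over _ _).nsmul _)
  rw [Multiset.card_add, mcard_finset] at this
  simp only [Multiset.card_nsmul, Multiset.card_singleton, mul_one, Finset.sum_const, Finset.card_univ,
    smul_eq_mul] at this
  push_cast at this
  rw [Nat.cast_sub (by omega)] at this
  simpa using this


def std3 (e : κ → Z) : Option (Option κ) → Z := fun o => o.elim (-∑ i, e i) (std e)

lemma std3_sum {m : ℕ} {e : κ → Z} (h : Ind m e) (hm : 1 ≤ m) (c : Option (Option κ) → ℕ) :
    ∑ o, c o • std3 e o =
      ∑ i, ((m - 1) * c none + c (some none) + c (some (some i))) • e i := by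
  have h1 : -∑ i, e i = ∑ i, (m - 1) • e i := by
    rw [neg_eq_iff_add_eq_zero, ← Finset.sum_add_distrib]
    refine Finset.sum_eq_zero fun i _ => ?_
    rw [← succ_nsmul', show m - 1 + 1 = m by omega, h.tor]
  rw [Fintype.sum_option]
  simp only [std3, Option.elim_none, Option.elim_some]
  rw [std_sum e (fun o => c (some o)), h1, Finset.smul_sum, ← Finset.sum_add_distrib]
  refine Finset.sum_congr rfl fun i _ => ?_
  rw [← mul_smul, ← add_smul]
  congr 1; ring

lemma Ind.std3_inj {m : ℕ} {e : κ → Z} (h : Ind m e) (hm : 3 ≤ m) (hR : 2 ≤ Fintype.card κ) :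
    Function.Injective (std3 e) := by
  have h2 := h.std_inj (by omega) hR
  have : Nonempty κ := Fintype.card_pos_iff.1 (by omega)
  have aux : ∀ o, -∑ i, e i ≠ std e o := by
    intro o ho
    have ho2 : (∑ i, e i) + std e o = 0 := by rw [← ho]; simp
    cases o
    · simp only [std, Option.elim_none] at ho2
      rw [← two_nsmul] at ho2
      have := addOrderOf_dvd_of_nsmul_eq_zero ho2
      rw [h.ord_sum] at this
      have := Nat.le_of_dvd (by norm_num) this
      omega
    · rename_i j
      obtain ⟨i, hi⟩ : ∃ i, i ≠ j := by
        by_contra hc; push Not at hc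
        have := Fintype.card_le_one_iff_subsingleton.2 ⟨fun a b => (hc a).trans (hc b).symm⟩
        omega
      have := h.ind (fun k => 1 + if k = j then 1 else 0) (by
        simp only [add_smul, one_smul, ite_smul, zero_smul, Finset.sum_add_distrib,
          Finset.sum_ite_eq', Finset.mem_univ, if_true]
        exact ho2) i
      simp [hi] at this; omega
  intro a b hab
  cases a <;> cases b
  · rfl
  · exact absurd hab (aux _)
  · exact absurd hab.symm (aux _)
  · exact congrArg _ (h2 hab)

lemma cm_std3 (e : κ → Z) (c : Option (Option κ) → ℕ) :
    cm (std3 e) c = c none • {-∑ i, e i} + cm (std e) (fun o => c (some o)) := by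
  rw [cm, Fintype.sum_option]; rfl

/-- atoms over the extended standard set -/
lemma Ind.std3_atom {m : ℕ} {e : κ → Z} (h : Ind m e) (hm : 3 ≤ m) (hR : 2 ≤ Fintype.card κ)
    {c : Option (Option κ) → ℕ} (hA : At (cm (std3 e) c)) :
    (c none = 0 ∧ At (cm (std e) (fun o => c (some o)))) ∨
    (c none = m ∧ ∀ o, c (some o) = 0) ∨
    (c none = 1 ∧ c (some none) = 1 ∧ ∀ i, c (some (some i)) = 0) ∨
    (c none = 1 ∧ c (some none) = 0 ∧ ∀ i, c (some (some i)) = 1) := by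
  have hinj := h.std3_inj hm hR
  have hsum := std3_sum h (by omega)
  have hs := hA.2.1
  rw [cm_sum, hsum] at hs
  have hd := h.ind _ hs
  by_cases h0 : c none = 0
  · left
    refine ⟨h0, ?_⟩
    rw [cm_std3, h0, zero_smul, zero_add] at hA
    exact hA
  right
  by_cases h1 : 1 ≤ c (some none)
  · right; left
    have := cm_at_eq hinj hA (c' := fun o => o.elim 1 (fun o => o.elim 1 (fun _ => 0))) (by
      rintro (_ | _ | i) <;> simp <;> omega) (by
      rw [hsum]; refine h.sum_zero fun i => ?_
      simp [show m - 1 + 1 = m by omega]) (by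
      intro hh; simpa using congrFun hh none)
    rw [← this]; simp
  by_cases h2 : ∀ i, 1 ≤ c (some (some i))
  · right; right
    have := cm_at_eq hinj hA (c' := fun o => o.elim 1 (fun o => o.elim 0 (fun _ => 1))) (by
      rintro (_ | _ | i)
      · simp; omega
      · simp
      · simpa using h2 i) (by
      rw [hsum]; refine h.sum_zero fun i => ?_
      simp [show m - 1 + 1 = m by omega]) (by
      intro hh; simpa using congrFun hh none)
    rw [← this]; simp
  · left
    push Not at h2
    obtain ⟨j, hj⟩ := h2
    have h3 := hd j
    rw [show c (some none) = 0 by omega, show c (some (some j)) = 0 by omega, add_zero, add_zero] at h3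
    have h4 : m ∣ c none := by
      have hcop : m.Coprime (m - 1) := by
        rw [Nat.coprime_self_sub_right (by omega)]; exact Nat.coprime_one_right m
      exact hcop.dvd_of_dvd_mul_left h3
    have h5 := Nat.le_of_dvd (by omega) h4
    have := cm_at_eq hinj hA (c' := fun o => o.elim m (fun _ => 0)) (by
      rintro (_ | o) <;> simp [h5]) (by
      rw [hsum]; refine h.sum_zero fun i => ?_
      simp) (by
      intro hh; have := congrFun hh none; simp at this; omega)
    rw [← this]; simp

lemma Ind.std3_struct {N : ℕ} {e : κ → Z} (h : Ind N e) (hN : 3 ≤ N) (hR : Fintype.card κ + 1 = N) :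
    Struct (N - 2) (Finset.univ.image (std3 e)) := by
  refine struct_cm (h.std3_inj hN (by omega))
    (fun o => o.elim 1 (fun o => o.elim ((N : ℤ) - 1) (fun _ => 1))) (c0 := N) (by omega) ?_
  intro c hA
  simp only [Fintype.sum_option, Option.elim_none, Option.elim_some, mul_one]
  have hk : ((Fintype.card κ : ℕ) : ℤ) = N - 1 := by omega
  rcases h.std3_atom hN (by omega) hA with ⟨h0, hA'⟩ | ⟨h0, h1⟩ | ⟨h0, h1, h2⟩ | ⟨h0, h1, h2⟩
  · obtain ⟨t, ht⟩ := h.std_F (by omega) (by omega) hA'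
    refine ⟨t, ?_⟩
    rw [h0, hk] at *
    rw [show Fintype.card κ - 1 = N - 2 by omega] at ht
    rw [← ht]; simp
  · exact ⟨0, by simp [h0, h1]⟩
  · exact ⟨0, by simp [h0, h1, h2]⟩
  · exact ⟨0, by simp [h0, h1, h2, hk]⟩

lemma Bd.third [Fintype Z] {N : ℕ} {e : κ → Z} (h : Ind N e) (hN : 3 ≤ N)
    (hR : Fintype.card κ + 1 = N) {β : ℝ} (hb : Bd Z (N - 2) β) :
    (N : ℝ) ^ 2 - N + 1 ≤ β * (N + 1) := by
  have : Nonempty κ := Fintype.card_pos_iff.1 (by omega)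
  have hV := h.std_V (by omega) (by omega)
  have hg0 : ∑ i, e i ≠ 0 := by
    intro h0; have := h.ord_sum; rw [h0] at this; simp at this; omega
  have hg := at_pow' (m := N) (by omega) (x := -∑ i, e i) (by rw [addOrderOf_neg, h.ord_sum])
  have hee := fun i => at_pow' (by omega) (h.ord i)
  have hsub : Finset.univ.image (ZS.std e) ⊆ Finset.univ.image (std3 e) := by
    intro x hx
    obtain ⟨o, _, rfl⟩ := Finset.mem_image.1 hx
    exact Finset.mem_image.2 ⟨some o, by simp, rfl⟩
  have := hb.lower (h.std3_struct hN hR)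
    (f := N • {cm (ZS.std e) (fun o => if o = none then 1 else N - 1)} + {N • {-∑ i, e i}})
    (f' := N • {{∑ i, e i, -∑ i, e i}} + ∑ i, (N - 1) • {N • {e i}})
    (((Fac.single hV).nsmul _).add (Fac.single hg)) (by
      refine ((Fac.single (at_pair hg0)).nsmul _).add ?_
      intro A hA
      rw [Multiset.mem_sum] at hA
      obtain ⟨i, _, hi⟩ := hA
      rw [Multiset.mem_singleton.1 (Multiset.mem_of_mem_nsmul hi)]
      exact hee i) (by
      rw [Multiset.sum_add, Multiset.sum_add, msum_finset, Multiset.sum_nsmul, Multiset.sum_nsmul,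
        Multiset.sum_singleton, Multiset.sum_singleton,
        Multiset.sum_singleton, cm, Fintype.sum_option, nsmul_add, Finset.smul_sum]
      simp only [Multiset.sum_nsmul, Multiset.sum_singleton, if_true, reduceCtorEq, if_false, one_smul]
      rw [Multiset.insert_eq_cons, ← Multiset.singleton_add, nsmul_add, add_assoc, add_assoc]
      congr 1
      rw [add_comm]
      congr 1
      exact Finset.sum_congr rfl fun i _ => by rw [smul_comm]; rfl) (by
      rw [Multiset.sum_add, Multiset.sum_nsmul, Multiset.sum_singleton, Multiset.sum_singleton]
      refine (((cm_over _ _).mono hsub).nsmul _).add (Over.nsmul ?_ _)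
      intro x hx
      rw [Multiset.mem_singleton.1 hx]
      exact Finset.mem_image.2 ⟨none, by simp, rfl⟩)
  rw [Multiset.card_add, Multiset.card_add, mcard_finset] at this
  simp only [Multiset.card_nsmul, Multiset.card_singleton, mul_one, Finset.sum_const, Finset.card_univ,
    smul_eq_mul] at this
  rw [show Fintype.card κ = N - 1 by omega] at this
  push_cast at this
  rw [Nat.cast_sub (by omega)] at this
  push_cast at this
  nlinarith

end Ex
end ZS

open scoped Classical
set_option linter.unusedSectionVars false

namespace ZS

section KSec
variable {Z : Type*} [AddCommGroup Z]

lemma deltaG0_iff {S : Set Z} {δ : ℕ} : δ ∈ deltaG0 S ↔ 0 < δ ∧ ∃ B : Multiset Z, (∀ g ∈ B, g ∈ S) ∧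
    B.sum = 0 ∧ ∃ a, Len B a ∧ Len B (a + δ) ∧ ∀ c, Len B c → ¬ (a < c ∧ c < a + δ) := by
  unfold deltaG0 systemL deltaOf
  simp only [Set.mem_iUnion, Set.mem_setOf_eq, exists_prop]
  constructor
  · rintro ⟨L, ⟨B, ⟨hB, hs⟩, rfl⟩, hd, a, h1, h2, h3⟩
    refine ⟨hd, B, hB, hs, a, (mem_lengthSet hB).1 h1, (mem_lengthSet hB).1 h2,
      fun c hc => h3 c ((mem_lengthSet hB).2 hc)⟩
  · rintro ⟨hd, B, hB, hs, a, h1, h2, h3⟩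
    refine ⟨_, ⟨B, ⟨hB, hs⟩, rfl⟩, hd, a, (mem_lengthSet hB).2 h1, (mem_lengthSet hB).2 h2,
      fun c hc => h3 c ((mem_lengthSet hB).1 hc)⟩

lemma delta_le {S : Set Z} {B : Multiset Z} (hB : ∀ g ∈ B, g ∈ S) {k l : ℕ} (hk : Len B k)
    (hl : Len B l) (hlt : k < l) : ∃ δ ∈ deltaG0 S, δ ≤ l - k := by
  have hex : ∃ c, Len B c ∧ k < c := ⟨l, hl, hlt⟩
  have h1 := Nat.find_spec hex
  have h2 : Nat.find hex ≤ l := Nat.find_min' hex ⟨hl, hlt⟩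
  have hs : B.sum = 0 := by obtain ⟨f, hf, rfl, _⟩ := hk; exact hf.sum_zero
  refine ⟨Nat.find hex - k, deltaG0_iff.2 ⟨by omega, B, hB, hs, k, hk, ?_, ?_⟩, by omega⟩
  · rw [show k + (Nat.find hex - k) = Nat.find hex by omega]; exact h1.1
  · rintro c hc ⟨h3, h4⟩
    have := Nat.find_min' hex ⟨hc, h3⟩
    omega

lemma Len.add {B C : Multiset Z} {k l : ℕ} (h : Len B k) (h' : Len C l) : Len (B + C) (k + l) := by
  obtain ⟨f, hf, rfl, rfl⟩ := h
  obtain ⟨g, hg, rfl, rfl⟩ := h'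
  exact ⟨f + g, hf.add hg, by simp, by simp⟩

lemma Len.nsmul {B : Multiset Z} {k : ℕ} (h : Len B k) (q : ℕ) : Len (q • B) (q * k) := by
  obtain ⟨f, hf, rfl, rfl⟩ := h
  exact ⟨q • f, hf.nsmul q, by rw [Multiset.sum_nsmul], by simp⟩

lemma sInf_dvd {S : Set Z} (hne : deltaG0 S ≠ ∅) {B : Multiset Z} (hB : ∀ g ∈ B, g ∈ S) {k l : ℕ}
    (hk : Len B k) (hl : Len B l) (hlt : k < l) : sInf (deltaG0 S) ∣ l - k := by
  have hmem := Nat.sInf_mem (Set.nonempty_iff_ne_empty.2 hne)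
  set δ := sInf (deltaG0 S) with hδ
  obtain ⟨hpos, B0, hB0, hs0, a, ha, ha', -⟩ := deltaG0_iff.1 hmem
  by_contra hnd
  have h1 : (l - k) % δ ≠ 0 := fun h => hnd (Nat.dvd_of_mod_eq_zero h)
  have h2 := Nat.mod_lt (l - k) hpos
  have h3 := Nat.div_add_mod (l - k) δ
  set q := (l - k) / δ
  have h4 := hk.add (ha'.nsmul q)
  have h5 := hl.add (ha.nsmul q)
  have h6 : q * (a + δ) = q * a + δ * q := by ring
  obtain ⟨δ', hδ', hle⟩ := delta_le (S := S) (by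
    intro g hg
    rcases Multiset.mem_add.1 hg with h | h
    exacts [hB g h, hB0 g (Multiset.mem_of_mem_nsmul h)]) h4 h5 (by omega)
  have := Nat.sInf_le hδ'
  omega

lemma struct_of_delta [Fintype Z] {d : ℕ} {S : Set Z} (hne : deltaG0 S ≠ ∅)
    (hd : d ∣ sInf (deltaG0 S)) {T : Finset Z} (hT : ∀ x ∈ T, x ∈ S) : Struct d T := by
  intro f f' hf hf' he ho
  have hB : ∀ g ∈ f.sum, g ∈ S := fun g hg => hT g (ho g hg)
  have h1 : Len f.sum f.card := ⟨f, hf, rfl, rfl⟩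
  have h2 : Len f.sum f'.card := ⟨f', hf', he.symm, rfl⟩
  rcases lt_trichotomy f.card f'.card with h | h | h
  · exact (Nat.modEq_iff_dvd' h.le).2 (hd.trans (sInf_dvd hne hB h1 h2 h))
  · rw [h]
  · exact ((Nat.modEq_iff_dvd' h.le).2 (hd.trans (sInf_dvd hne hB h2 h1 h))).symm

lemma KG0_finite [Fintype Z] (S : Set Z) :
    {x | ∃ A : Multiset Z, IsMinZeroSum S A ∧ x = crossNum A}.Finite := by
  apply ((at_finite (Z := Z)).image crossNum).subset
  rintro x ⟨A, hA, rfl⟩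
  exact ⟨A, (isMin_iff.1 hA).1, rfl⟩

lemma KGd_finite [Fintype Z] (d : ℕ) :
    {x | ∃ G0 : Set Z, deltaG0 G0 ≠ ∅ ∧ d ∣ sInf (deltaG0 G0) ∧ x = KG0 G0}.Finite := by
  apply (Set.finite_range (KG0 (G := Z))).subset
  rintro x ⟨S, _, _, rfl⟩
  exact ⟨S, rfl⟩

lemma KGd_attained [Fintype Z] {d : ℕ} (h : 0 < KGd Z d) :
    ∃ A : Multiset Z, At A ∧ Struct d A.toFinset ∧ crossNum A = KGd Z d := by
  have hne : {x | ∃ G0 : Set Z, deltaG0 G0 ≠ ∅ ∧ d ∣ sInf (deltaG0 G0) ∧ x = KG0 G0}.Nonempty := by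
    by_contra hc
    rw [Set.not_nonempty_iff_eq_empty] at hc
    rw [KGd, hc, Real.sSup_empty] at h
    exact lt_irrefl _ h
  obtain ⟨S, h1, h2, h3⟩ := hne.csSup_mem (KGd_finite d)
  have h3' : KGd Z d = KG0 S := h3
  have hne' : {x | ∃ A : Multiset Z, IsMinZeroSum S A ∧ x = crossNum A}.Nonempty := by
    by_contra hc
    rw [Set.not_nonempty_iff_eq_empty] at hc
    rw [h3', KG0, hc, Real.sSup_empty] at h
    exact lt_irrefl _ h
  obtain ⟨A, hA, hA'⟩ := hne'.csSup_mem (KG0_finite S)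
  have hA2 : KG0 S = crossNum A := hA'
  rw [isMin_iff] at hA
  exact ⟨A, hA.1, struct_of_delta h1 h2 fun x hx => hA.2 x (Multiset.mem_toFinset.1 hx), by rw [h3', hA2]⟩

lemma KGd_upper [Fintype Z] {d : ℕ} (h : 1 ≤ KGd Z d) {A : Multiset Z} (hA : At A)
    (hS : Struct d A.toFinset) : crossNum A ≤ KGd Z d := by
  let S : Set Z := {x | x ∈ A}
  have hmem : ∀ B : Multiset Z, (∀ g ∈ B, g ∈ S) → Over A.toFinset B := fun B hB x hx =>
    Multiset.mem_toFinset.2 (hB x hx)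
  by_cases hne : deltaG0 S = ∅
  · have e : ck A = ex Z := by
      have h1 : Len (ex Z • A) (ex Z * 1) := Len.nsmul ⟨{A}, Fac.single hA, by simp, by simp⟩ _
      have h2 : Len (ex Z • A) (ck A) := ⟨powFac A, powFac_fac _, powFac_sum _, powFac_card _⟩
      rw [mul_one] at h1
      have hB : ∀ g ∈ ex Z • A, g ∈ S := fun g hg => Multiset.mem_of_mem_nsmul hg
      rcases lt_trichotomy (ck A) (ex Z) with h | h | h
      · obtain ⟨δ, hδ, _⟩ := delta_le hB h2 h1 h
        rw [hne] at hδ; exact absurd hδ (Set.notMem_empty _)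
      · exact h
      · obtain ⟨δ, hδ, _⟩ := delta_le hB h1 h2 h
        rw [hne] at hδ; exact absurd hδ (Set.notMem_empty _)
    have h1 := ck_real A
    rw [e] at h1
    have hpos : (0 : ℝ) < ex Z := by exact_mod_cast ex_pos
    have : crossNum A = 1 := by
      apply mul_left_cancel₀ hpos.ne'
      linarith
    rw [this]; exact h
  · have hd : d ∣ sInf (deltaG0 S) := by
      have h1 := Nat.sInf_mem (Set.nonempty_iff_ne_empty.2 hne)
      obtain ⟨hpos, B, hB, hs, a, ⟨f, hf, hfs, hfc⟩, ⟨f', hf', hfs', hfc'⟩, -⟩ := deltaG0_iff.1 h1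
      have := hS f f' hf hf' (by rw [hfs, hfs']) (by rw [hfs]; exact hmem _ hB)
      rw [hfc, hfc', Nat.modEq_iff_dvd' (by omega)] at this
      simpa using this
    have h1 : KG0 S ≤ KGd Z d := le_csSup (KGd_finite d).bddAbove ⟨S, hne, hd, rfl⟩
    have h2 : crossNum A ≤ KG0 S := le_csSup (KG0_finite S).bddAbove
      ⟨A, isMin_iff.2 ⟨hA, fun g hg => hg⟩, rfl⟩
    linarith

end KSec
end ZS

open scoped Classical
set_option linter.unusedSectionVars false

namespace ZS

section StepA
variable {Z : Type*} [AddCommGroup Z] [Fintype Z]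

noncomputable def kw (z : Z) : ℝ := 1 / addOrderOf z

lemma kw_nonneg (z : Z) : 0 ≤ kw z := by unfold kw; positivity

lemma omg_kw (A : Multiset Z) : omg kw A = crossNum A := rfl

lemma ex_pos_real : (0 : ℝ) < ex Z := by exact_mod_cast ex_pos

lemma one_le_cross {A : Multiset Z} : 1 ≤ crossNum A ↔ ex Z ≤ ck A := by
  have h := ck_real A
  have hp := ex_pos_real (Z := Z)
  constructor
  · intro h1
    have : (ex Z : ℝ) ≤ ck A := by rw [h]; nlinarith
    exact_mod_cast this
  · intro h1
    have : (ex Z : ℝ) ≤ ck A := by exact_mod_cast h1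
    rw [h] at this
    by_contra hc
    push Not at hc
    nlinarith

lemma Struct.toF {d : ℕ} {S : Finset Z} (hS : Struct d S) {A : Multiset Z} (ho : Over S A) :
    Struct d A.toFinset := hS.mono fun x hx => ho x (Multiset.mem_toFinset.1 hx)

lemma bd_lcn {d : ℕ} {β : ℝ} (hβ : 0 ≤ β) (H : ∀ S : Finset Z, Struct d S → LCN S)
    (Hβ : ∀ A : Multiset Z, At A → Struct d A.toFinset → crossNum A ≤ β) : Bd Z d β := by
  refine bd_of_weights hβ fun S hS => ⟨kw, kw_nonneg, fun A hA ho => ?_⟩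
  rw [omg_kw]
  exact ⟨one_le_cross.2 (H S hS A hA ho), Hβ A hA (hS.toF ho)⟩

lemma lcn_of_large {d : ℕ} (h : ex Z ≤ d + 1) {S : Finset Z} (hS : Struct d S) : LCN S := by
  intro A hA ho
  by_contra hc
  have := (ck_small hS hA ho (by omega)).1
  omega

lemma bd_hf {d : ℕ} (H : ∀ S : Finset Z, Struct d S → HF S) : Bd Z d 1 := by
  refine bd_lcn zero_le_one (fun S hS A hA ho => (H S hS A hA ho).ge) fun A hA hS => ?_
  have := H _ hS A hA (over_toFinset A)
  have h := ck_real A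
  have hp := ex_pos_real (Z := Z)
  rw [this] at h
  nlinarith

lemma stepA {r d : ℕ} (hr : 1 ≤ r) (hR : RkLe r Z) (hex : ex Z ≤ r + 1) (hd : r ≤ d) : Bd Z d 1 :=
  bd_hf fun S hS => hf_of_rank (by omega) (by omega) hR hd hS (lcn_of_large (by omega) hS)

lemma exists_ord_ex : ∃ g : Z, addOrderOf g = ex Z :=
  AddMonoid.exists_addOrderOf_eq_exponent AddMonoid.ExponentExists.of_finite

lemma ex_le_of_bd {r : ℕ} (hr : 1 ≤ r) (h : ∀ d, r ≤ d → Bd Z d 1) : ex Z ≤ r + 1 := by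
  by_contra hc
  obtain ⟨g, hg⟩ := exists_ord_ex (Z := Z)
  have := (h (ex Z - 2) (by omega)).pair (by omega) hg
  have h3 : (3 : ℝ) ≤ ex Z := by exact_mod_cast (by omega : 3 ≤ ex Z)
  linarith

lemma ind_of_int {κ : Type*} [Fintype κ] {p : ℕ} {e : κ → Z} (h1 : ∀ i, p • e i = 0)
    (h2 : ∀ c : κ → ℤ, ∑ i, c i • e i = 0 → ∀ i, (p : ℤ) ∣ c i) : Ind p e :=
  ⟨h1, fun c hc i => by
    have := h2 (fun i => c i) (by simpa using hc) i
    exact_mod_cast this⟩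

lemma rk_of_bd {r : ℕ} (hr : 1 ≤ r) (h : ∀ d, r ≤ d → Bd Z d 1) : RkLe r Z := by
  by_contra hc
  obtain ⟨p, hp, e, h1, h2⟩ := exists_indep_of_not_rk hc
  have := Bd.std (ind_of_int h1 h2) hp.two_le (by simp; omega) (β := 1) (h _ (by simp))
  simp only [Fintype.card_fin] at this
  push_cast at this
  have h3 : (2 : ℝ) ≤ p := by exact_mod_cast hp.two_le
  have h4 : (1 : ℝ) ≤ r := by exact_mod_cast hr
  nlinarith

end StepA

section Weights
variable {Z : Type*} [AddCommGroup Z] [Fintype Z]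

lemma weights_unlinked {d : ℕ} {S : Finset Z} (hS : Struct d S) (hN : ex Z = d + 2) {β : ℝ}
    (hβ : (ex Z : ℝ) / 2 ≤ β) (h1 : 1 ≤ β)
    (Hβ : ∀ A : Multiset Z, At A → Struct d A.toFinset → crossNum A ≤ β)
    (hun : ∀ g ∈ S, -g ∈ S → addOrderOf g = ex Z → ∀ A, At A → Over S A → g ∈ A →
      A = ex Z • {g} ∨ A = {g, -g}) :
    ∃ ω : Z → ℝ, (∀ z, 0 ≤ ω z) ∧ ∀ A, At A → Over S A → 1 ≤ omg ω A ∧ omg ω A ≤ β := by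
  let P : Z → Prop := fun z => z ∈ S ∧ -z ∈ S ∧ addOrderOf z = ex Z
  have hPn : ∀ z, P z → P (-z) := fun z hz => ⟨hz.2.1, by rw [neg_neg]; exact hz.1, by
    rw [addOrderOf_neg]; exact hz.2.2⟩
  refine ⟨fun z => if P z then 1 / 2 else kw z, fun z => ?_, fun A hA ho => ?_⟩
  · simp only; split_ifs
    · norm_num
    · exact kw_nonneg z
  · by_cases hc : ∃ g ∈ A, P g
    · obtain ⟨g, hg, hP⟩ := hc
      have hP' := hPn g hP
      have h2 : (2 : ℝ) ≤ ex Z := by exact_mod_cast (by omega : 2 ≤ ex Z)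
      rcases hun g hP.1 hP.2.1 hP.2.2 A hA ho hg with rfl | rfl
      · have : omg (fun z => if P z then 1 / 2 else kw z) (ex Z • {g}) = ex Z / 2 := by
          simp [omg, Multiset.map_nsmul, hP, Multiset.sum_nsmul]
          ring
        rw [this]
        exact ⟨by linarith, hβ⟩
      · have : omg (fun z => if P z then 1 / 2 else kw z) {g, -g} = 1 := by
          simp [omg, hP, hP']
          norm_num
        rw [this]
        exact ⟨le_rfl, h1⟩
    · push Not at hc
      have : omg (fun z => if P z then 1 / 2 else kw z) A = crossNum A := by
        rw [← omg_kw]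
        unfold omg
        congr 1
        exact Multiset.map_congr rfl fun x hx => by simp [hc x hx]
      rw [this]
      refine ⟨one_le_cross.2 ?_, Hβ A hA (hS.toF ho)⟩
      by_contra hlt
      obtain ⟨g, rfl, hg⟩ := (ck_small hS hA ho (by omega)).2 hN
      exact hc g (by simp) ⟨ho g (by simp), ho (-g) (by simp), hg⟩

lemma weights_linked {κ : Type*} [Fintype κ] {N : ℕ} {S : Finset Z} {e : κ → Z} (h : Ind N e)
    (hN : 4 ≤ N) (hR : Fintype.card κ + 1 = N) {β : ℝ} (hβ : (N : ℝ) - 2 + 3 / N ≤ β)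
    (hS : S ⊆ insert 0 (Finset.univ.image (std3 e))) :
    ∃ ω : Z → ℝ, (∀ z, 0 ≤ ω z) ∧ ∀ A, At A → Over S A → 1 ≤ omg ω A ∧ omg ω A ≤ β := by
  have hinj := h.std3_inj (by omega) (by omega)
  have hN4 : (4 : ℝ) ≤ N := by exact_mod_cast hN
  have hNp : (0 : ℝ) < N := by linarith
  have h0 : ∀ o, std3 e o ≠ 0 := by
    have : Nonempty κ := Fintype.card_pos_iff.1 (by omega)
    have ho : ∀ o, addOrderOf (std3 e o) = N := by
      rintro (_ | _ | i)
      · simp [std3, addOrderOf_neg, h.ord_sum]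
      · simp [std3, std, h.ord_sum]
      · simp [std3, std, h.ord]
    intro o hh
    have := ho o
    rw [hh] at this; simp at this; omega
  let w0 : Option (Option κ) → ℝ := fun o => o.elim (((N : ℝ) - 2) / N) (fun o => o.elim (2 / N) (fun _ => 1 / N))
  have hw0 : ∀ o, 0 ≤ w0 o := by
    rintro (_ | _ | i) <;> simp only [w0, Option.elim_none, Option.elim_some]
    · exact div_nonneg (by linarith) hNp.le
    · positivity
    · positivity
  let ω : Z → ℝ := Function.extend (std3 e) w0 (fun _ => 1)
  have hωe : ∀ o, ω (std3 e o) = w0 o := fun o => hinj.extend_apply _ _ _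
  have hωz : ω 0 = 1 := Function.extend_apply' _ _ _ (by rintro ⟨o, ho⟩; exact h0 o ho)
  have hβ1 : 1 ≤ β := by
    have : 0 < 3 / (N : ℝ) := by positivity
    linarith
  have hβN : ((N : ℝ) ^ 2 - 2 * N + 3) / N ≤ β := by
    have : ((N : ℝ) ^ 2 - 2 * N + 3) / N = N - 2 + 3 / N := by field_simp
    rw [this]; exact hβ
  refine ⟨ω, fun z => ?_, fun A hA ho => ?_⟩
  · by_cases hz : ∃ o, std3 e o = z
    · obtain ⟨o, rfl⟩ := hz; rw [hωe]; exact hw0 o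
    · simp only [ω]; rw [Function.extend_apply' _ _ _ hz]; norm_num
  · by_cases hz : (0 : Z) ∈ A
    · rw [hA.zero_mem hz]
      simp [omg, hωz, hβ1]
    · have ho' : Over (Finset.univ.image (std3 e)) A := by
        intro x hx
        rcases Finset.mem_insert.1 (hS (ho x hx)) with h | h
        · rw [h] at hx; exact absurd hx hz
        · exact h
      rw [cm_rep hinj ho'] at hA ⊢
      generalize (fun i => A.count (std3 e i)) = c at hA ⊢
      rw [cm_omg]
      simp only [hωe]
      have hk : ((Fintype.card κ : ℕ) : ℝ) = N - 1 := by
        have : ((Fintype.card κ + 1 : ℕ) : ℝ) = N := by exact_mod_cast hR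
        push_cast at this; linarith
      simp only [Fintype.sum_option, w0, Option.elim_none, Option.elim_some]
      rcases h.std3_atom (by omega) (by omega) hA with ⟨h0, hA'⟩ | ⟨h0, h1⟩ | ⟨h0, h1, h2⟩ | ⟨h0, h1, h2⟩
      · rcases h.std_atom (by omega) (by omega) hA' with ⟨h1, h2⟩ | ⟨j, h1⟩
        · have h3 : ∀ i, (c (some (some i)) : ℝ) = N - c (some none) := by
            intro i; rw [← h2 i]; push_cast; ring
          have hle : (c (some none) : ℝ) ≤ N := by
            have hne : Nonempty κ := Fintype.card_pos_iff.1 (by omega)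
            have := h2 (Classical.arbitrary κ)
            exact_mod_cast (by omega : c (some none) ≤ N)
          have h1' : (1 : ℝ) ≤ c (some none) := by exact_mod_cast h1
          simp only [h0, h3, Finset.sum_const, Finset.card_univ, nsmul_eq_mul, hk]
          have e1 : ((0 : ℕ) : ℝ) * (((N : ℝ) - 2) / N) + (c (some none) * (2 / N) + (N - 1) * ((N - c (some none)) * (1 / N)))
            = (2 * c (some none) + (N - 1) * (N - c (some none))) / N := by field_simp; push_cast; ring
          rw [e1]
          constructor
          · rw [le_div_iff₀ hNp]; nlinarith
          · refine le_trans ?_ hβN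
            refine div_le_div_of_nonneg_right ?_ hNp.le
            nlinarith
        · have h2 : ∀ o, c (some o) = if o = some j then N else 0 := fun o => congrFun h1 o
          simp only [h0, h2]
          simp
          rw [mul_inv_cancel₀ hNp.ne']
          exact ⟨le_rfl, hβ1⟩
      · simp only [h0, h1]
        simp
        rw [mul_div_cancel₀ _ hNp.ne']
        have : 0 < 3 / (N : ℝ) := by positivity
        constructor <;> linarith
      · simp only [h0, h1, h2]
        simp
        rw [← add_div, show (N : ℝ) - 2 + 2 = N by ring, div_self hNp.ne']
        exact ⟨le_rfl, hβ1⟩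
      · simp only [h0, h1, h2]
        simp [hk]
        rw [← div_eq_mul_inv, ← add_div]
        constructor
        · rw [le_div_iff₀ hNp]; nlinarith
        · refine le_trans ?_ hβN
          refine div_le_div_of_nonneg_right ?_ hNp.le
          nlinarith

end Weights
end ZS

open scoped Classical
set_option linter.unusedSectionVars false

namespace ZS

section Linked
variable {Z : Type*} [AddCommGroup Z] [Fintype Z]

lemma wt_ex {g : Z} (hg : addOrderOf g = ex Z) : wt g = 1 := by
  have h1 := ord_mul_wt g
  have h2 := ex_pos (Z := Z)
  rw [hg] at h1
  exact Nat.eq_of_mul_eq_mul_left h2 (by omega)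

lemma ord_neg {g : Z} (hg : addOrderOf g = ex Z) : addOrderOf (-g) = ex Z := by
  rw [addOrderOf_neg, hg]

lemma ne_neg {g : Z} (hg : addOrderOf g = ex Z) (h3 : 3 ≤ ex Z) : g ≠ -g := by
  intro h
  have h1 : 2 • g = 0 := by rw [two_nsmul]; nth_rewrite 2 [h]; simp
  have := addOrderOf_dvd_of_nsmul_eq_zero h1
  have := Nat.le_of_dvd (by norm_num) this
  omega

lemma sum_erase_mem {f : Multiset (Multiset Z)} {g : Z} (h : ∀ B ∈ f, g ∈ B) :
    f.sum = f.card • ({g} : Multiset Z) + (f.map fun B => B.erase g).sum := by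
  induction f using Multiset.induction with
  | empty => simp
  | cons A f ih =>
    have h1 := h A (Multiset.mem_cons_self _ _)
    rw [Multiset.sum_cons, ih fun B hB => h B (Multiset.mem_cons_of_mem hB), Multiset.map_cons,
      Multiset.sum_cons, Multiset.card_cons, succ_nsmul]
    conv_lhs => rw [← Multiset.cons_erase h1, ← Multiset.singleton_add]
    abel

lemma split_count (A : Multiset Z) (g : Z) :
    A = A.count g • {g} + A.filter (· ≠ g) := by
  ext x
  rw [Multiset.count_add, Multiset.count_nsmul, Multiset.count_singleton, Multiset.count_filter]
  by_cases hx : x = g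
  · simp [hx]
  · simp [hx]

/-- context data for a pair ±g -/
structure Pr (d : ℕ) (S : Finset Z) (g : Z) : Prop where
  hd : 2 ≤ d
  hN : ex Z = d + 2
  hS : Struct d S
  hg : g ∈ S
  hg' : -g ∈ S
  ho : addOrderOf g = ex Z

namespace Pr
variable {d : ℕ} {S : Finset Z} {g : Z}

lemma neg (h : Pr d S g) : Pr d S (-g) :=
  ⟨h.hd, h.hN, h.hS, h.hg', by simpa using h.hg, ord_neg h.ho⟩

lemma ne (h : Pr d S g) : g ≠ -g := ne_neg h.ho (by have := h.hN; have := h.hd; omega)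
lemma ne0 (h : Pr d S g) : g ≠ 0 := by
  rintro rfl
  exact h.ne (by simp)

lemma flip (h : Pr d S g) {a : ℕ} {T : Multiset Z} (ha : 1 ≤ a) (ha' : a < ex Z)
    (hA : At (a • {g} + T)) (ho : Over S T) (h1 : g ∉ T) (h2 : -g ∉ T) :
    (a = 1 ∧ At ((ex Z - 1) • {-g} + T)) ∨
    ∃ f : Multiset (Multiset Z), f.card = ex Z - a ∧ f.sum = T ∧ ∀ B ∈ f, At ({-g} + B) := by
  have hs : ((ex Z - a) • {-g} + T : Multiset Z).sum = 0 := by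
    have h3 := hA.2.1
    have h4 := ex_smul g
    rw [Multiset.sum_add, Multiset.sum_nsmul, Multiset.sum_singleton] at h3 ⊢
    have : ex Z = (ex Z - a) + a := by omega
    rw [this, add_nsmul] at h4
    rw [smul_neg, eq_neg_of_add_eq_zero_left h4, neg_neg]
    exact h3
  obtain ⟨f, hf, hfs⟩ := exists_fac _ hs
  have hm : ∀ B ∈ f, -g ∈ B := by
    intro B hB
    by_contra hc
    have hle : B ≤ (ex Z - a) • {-g} + T := hfs ▸ Multiset.le_sum_of_mem hB
    have hle2 : B ≤ T := by
      rw [Multiset.le_iff_count] at hle ⊢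
      intro x
      by_cases hx : x = -g
      · rw [hx, Multiset.count_eq_zero.2 hc]; exact Nat.zero_le _
      · have := hle x
        rw [Multiset.count_add, Multiset.count_nsmul, Multiset.count_singleton, if_neg hx] at this
        simpa using this
    have h5 := hA.eq_of_le (hle2.trans (Multiset.le_add_left _ _)) (hf B hB).2.1 (hf B hB).1
    apply h1
    apply Multiset.mem_of_le hle2
    rw [h5, Multiset.mem_add]
    left
    rw [Multiset.mem_nsmul]; simp; omega
  have h6 := sum_erase_mem hm
  have hlecard : f.card ≤ ex Z - a := by
    have := congrArg (Multiset.count (-g)) h6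
    rw [hfs, Multiset.count_add, Multiset.count_add, Multiset.count_eq_zero.2 h2] at this
    simp at this; omega
  have hpos : 0 < f.card := by
    apply fac_pos
    rw [hfs]
    intro hc
    have := congrArg Multiset.card hc
    simp at this; omega
  have hst := h.hS (f + {ex Z • {g}}) ({a • {g} + T} + (ex Z - a) • {{g, -g}})
    (hf.add (Fac.single (by have := at_pow (ord_pos g); rwa [h.ho] at this)))
    ((Fac.single hA).add ((Fac.single (at_pair h.ne0)).nsmul _))
    (by
      rw [Multiset.sum_add, Multiset.sum_add, Multiset.sum_nsmul, hfs]
      simp only [Multiset.sum_singleton]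
      have e1 : ({g, -g} : Multiset Z) = {g} + {-g} := rfl
      have e2 : ex Z • ({g} : Multiset Z) = (ex Z - a) • {g} + a • {g} := by
        rw [← add_nsmul]; congr 1; omega
      rw [e1, e2, nsmul_add]; abel)
    (by
      rw [Multiset.sum_add, hfs, Multiset.sum_singleton]
      exact (((over_pow h.hg' _).add ho).add (over_pow h.hg _)))
  have hmod : f.card ≡ ex Z - a [MOD d] := by
    simp only [Multiset.card_add, Multiset.card_singleton, Multiset.card_nsmul, 
      mul_one] at hst
    rw [add_comm 1] at hst
    exact Nat.ModEq.add_right_cancel' 1 hst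
  have hN := h.hN
  have hd := h.hd
  have hcase : f.card = ex Z - a ∨ (a = 1 ∧ f.card = 1) := by
    rcases eq_or_lt_of_le hlecard with h7 | h7
    · left; exact h7
    · right
      obtain ⟨c, hc⟩ := (Nat.modEq_iff_dvd' hlecard).1 hmod
      have hc1 : c = 1 := by
        rcases c with _ | _ | c
        · simp at hc; omega
        · rfl
        · exfalso
          have : d * (c + 1 + 1) = d * c + d + d := by ring
          have : 0 ≤ d * c := Nat.zero_le _
          omega
      subst hc1
      omega
  rcases hcase with h7 | ⟨h7, h8⟩
  · right
    refine ⟨f.map fun B => B.erase (-g), by simpa using h7, ?_, ?_⟩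
    · rw [hfs, h7] at h6
      exact (add_left_cancel h6).symm
    · intro B hB
      obtain ⟨C, hC, rfl⟩ := Multiset.mem_map.1 hB
      rw [Multiset.singleton_add, Multiset.cons_erase (hm C hC)]
      exact hf C hC
  · left
    have := at_of_fac_card_one hf h8
    rw [hfs, h7] at this
    exact ⟨h7, this⟩

/-- atoms containing g are large unless a pair -/
lemma big (h : Pr d S g) {A : Multiset Z} (hA : At A) (ho : Over S A) (hm : g ∈ A)
    (hm' : -g ∉ A) : ex Z ≤ ck A := by
  by_contra hc
  push Not at hc
  obtain ⟨x, hx, _⟩ := (ck_small h.hS hA ho hc).2 h.hN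
  rw [hx] at hm hm'
  simp at hm hm'
  rcases hm with rfl | rfl
  · exact hm'.2 rfl
  · exact hm'.1 (by simp)

lemma rule (h : Pr d S g) {a : ℕ} {T : Multiset Z} (ha : 2 ≤ a) (ha' : a < ex Z)
    (hA : At (a • {g} + T)) (ho : Over S T) (h1 : g ∉ T) (h2 : -g ∉ T) :
    ex Z + d * (ex Z - a) ≤ ck (a • {g} + T) := by
  rcases h.flip (by omega) ha' hA ho h1 h2 with h3 | ⟨f, hc, hs, hf⟩
  · omega
  have key : ∀ f : Multiset (Multiset Z), f.sum ≤ T → (∀ B ∈ f, At ({-g} + B)) →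
      (ex Z - 1) * f.card ≤ ck f.sum := by
    intro f
    induction f using Multiset.induction with
    | empty => simp
    | cons B f ih =>
      intro hle hf
      rw [Multiset.sum_cons] at hle
      have h3 := ih ((Multiset.le_add_left _ _).trans hle)
        (fun C hC => hf C (Multiset.mem_cons_of_mem hC))
      have hB := (Multiset.le_add_right _ _).trans hle
      have h4 := h.neg.big (hf B (Multiset.mem_cons_self _ _))
        ((by intro x hx; rw [Multiset.mem_singleton] at hx; rw [hx]; exact h.hg' : Over S {-g}).add
          (ho.le hB)) (by simp) (by
            rw [neg_neg, Multiset.mem_add, Multiset.mem_singleton]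
            rintro (h5 | h5)
            · exact h.ne h5
            · exact h1 (Multiset.mem_of_le hB h5))
      simp only [ck_add, ck_singleton, wt_ex (ord_neg h.ho)] at h4
      rw [Multiset.sum_cons, ck_add, Multiset.card_cons, mul_add]
      omega
  have h3 := key f hs.le hf
  rw [hs, hc] at h3
  rw [ck_add, ck_nsmul, ck_singleton, wt_ex h.ho]
  have hN := h.hN
  obtain ⟨k, hk⟩ : ∃ k, ex Z = a + k := ⟨ex Z - a, by omega⟩
  have e1 : ex Z - a = k := by omega
  have e2 : ex Z - 1 = d + 1 := by omega
  rw [e1] at h3 ⊢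
  rw [e2] at h3
  nlinarith

/-- minimal linked atom -/
lemma exists_UV (h : Pr d S g) {A : Multiset Z} (hA : At A) (ho : Over S A) (hm : g ∈ A)
    (h1 : A ≠ ex Z • {g}) (h2 : A ≠ {g, -g}) :
    ∃ γ, (γ = g ∨ γ = -g) ∧ ∃ T : Multiset Z, Over S T ∧ γ ∉ T ∧ -γ ∉ T ∧
      At ({-γ} + T) ∧ At ((ex Z - 1) • {γ} + T) := by
  -- predicate
  let P : ℕ → Prop := fun k => ∃ γ, (γ = g ∨ γ = -g) ∧ ∃ T : Multiset Z, T.card = k ∧ Over S T ∧ γ ∉ T ∧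
    -γ ∉ T ∧ T ≠ 0 ∧ ∃ a, 1 ≤ a ∧ a < ex Z ∧ At (a • {γ} + T)
  have hP : ∃ k, P k := by
    have hng : -g ∉ A := fun hc => h2 (hA.neg_pair hm hc h.ne)
    have hlt : A.count g < ex Z := by
      by_contra hc
      apply h1
      have := hA.eq_pow (h := g) (by rw [h.ho]; omega)
      rwa [h.ho] at this
    have e : A = A.count g • {g} + A.filter (· ≠ g) := split_count A g
    refine ⟨_, g, Or.inl rfl, A.filter (· ≠ g), rfl, ho.le (Multiset.filter_le _ _), by simp,
      by simp [hng], ?_, A.count g, Multiset.count_pos.2 hm, hlt, by rw [← e]; exact hA⟩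
    intro hc
    rw [hc, add_zero] at e
    have h3 := hA.2.1
    rw [e, Multiset.sum_nsmul, Multiset.sum_singleton] at h3
    have := Nat.le_of_dvd (Multiset.count_pos.2 hm) (addOrderOf_dvd_of_nsmul_eq_zero h3)
    rw [h.ho] at this
    omega
  obtain ⟨γ, hγ, T, hTk, hTo, t1, t2, t0, a, ha, ha', hAt⟩ := Nat.find_spec hP
  have hmin : ∀ k, P k → T.card ≤ k := fun k hk => hTk ▸ Nat.find_min' hP hk
  have hpr : Pr d S γ := by rcases hγ with rfl | rfl; exacts [h, h.neg]
  have hγ' : -γ = g ∨ -γ = -g := by rcases hγ with rfl | rfl <;> simp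
  have hd := h.hd
  have hN := h.hN
  rcases hpr.flip ha ha' hAt hTo t1 t2 with ⟨rfl, h3⟩ | ⟨f, hc, hs, hf⟩
  · refine ⟨-γ, hγ', T, hTo, t2, by simpa using t1, by simpa using hAt, h3⟩
  · by_cases h1c : ex Z - a = 1
    · rw [h1c] at hc
      obtain ⟨B, rfl⟩ := Multiset.card_eq_one.1 hc
      rw [Multiset.sum_singleton] at hs
      subst hs
      refine ⟨γ, hγ, B, hTo, t1, t2, hf B (by simp), ?_⟩
      have : ex Z - 1 = a := by omega
      rwa [this]
    · exfalso
      obtain ⟨B, hB⟩ := Multiset.card_pos_iff_exists_mem.1 (by omega : 0 < f.card)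
      obtain ⟨f', rfl⟩ := Multiset.exists_cons_of_mem hB
      rw [Multiset.sum_cons] at hs
      rw [Multiset.card_cons] at hc
      have nz : ∀ C ∈ B ::ₘ f', C ≠ 0 := by
        rintro C hC rfl
        have := (hf _ hC).2.1
        simp at this
        exact hpr.ne0 this
      obtain ⟨C, hC⟩ := Multiset.card_pos_iff_exists_mem.1 (by omega : 0 < f'.card)
      have hCle : C.card ≤ f'.sum.card := Multiset.card_le_card (Multiset.le_sum_of_mem hC)
      have hCp := Multiset.card_pos.2 (nz C (Multiset.mem_cons_of_mem hC))
      have hBle : B ≤ T := hs ▸ Multiset.le_add_right _ _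
      have := hmin B.card ⟨-γ, hγ', B, rfl, hTo.le hBle, fun hx => t2 (Multiset.mem_of_le hBle hx),
        by rw [neg_neg]; exact fun hx => t1 (Multiset.mem_of_le hBle hx), nz B (by simp), 1, le_rfl,
        by omega, by simpa using hf B (by simp)⟩
      rw [← hs, Multiset.card_add] at this
      omega

end Pr
end Linked
end ZS

open scoped Classical
set_option linter.unusedSectionVars false

namespace ZS

section LemM
variable {Z : Type*} [AddCommGroup Z] [Fintype Z]

structure ME (d : ℕ) (S : Finset Z) (g : Z) (E : Finset Z) (s : (Z → ℤ) → ZMod (ex Z)) : Prop where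
  pr : Pr d S g
  hs : SB d S s
  hES : E ⊆ S
  hE : MinNH E
  hL : LCN E
  hc : E.card = d + 2
  hgE : g ∈ E
  hgE' : -g ∉ E
  hx : ∃ x ∈ Q E, s x ≠ 0

namespace ME
variable {d : ℕ} {S E : Finset Z} {g : Z} {s : (Z → ℤ) → ZMod (ex Z)}

lemma erase_zero (m : ME d S g E s) {h : Z} (hh : h ∈ E) {y : Z → ℤ} (hy : y ∈ Q E)
    (h0 : y h = 0) : s y = 0 := by
  refine (m.hs.mono ((Finset.erase_subset h E).trans m.hES)).hf_zero (by have := m.pr.hd; omega)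
    (m.hE.2 h hh) ⟨fun z hz => ?_, hy.2⟩
  by_cases hzh : z = h
  · rw [hzh, h0]
  · exact hy.1 z fun hc => hz (Finset.mem_erase.2 ⟨hzh, hc⟩)

lemma coord (m : ME d S g E s) {h : Z} (hh : h ∈ E) {v : Z → ℤ} (hv : v ∈ Q E) (h1 : v h = 1)
    {y : Z → ℤ} (hy : y ∈ Q E) : s y = y h * s v := by
  have hs := m.hs.mono m.hES
  have := m.erase_zero hh (sub_mem hy (zsmul_mem hv (y h))) (by simp [h1])
  rw [hs.sub hy (zsmul_mem hv _), hs.zsmul hv, sub_eq_zero] at this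
  exact this

lemma no_unit (m : ME d S g E s) {h : Z} (hh : h ∈ E) {v : Z → ℤ} (hv : v ∈ Q E) (h1 : v h = 1) :
    s v ≠ 0 := by
  intro h0
  obtain ⟨x, hx, hx0⟩ := m.hx
  apply hx0
  rw [m.coord hh hv h1 hx, h0, mul_zero]

lemma sgv (m : ME d S g E s) {A : Multiset Z} (hA : At A) (ho : Over E A) {σ : ℤ}
    (h : (ck A : ℤ) = ex Z + d * σ) : s (cnt A) = (σ : ZMod (ex Z)) := by
  rw [m.hs.atom A hA (ho.mono m.hES), sg_eq (by have := m.pr.hd; omega) h]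

/-- decomposition helper -/
lemma dec (m : ME d S g E s) {A : Multiset Z} (ho : Over E A) :
    ∃ T, A = A.count g • {g} + T ∧ Over E T ∧ Over S T ∧ g ∉ T ∧ -g ∉ T ∧ T ≤ A := by
  refine ⟨_, split_count A g, ho.le (Multiset.filter_le _ _),
    (ho.le (Multiset.filter_le _ _)).mono m.hES, by simp, ?_, Multiset.filter_le _ _⟩
  intro hc
  exact m.hgE' (ho _ (Multiset.mem_of_mem_filter hc))

lemma rule (m : ME d S g E s) {A : Multiset Z} (hA : At A) (ho : Over E A) (h2 : 2 ≤ A.count g)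
    (hlt : A.count g < ex Z) : ex Z + d * (ex Z - A.count g) ≤ ck A := by
  obtain ⟨T, e, _, h1, h3, h4, _⟩ := m.dec ho
  have := m.pr.rule h2 hlt (by rw [← e]; exact hA) h1 h3 h4
  rwa [← e] at this

lemma pos (m : ME d S g E s) {A : Multiset Z} (hA : At A) (ho : Over E A) (hm : g ∈ A)
    (hlt : A.count g < ex Z) : ex Z < ck A := by
  refine lt_of_le_of_ne (m.hL A hA ho) fun heq => ?_
  have hp := Multiset.count_pos.2 hm
  have hd := m.pr.hd
  by_cases h1 : A.count g = 1
  · exact m.no_unit m.hgE (cnt_mem ho hA.2.1) (by simp [cnt, h1])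
      (by rw [m.sgv hA ho (σ := 0) (by rw [← heq]; simp)]; simp)
  · have h2 := m.rule hA ho (by omega) hlt
    have : 0 < d * (ex Z - A.count g) := Nat.mul_pos (by omega) (by omega)
    omega

lemma red_at (m : ME d S g E s) {B : Multiset Z} (ho : Over E B) (hs : B.sum = 0)
    (hc : ∀ h ∈ E, B.count h ≤ addOrderOf h) (h0 : 0 < B.count g) (hlt : B.count g < ex Z) :
    At B ∧ At (cpl E B) := by
  obtain ⟨f, hf, rfl⟩ := exists_fac B hs
  obtain ⟨f', hf', he⟩ := exists_fac _ (cpl_sum ho hc hs)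
  have hgt : ex Z * f.card < ck f.sum := by
    obtain ⟨A, hA, hgA⟩ : ∃ A ∈ f, g ∈ A := by
      have := Multiset.count_pos.1 h0
      by_contra hcon
      push Not at hcon
      have h2 : ∀ f : Multiset (Multiset Z), (∀ A ∈ f, g ∉ A) → g ∉ f.sum := by
        intro f
        induction f using Multiset.induction with
        | empty => simp
        | cons A f ih =>
          intro h
          rw [Multiset.sum_cons, Multiset.mem_add]
          rintro (h3 | h3)
          · exact h A (Multiset.mem_cons_self _ _) h3
          · exact ih (fun B hB => h B (Multiset.mem_cons_of_mem hB)) h3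
      exact h2 f hcon this
    obtain ⟨f1, rfl⟩ := Multiset.exists_cons_of_mem hA
    rw [Multiset.sum_cons] at ho hlt ⊢
    have h3 := m.pos (hf A hA) (ho.le (Multiset.le_add_right _ _)) hgA
      (lt_of_le_of_lt (Multiset.count_le_of_le _ (Multiset.le_add_right _ _)) hlt)
    have h4 := ck_fac_lower m.hL (f := f1) (fun B hB => hf B (Multiset.mem_cons_of_mem hB))
      (ho.le (Multiset.le_add_left _ _))
    rw [Multiset.card_cons, ck_add, mul_add]
    omega
  have h5 := cpl_comp (m.pr.hS.mono m.hES) m.hL hf hf' ho hc he hgt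
  have h6 : 0 < f.card := fac_pos (by rintro hz; rw [hz] at h0; simp at h0)
  have h7 : 0 < f'.card := fac_pos (by
    rw [he]; exact cpl_ne m.hgE (by rw [m.pr.ho]; exact hlt))
  rw [m.hc] at h5
  refine ⟨at_of_fac_card_one hf (by omega), ?_⟩
  rw [← he]
  exact at_of_fac_card_one hf' (by omega)

lemma at_le (hA : At (A : Multiset Z)) : ∀ h ∈ E, A.count h ≤ addOrderOf h := fun h _ => hA.count_le h

lemma exact_ck (m : ME d S g E s) {A : Multiset Z} (hA : At A) (ho : Over E A)
    (h2 : 2 ≤ A.count g) (hlt : A.count g + 2 ≤ ex Z) : ck A = ex Z + d * (ex Z - A.count g) := by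
  have h3 := m.rule hA ho h2 (by omega)
  have hN := m.pr.hN
  have h4 := (m.red_at ho hA.2.1 (at_le hA) (by omega) (by omega)).2
  have hcc : (cpl E A).count g = ex Z - A.count g := by rw [cpl_count m.hgE, m.pr.ho]
  have h5 := m.rule h4 (cpl_over _ _) (by omega) (by omega)
  have h6 := cpl_ck ho (at_le hA)
  rw [m.hc, ← hN] at h6
  rw [hcc] at h5
  obtain ⟨k, hk⟩ : ∃ k, ex Z = A.count g + k := ⟨ex Z - A.count g, by omega⟩
  have e1 : ex Z - A.count g = k := by omega
  have e2 : ex Z - k = A.count g := by omega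
  rw [e1] at h3 ⊢
  rw [e1, e2] at h5
  have : ex Z * ex Z = ex Z + ex Z + d * k + d * A.count g := by
    conv_lhs => rw [hN]
    nlinarith
  omega

lemma exists_V (m : ME d S g E s) : ∃ V, At V ∧ Over E V ∧ V.count g = ex Z - 1 := by
  obtain ⟨A, hA, ho, hk⟩ := m.hE.exists_atom
  have hc := m.hE.count hA ho hk g m.hgE
  rw [m.pr.ho] at hc
  have hN := m.pr.hN
  obtain ⟨T, e, hTE, h1, h3, h4, hle⟩ := m.dec ho
  rcases m.pr.flip hc.1 hc.2 (by rw [← e]; exact hA) h1 h3 h4 with ⟨h5, _⟩ | ⟨f, hfc, hfs, hf⟩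
  · refine ⟨_, (m.red_at ho hA.2.1 (at_le hA) hc.1 hc.2).2, cpl_over _ _, ?_⟩
    rw [cpl_count m.hgE, m.pr.ho, h5]
  · obtain ⟨B, hB⟩ := Multiset.card_pos_iff_exists_mem.1 (by omega : 0 < f.card)
    have hBT : B ≤ T := hfs ▸ Multiset.le_sum_of_mem hB
    have hgB : g ∉ B := fun hc => h3 (Multiset.mem_of_le hBT hc)
    have hov : Over E ((ex Z - 1) • {g} + B) := (over_pow m.hgE _).add (hTE.le hBT)
    have hcg : ((ex Z - 1) • {g} + B).count g = ex Z - 1 := by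
      rw [Multiset.count_add, Multiset.count_eq_zero.2 hgB]; simp
    refine ⟨(ex Z - 1) • {g} + B, (m.red_at hov ?_ ?_ (by omega) (by omega)).1, hov, hcg⟩
    · have h6 := (hf B hB).2.1
      rw [Multiset.sum_add, Multiset.sum_singleton] at h6
      rw [Multiset.sum_add, Multiset.sum_nsmul, Multiset.sum_singleton, ← h6]
      congr 1
      have h7 := ex_smul g
      have : ex Z = (ex Z - 1) + 1 := by omega
      rw [this, add_nsmul, one_nsmul] at h7
      exact eq_neg_of_add_eq_zero_left h7
    · intro h hh
      by_cases hhg : h = g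
      · rw [hhg, hcg, m.pr.ho]; omega
      · rw [Multiset.count_add, Multiset.count_nsmul, Multiset.count_singleton, if_neg hhg]
        have := Multiset.count_le_of_le h (hBT.trans hle)
        have := hA.count_le h
        omega

lemma two (m : ME d S g E s) {V : Multiset Z} (hV : At V) (ho : Over E V)
    (hc : V.count g = ex Z - 1) : 2 * s (cnt V) = 2 := by
  have hN := m.pr.hN
  have hd := m.pr.hd
  let B := ZS.mk fun h => (2 * V.count h) % addOrderOf h
  have hBc : ∀ h, B.count h = (2 * V.count h) % addOrderOf h := fun h => count_mk _ _
  have hBo : Over E B := by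
    intro h hh
    have := Multiset.count_pos.2 hh
    rw [hBc] at this
    apply ho
    rw [← Multiset.count_pos]
    by_contra hcon
    have h0 : V.count h = 0 := by omega
    simp [h0] at this
  have hBs : B.sum = 0 := by
    rw [sum_eq_count]
    have h1 := hV.2.1
    rw [sum_eq_count] at h1
    calc ∑ h, B.count h • h = ∑ h, 2 • (V.count h • h) := by
          refine Finset.sum_congr rfl fun h _ => ?_
          rw [hBc, mod_addOrderOf_nsmul, mul_smul]
      _ = 0 := by rw [← Finset.smul_sum, h1, smul_zero]
  have hBg : B.count g = ex Z - 2 := by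
    rw [hBc, hc, m.pr.ho]
    have : 2 * (ex Z - 1) = ex Z - 2 + ex Z := by omega
    rw [this, Nat.add_mod_right, Nat.mod_eq_of_lt (by omega)]
  have hB := (m.red_at hBo hBs (fun h _ => by rw [hBc]; exact (Nat.mod_lt _ (ord_pos h)).le)
    (by omega) (by omega)).1
  have h1 := m.exact_ck hB hBo (by omega) (by omega)
  rw [hBg] at h1
  have h2 : ex Z - (ex Z - 2) = 2 := by omega
  rw [h2] at h1
  have h3 := m.sgv hB hBo (σ := 2) (by rw [h1]; push_cast; ring)
  have hs := m.hs.mono m.hES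
  have h4 := hs.congr (by omega) (cnt_mem hBo hBs) (nsmul_mem (cnt_mem ho hV.2.1) 2) (by
    intro h
    simp only [cnt, hBc, Pi.smul_apply]
    have := Nat.mod_add_div (2 * V.count h) (addOrderOf h)
    refine ⟨-((2 * V.count h / addOrderOf h : ℕ) : ℤ), ?_⟩
    have h5 : ((2 * V.count h % addOrderOf h : ℕ) : ℤ) + addOrderOf h * (2 * V.count h / addOrderOf h : ℕ)
      = 2 * V.count h := by exact_mod_cast this
    rw [nsmul_eq_mul]
    push_cast at h5 ⊢
    linarith)
  rw [h3, hs.nsmul (cnt_mem ho hV.2.1)] at h4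
  push_cast at h4
  exact h4.symm

lemma flipE (m : ME d S g E s) {V T : Multiset Z} (hV : At V) (ho : Over E V)
    (e : V = (ex Z - 1) • {g} + T) (hT : g ∉ T) (hU : At ({-g} + T)) (hk : ck V ≠ ex Z + d)
    (hsU : s (cnt ({-g} + T)) ≠ 0) :
    ME d S (-g) (insert (-g) (E.erase g)) s := by
  have hN := m.pr.hN
  have hd := m.pr.hd
  have hne := m.pr.ne
  have hTE : Over E T := ho.le (by rw [e]; exact Multiset.le_add_left _ _)
  have hUo : Over (insert (-g) (E.erase g)) ({-g} + T) := by
    intro x hx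
    rw [Multiset.mem_add, Multiset.mem_singleton] at hx
    rw [Finset.mem_insert, Finset.mem_erase]
    rcases hx with hx | hx
    · left; exact hx
    · right; exact ⟨fun hc => hT (hc ▸ hx), hTE x hx⟩
  have hsub : insert (-g) (E.erase g) ⊆ S := by
    intro x hx
    rcases Finset.mem_insert.1 hx with rfl | hx
    · exact m.pr.hg'
    · exact m.hES (Finset.mem_of_mem_erase hx)
  have hgn : g ∉ insert (-g) (E.erase g) := by
    simp [hne]
  have hL : LCN (insert (-g) (E.erase g)) := by
    intro A hA hAo
    by_contra hc
    push Not at hc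
    obtain ⟨x, hx, hxo⟩ := (ck_small m.pr.hS hA (hAo.mono hsub) hc).2 hN
    have hx1 := hAo x (by simp [hx])
    have hx2 := hAo (-x) (by simp [hx])
    rw [Finset.mem_insert] at hx1 hx2
    rcases hx1 with rfl | hx1
    · rw [neg_neg] at hx2
      exact hgn (Finset.mem_insert.2 hx2)
    rcases hx2 with hx2 | hx2
    · have : x = g := neg_injective hx2
      exact hgn (Finset.mem_insert_of_mem (this ▸ hx1))
    · have := m.hL A hA (by
        intro y hy
        rw [hx] at hy
        simp at hy
        rcases hy with rfl | rfl
        exacts [Finset.mem_of_mem_erase hx1, Finset.mem_of_mem_erase hx2])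
      omega
  refine ⟨m.pr.neg, m.hs, hsub, ⟨?_, ?_⟩, hL, ?_, Finset.mem_insert_self _ _, by simpa using hgn,
    _, cnt_mem hUo hU.2.1, hsU⟩
  · intro hHF
    have h1 := hHF _ hU hUo
    apply hk
    rw [e]
    simp only [ck_add, ck_nsmul, ck_singleton, wt_ex m.pr.ho, wt_ex (ord_neg m.pr.ho)] at h1 ⊢
    omega
  · intro h hh A hA hAo
    by_cases hgA : -g ∈ A
    · by_cases hful : ex Z ≤ A.count (-g)
      · have := hA.eq_pow (h := -g) (by rw [ord_neg m.pr.ho]; exact hful)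
        rw [this, ck_pow]
      · exfalso
        push Not at hful
        have hAo' : Over (insert (-g) (E.erase g)) A := hAo.mono (Finset.erase_subset _ _)
        have hhg : h ≠ -g := by
          rintro rfl
          have := hAo _ hgA
          simp at this
        have hhE : h ∈ E := by
          rcases Finset.mem_insert.1 hh with h1 | h1
          · exact absurd h1 hhg
          · exact Finset.mem_of_mem_erase h1
        have hhg2 : h ≠ g := by rintro rfl; exact hgn hh
        have hp := Multiset.count_pos.2 hgA
        -- flipped sequence
        have e2 := split_count A (-g)
        set R := A.filter (· ≠ -g) with hR
        have hRo : Over (E.erase h) R := by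
          intro x hx
          have hxA := hAo x (Multiset.mem_of_mem_filter hx)
          have hxg := Multiset.of_mem_filter hx
          rw [Finset.mem_erase, Finset.mem_insert, Finset.mem_erase] at hxA
          rw [Finset.mem_erase]
          exact ⟨hxA.1, (hxA.2.resolve_left hxg).2⟩
        have hRg : g ∉ R := by
          intro hx
          exact hgn (hAo' g (Multiset.mem_of_mem_filter hx))
        have hsum : ((ex Z - A.count (-g)) • {g} + R : Multiset Z).sum = 0 := by
          have h3 := hA.2.1
          rw [e2] at h3
          have h4 := ex_smul g
          rw [Multiset.sum_add, Multiset.sum_nsmul, Multiset.sum_singleton] at h3 ⊢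
          have : ex Z = (ex Z - A.count (-g)) + A.count (-g) := by omega
          rw [this, add_nsmul] at h4
          rw [eq_neg_of_add_eq_zero_left h4, ← smul_neg]
          exact h3
        have hovE : Over (E.erase h) ((ex Z - A.count (-g)) • {g} + R) :=
          (over_pow (Finset.mem_erase.2 ⟨hhg2.symm, m.hgE⟩) _).add hRo
        have hcg : ((ex Z - A.count (-g)) • {g} + R).count g = ex Z - A.count (-g) := by
          rw [Multiset.count_add, Multiset.count_eq_zero.2 hRg]; simp
        have hat := (m.red_at (hovE.mono (Finset.erase_subset _ _)) hsum (by
          intro x hx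
          by_cases hxg : x = g
          · rw [hxg, hcg, m.pr.ho]; omega
          · rw [Multiset.count_add, Multiset.count_nsmul, Multiset.count_singleton, if_neg hxg]
            have h7 : R.count x ≤ A.count x := Multiset.count_le_of_le x (Multiset.filter_le _ A)
            have := hA.count_le x
            omega) (by omega) (by omega)).1
        have h5 := m.pos hat (hovE.mono (Finset.erase_subset _ _))
          (by rw [← Multiset.count_pos]; omega) (by omega)
        have h6 := m.hE.2 h hhE _ hat hovE
        omega
    · refine m.hE.2 g m.hgE A hA fun x hx => ?_
      have := hAo x hx
      rw [Finset.mem_erase, Finset.mem_insert] at this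
      exact this.2.resolve_left fun hc => hgA (hc ▸ hx)
  · rw [Finset.card_insert_of_notMem, Finset.card_erase_of_mem m.hgE, m.hc]
    · omega
    · exact fun hc => m.hgE' (Finset.mem_of_mem_erase hc)

lemma ck_V (m : ME d S g E s) {V : Multiset Z} (hV : At V) (ho : Over E V)
    (hc : V.count g = ex Z - 1) : ck V = ex Z + d := by
  by_contra hk
  have hN := m.pr.hN
  have hd := m.pr.hd
  obtain ⟨T, e, hTE, h1, h3, h4, hle⟩ := m.dec ho
  rw [hc] at e
  have hU : At ({-g} + T) := by
    rcases m.pr.flip (a := ex Z - 1) (by omega) (by omega) (by rw [← e]; exact hV) h1 h3 h4 with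
      ⟨h5, _⟩ | ⟨f, hfc, hfs, hf⟩
    · omega
    · obtain ⟨B, rfl⟩ := Multiset.card_eq_one.1 (by rw [hfc]; omega : f.card = 1)
      rw [Multiset.sum_singleton] at hfs
      rw [← hfs]; exact hf B (by simp)
  have hUo : Over S ({-g} + T) := by
    intro x hx
    rw [Multiset.mem_add, Multiset.mem_singleton] at hx
    rcases hx with rfl | hx
    exacts [m.pr.hg', h1 x hx]
  have hkk : ck V = ck ({-g} + T) + d := by
    rw [e]
    simp only [ck_add, ck_nsmul, ck_singleton, wt_ex m.pr.ho, wt_ex (ord_neg m.pr.ho)]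
    omega
  have h2V := m.two hV ho hc
  have hsgV := m.pr.hS.sg (by omega) hV (ho.mono m.hES)
  have hsV := m.hs.atom V hV (ho.mono m.hES)
  have hsU : s (cnt ({-g} + T)) = ((sg d V - 1 : ℤ) : ZMod (ex Z)) := by
    rw [m.hs.atom _ hU hUo, sg_eq (σ := sg d V - 1) (by omega)]
    have : (ck V : ℤ) = ck ({-g} + T) + d := by exact_mod_cast hkk
    linarith
  -- bounds on sg
  have hVpos := m.pos hV ho (by rw [← Multiset.count_pos]; omega) (by omega)
  have hcpl := (m.red_at ho hV.2.1 (at_le hV) (by omega) (by omega)).2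
  have hcg : (cpl E V).count g = 1 := by rw [cpl_count m.hgE, m.pr.ho]; omega
  have hcpos := m.pos hcpl (cpl_over _ _) (by rw [← Multiset.count_pos]; omega) (by omega)
  have hck := cpl_ck ho (at_le hV)
  rw [m.hc, ← hN] at hck
  have hdz : (0 : ℤ) < d := by exact_mod_cast (by omega : 0 < d)
  have b1 : 0 < sg d V := by
    have : (ex Z : ℤ) < ck V := by exact_mod_cast hVpos
    by_contra hcon
    push Not at hcon
    nlinarith
  have b2 : sg d V < ex Z := by
    have h5 : (ex Z : ℤ) < ck (cpl E V) := by exact_mod_cast hcpos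
    have h6 : (ck V : ℤ) + ck (cpl E V) = ex Z * ex Z := by exact_mod_cast hck
    have h7 : (ex Z : ℤ) = d + 2 := by exact_mod_cast hN
    by_contra hcon
    push Not at hcon
    nlinarith
  have b3 : sg d V ≠ 1 := by
    intro h5
    rw [h5] at hsgV
    apply hk
    have : (ck V : ℤ) = (ex Z + d : ℕ) := by rw [hsgV]; push_cast; ring
    exact_mod_cast this
  have hsU0 : s (cnt ({-g} + T)) ≠ 0 := by
    rw [hsU]
    intro h5
    rw [ZMod.intCast_zmod_eq_zero_iff_dvd _ (ex Z)] at h5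
    have := Int.le_of_dvd (by omega) h5
    omega
  have m' := m.flipE hV ho e h3 hU hk hsU0
  -- complement of U
  have hUo' : Over (insert (-g) (E.erase g)) ({-g} + T) := by
    intro x hx
    rw [Multiset.mem_add, Multiset.mem_singleton] at hx
    rw [Finset.mem_insert, Finset.mem_erase]
    rcases hx with hx | hx
    · left; exact hx
    · right; exact ⟨fun hc => h3 (hc ▸ hx), hTE x hx⟩
  have hUc : ({-g} + T).count (-g) = 1 := by
    rw [Multiset.count_add, Multiset.count_eq_zero.2 h4]; simp
  have hW := (m'.red_at hUo' hU.2.1 (at_le hU) (by omega) (by omega)).2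
  have hWc : (cpl (insert (-g) (E.erase g)) ({-g} + T)).count (-g) = ex Z - 1 := by
    rw [cpl_count m'.hgE, ord_neg m.pr.ho, hUc]
  have h2W := m'.two hW (cpl_over _ _) hWc
  have hckU := cpl_ck hUo' (at_le hU)
  rw [m'.hc, ← hN] at hckU
  have hsW := m'.sgv hW (cpl_over _ _) (σ := ex Z - (sg d V - 1)) (by
    have h6 : (ck ({-g} + T) : ℤ) + ck (cpl (insert (-g) (E.erase g)) ({-g} + T)) = ex Z * ex Z := by
      exact_mod_cast hckU
    have h7 : (ex Z : ℤ) = d + 2 := by exact_mod_cast hN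
    have h8 : (ck V : ℤ) = ck ({-g} + T) + d := by exact_mod_cast hkk
    rw [h7] at h6 hsgV ⊢
    linarith)
  rw [hsW] at h2W
  rw [hsV] at h2V
  push_cast at h2W
  have h9 : (2 : ZMod (ex Z)) = 0 := by
    have : ((ex Z : ℕ) : ZMod (ex Z)) = 0 := ZMod.natCast_self _
    rw [this] at h2W
    linear_combination -h2V - h2W
  have h10 : ((2 : ℕ) : ZMod (ex Z)) = 0 := by exact_mod_cast h9
  rw [ZMod.natCast_eq_zero_iff] at h10
  have := Nat.le_of_dvd (by norm_num) h10
  omega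

end ME
end LemM
end ZS

open scoped Classical
set_option linter.unusedSectionVars false

namespace ZS

section LinkE
variable {Z : Type*} [AddCommGroup Z] [Fintype Z]

namespace ME
variable {d : ℕ} {S E : Finset Z} {g : Z} {s : (Z → ℤ) → ZMod (ex Z)}

lemma basis (m : ME d S g E s) : ∃ V, At V ∧ Over E V ∧ V.count g = ex Z - 1 ∧ ck V = ex Z + d ∧
    (∀ h ∈ E.erase g, V.count h = 1 ∧ addOrderOf h = ex Z) ∧ g = ∑ h ∈ E.erase g, h := by
  obtain ⟨V, hV, ho, hc⟩ := m.exists_V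
  have hk := m.ck_V hV ho hc
  have hN := m.pr.hN
  have hd := m.pr.hd
  have hcnt := m.hE.count hV ho (by omega)
  have e1 : ck V = ∑ h ∈ E, V.count h * wt h := by
    rw [ck_eq_count]
    symm
    apply Finset.sum_subset (Finset.subset_univ _)
    intro x _ hx
    rw [Multiset.count_eq_zero.2 fun hc => hx (ho x hc), zero_mul]
  rw [← Finset.add_sum_erase _ _ m.hgE, hc, wt_ex m.pr.ho] at e1
  have e2 : ∑ h ∈ E.erase g, 1 = ∑ h ∈ E.erase g, V.count h * wt h := by
    rw [Finset.sum_const, smul_eq_mul, mul_one, Finset.card_erase_of_mem m.hgE, m.hc]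
    omega
  have e3 := (Finset.sum_eq_sum_iff_of_le (fun h hh => by
    have h1 := (hcnt h (Finset.mem_of_mem_erase hh)).1
    have h2 := wt_pos h
    exact Nat.mul_pos h1 h2)).1 e2
  have e4 : ∀ h ∈ E.erase g, V.count h = 1 ∧ addOrderOf h = ex Z := by
    intro h hh
    have h1 := e3 h hh
    have h2 : V.count h = 1 := Nat.eq_one_of_mul_eq_one_right h1.symm
    have h3 : wt h = 1 := Nat.eq_one_of_mul_eq_one_left h1.symm
    refine ⟨h2, ?_⟩
    have := ord_mul_wt h
    rwa [h3, mul_one] at this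
  refine ⟨V, hV, ho, hc, hk, e4, ?_⟩
  have h5 := hV.2.1
  rw [sum_eq_count, ← Finset.sum_subset (Finset.subset_univ E) (fun x _ hx => by
    rw [Multiset.count_eq_zero.2 fun hc => hx (ho x hc), zero_nsmul]),
    ← Finset.add_sum_erase _ _ m.hgE, hc] at h5
  have h6 := ex_smul g
  have : ex Z = (ex Z - 1) + 1 := by omega
  rw [this, add_nsmul, one_nsmul] at h6
  rw [eq_neg_of_add_eq_zero_left h6, Finset.sum_congr rfl (fun h hh => by rw [(e4 h hh).1, one_nsmul]),
    neg_add_eq_zero] at h5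
  exact h5

lemma indep (m : ME d S g E s) {x : Z → ℤ} (hx : x ∈ Q (E.erase g)) :
    ∀ h ∈ E.erase g, (ex Z : ℤ) ∣ x h := by
  obtain ⟨V, hV, ho, hc, hk, h1, _⟩ := m.basis
  intro h hh
  have hxE : x ∈ Q E := Q_mono (Finset.erase_subset _ _) hx
  have h2 := m.erase_zero m.hgE hxE (hx.1 g (by simp))
  have h3 := m.coord (Finset.mem_of_mem_erase hh) (cnt_mem ho hV.2.1) (by simp [cnt, (h1 h hh).1]) hxE
  rw [h2, m.sgv hV ho (σ := 1) (by rw [hk]; push_cast; ring)] at h3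
  rw [← ZMod.intCast_zmod_eq_zero_iff_dvd]
  simpa using h3.symm

lemma no_neg (m : ME d S g E s) {e : Z} (he : e ∈ E.erase g) : -e ∉ S := by
  intro hne
  obtain ⟨V, hV, ho, hc, hk, h1, _⟩ := m.basis
  have hN := m.pr.hN
  have hd := m.pr.hd
  have heE := Finset.mem_of_mem_erase he
  have hpr : Pr d S e := ⟨hd, hN, m.pr.hS, m.hES heE, hne, (h1 e he).2⟩
  have hneE : -e ∉ E := by
    intro hc
    have := m.hL _ (at_pair hpr.ne0) (by
      intro x hx
      simp at hx
      rcases hx with rfl | rfl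
      exacts [heE, hc])
    have e1 : ({e, -e} : Multiset Z) = {e} + {-e} := rfl
    rw [e1, ck_add, ck_singleton, ck_singleton, wt_ex hpr.ho, wt_ex (ord_neg hpr.ho)] at this
    omega
  have m' : ME d S e E s := ⟨hpr, m.hs, m.hES, m.hE, m.hL, m.hc, heE, hneE, m.hx⟩
  have hW := (m.red_at ho hV.2.1 (at_le hV) (by omega) (by omega)).2
  have h2 := m'.ck_V hW (cpl_over _ _) (by rw [cpl_count heE, (h1 e he).2, (h1 e he).1])
  have h3 := cpl_ck ho (at_le hV)
  rw [h2, hk, m.hc, hN] at h3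
  nlinarith

end ME

lemma PP.neg {N p b : ℕ} {w : ZMod N} (h : PP p b w) : PP p b (-w) := by
  obtain ⟨m, hm, e⟩ := h
  exact ⟨m, hm, by rw [mul_neg, e, neg_zero]⟩

lemma Pr.lcn {d : ℕ} {S : Finset Z} {g : Z} (h : Pr d S g) {A : Multiset Z} (hA : At A)
    (ho : Over S A) (hbig : ∀ x, A ≠ {x, -x}) : LCN A.toFinset := by
  have hN := h.hN
  have hd := h.hd
  intro B hB hBo
  by_contra hc
  push Not at hc
  have hAS : A.toFinset ⊆ S := fun x hx => ho x (Multiset.mem_toFinset.1 hx)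
  obtain ⟨x, hx, hxo⟩ := (ck_small h.hS hB (hBo.mono hAS) hc).2 hN
  have h1 : x ∈ A := Multiset.mem_toFinset.1 (hBo x (by simp [hx]))
  have h2 : -x ∈ A := Multiset.mem_toFinset.1 (hBo (-x) (by simp [hx]))
  exact hbig x (hA.neg_pair h1 h2 (ne_neg hxo (by omega)))

lemma Pr.exists_ME {d : ℕ} {S : Finset Z} {g : Z} (h : Pr d S g) (hR : RkLe (d + 1) Z)
    {A : Multiset Z} (hA : At A) (ho : Over S A) (hm : g ∈ A)
    (h1 : A ≠ ex Z • {g}) (h2 : A ≠ {g, -g}) : ∃ γ E s, ME d S γ E s := by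
  have hN := h.hN
  have hd := h.hd
  obtain ⟨γ, hγ, T, hTo, t1, t2, hU, hV⟩ := h.exists_UV hA ho hm h1 h2
  have hp : Pr d S γ := by rcases hγ with rfl | rfl; exacts [h, h.neg]
  clear h hA ho hm h1 h2 hγ
  obtain ⟨s, hs⟩ := hp.hS.exists_sb (by omega)
  obtain ⟨p, hpp, hpe⟩ := Nat.exists_prime_and_dvd (by omega : ex Z ≠ 1)
  have hUo : Over S ({-γ} + T) := by
    intro x hx
    rw [Multiset.mem_add, Multiset.mem_singleton] at hx
    rcases hx with rfl | hx
    exacts [hp.hg', hTo x hx]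
  have hVo : Over S ((ex Z - 1) • {γ} + T) := (over_pow hp.hg _).add hTo
  have hgV : γ ∈ (ex Z - 1) • {γ} + T := by
    rw [← Multiset.count_pos, Multiset.count_add]; simp; omega
  have hUp : ∀ x, ({-γ} + T) ≠ {x, -x} := by
    intro x hx
    have h3 : -γ = x ∨ -γ = -x := by
      have : -γ ∈ ({x, -x} : Multiset Z) := by rw [← hx]; simp
      simpa using this
    have h4 : γ ∈ ({-γ} + T : Multiset Z) := by
      rw [hx]
      rcases h3 with rfl | h3
      · simp
      · rw [neg_injective h3]; simp
    rw [Multiset.mem_add, Multiset.mem_singleton] at h4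
    exact h4.elim hp.ne t1
  have hVp : ∀ x, ((ex Z - 1) • {γ} + T) ≠ {x, -x} := by
    intro x hx
    have := congrArg Multiset.card hx
    simp at this
    omega
  have hUL := hp.lcn hU hUo hUp
  have hVL := hp.lcn hV hVo hVp
  have hUS : ({-γ} + T).toFinset ⊆ S := fun x hx => hUo x (Multiset.mem_toFinset.1 hx)
  have hVS : ((ex Z - 1) • {γ} + T).toFinset ⊆ S := fun x hx => hVo x (Multiset.mem_toFinset.1 hx)
  have hsUV : s (cnt ((ex Z - 1) • {γ} + T)) = s (cnt ({-γ} + T)) + 1 := by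
    have h3 := hp.hS.sg (by omega) hU hUo
    rw [hs.atom _ hU hUo, hs.atom _ hV hVo, sg_eq (σ := sg d ({-γ} + T) + 1) (by omega)]
    · push_cast; ring
    · have : ck ((ex Z - 1) • {γ} + T) = ck ({-γ} + T) + d := by
        simp only [ck_add, ck_nsmul, ck_singleton, wt_ex hp.ho, wt_ex (ord_neg hp.ho)]
        omega
      rw [this]
      push_cast
      rw [h3]; ring
  -- minimal set
  have hmin : ∃ E : Finset Z, (E ⊆ ({-γ} + T).toFinset ∨ E ⊆ ((ex Z - 1) • {γ} + T).toFinset) ∧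
      MinNH E ∧ LCN E ∧ E.card = d + 2 ∧ ∃ x ∈ Q E, ¬ PP p 0 (s x) := by
    by_cases hPU : PP p 0 (s (cnt ({-γ} + T)))
    · by_cases hPV : PP p 0 (s (cnt ((ex Z - 1) • {γ} + T)))
      · exfalso
        have := hPV.add hPU.neg
        rw [hsUV, add_neg_cancel_comm] at this
        obtain ⟨q, hq, hq'⟩ := this
        simp only [pow_zero, mul_one] at hq'
        rw [ZMod.natCast_eq_zero_iff] at hq'
        exact hpp.one_lt.ne' (Nat.dvd_one.1 (hq ▸ Nat.dvd_gcd (hpe.trans hq') dvd_rfl))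
      · obtain ⟨E, hE, h4, h5, h6⟩ := exists_pmin (by omega) rfl hpp hR (hp.hS.mono hVS) hVL (hs.mono hVS)
          (cnt_mem (over_toFinset _) hV.2.1) hPV
        exact ⟨E, Or.inr hE, h4, hVL.mono hE, h5, h6⟩
    · obtain ⟨E, hE, h4, h5, h6⟩ := exists_pmin (by omega) rfl hpp hR (hp.hS.mono hUS) hUL (hs.mono hUS)
        (cnt_mem (over_toFinset _) hU.2.1) hPU
      exact ⟨E, Or.inl hE, h4, hUL.mono hE, h5, h6⟩
  obtain ⟨E, hEs, hE, hEL, hEc, x, hx, hxP⟩ := hmin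
  have nz : ∀ {y}, ¬ PP p 0 (s y) → s y ≠ 0 := by
    intro y hy h0
    rw [h0] at hy; exact hy PP.zero
  have hES : E ⊆ S := by rcases hEs with h | h; exacts [h.trans hUS, h.trans hVS]
  have notboth : γ ∈ E → -γ ∉ E := by
    intro h3 h4
    have := hEL _ (at_pair hp.ne0) (by
      intro x hx
      simp at hx
      rcases hx with rfl | rfl
      exacts [h3, h4])
    have e1 : ({γ, -γ} : Multiset Z) = {γ} + {-γ} := rfl
    rw [e1, ck_add, ck_singleton, ck_singleton, wt_ex hp.ho, wt_ex (ord_neg hp.ho)] at this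
    omega
  by_cases hg1 : γ ∈ E
  · exact ⟨γ, E, s, hp, hs, hES, hE, hEL, hEc, hg1, notboth hg1, x, hx, nz hxP⟩
  by_cases hg2 : -γ ∈ E
  · exact ⟨-γ, E, s, hp.neg, hs, hES, hE, hEL, hEc, hg2, by simpa using hg1, x, hx, nz hxP⟩
  -- E ⊆ T
  have hET : ∀ y ∈ E, y ∈ T := by
    intro y hy
    rcases hEs with h3 | h3
    · have := Multiset.mem_toFinset.1 (h3 hy)
      rw [Multiset.mem_add, Multiset.mem_singleton] at this
      exact this.resolve_left fun hc => hg2 (hc ▸ hy)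
    · have := Multiset.mem_toFinset.1 (h3 hy)
      rw [Multiset.mem_add] at this
      refine this.resolve_left fun hc => ?_
      have := Multiset.mem_of_mem_nsmul hc
      rw [Multiset.mem_singleton] at this
      exact hg1 (this ▸ hy)
  have hS' : insert γ E ⊆ ((ex Z - 1) • {γ} + T).toFinset := by
    intro y hy
    rw [Multiset.mem_toFinset]
    rcases Finset.mem_insert.1 hy with rfl | hy
    · exact hgV
    · exact Multiset.mem_add.2 (Or.inr (hET y hy))
  obtain ⟨e0, he0⟩ := hE.nonempty
  have he0g : e0 ≠ γ := fun hc => hg1 (hc ▸ he0)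
  obtain ⟨B, hB0, hB1, hB2, q, hq, y, hy, z, hz, hyz⟩ := gen_rel (S := insert γ E) (B0 := {γ}) (h := e0)
    hpp hR (Finset.mem_insert_of_mem he0)
    (by simp [he0g.symm]) (pind_single hpp hpe hp.ho _) (Q_mono (Finset.subset_insert _ _) hx)
  have fin : ∀ R : Finset Z, R ⊆ insert γ E → γ ∈ R → R.card ≤ d + 2 → ∀ w ∈ Q R, ¬ PP p 0 (s w) →
      ∃ γ E s, ME d S γ E s := by
    intro R hR1 hR2 hR3 w hw hwP
    have hRS := (hR1.trans hS').trans hVS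
    obtain ⟨F, hF, h4, h5, w', hw', hwP'⟩ := exists_pmin (by omega) rfl hpp hR (hp.hS.mono hRS)
      (hVL.mono (hR1.trans hS')) (hs.mono hRS) hw hwP
    have hFR : F = R := Finset.eq_of_subset_of_card_le hF (by omega)
    subst hFR
    refine ⟨γ, F, s, hp, hs, hRS, h4, hVL.mono (hR1.trans hS'), h5, hR2, ?_, w', hw', nz hwP'⟩
    intro hc
    rcases Finset.mem_insert.1 (hR1 hc) with h6 | h6
    · exact hp.ne h6.symm
    · exact hg2 h6
  have hins : insert e0 B ⊆ insert γ E :=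
    Finset.insert_subset (Finset.mem_insert_of_mem he0) (hB1.trans (Finset.erase_subset _ _))
  by_cases hPy : PP p 0 (s y)
  · by_cases hPz : PP p 0 (s z)
    · exfalso
      apply hxP
      apply PP.of_mul hq
      have hsE := hs.mono ((hS').trans hVS)
      rw [← hsE.nsmul (Q_mono (Finset.subset_insert _ _) hx), hyz,
        hsE.add _ _ (Q_mono hins hy) (Q_mono (Finset.erase_subset _ _) hz)]
      exact hPy.add hPz
    · refine fin _ (Finset.erase_subset e0 _) ?_ ?_ z hz hPz
      · simp [he0g.symm]
      · rw [Finset.card_erase_of_mem (Finset.mem_insert_of_mem he0), Finset.card_insert_of_notMem hg1]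
        omega
  · refine fin _ hins (Finset.mem_insert_of_mem (hB0 (by simp))) ?_ y hy hPy
    exact (Finset.card_insert_le _ _).trans (by omega)

end LinkE
end ZS

open scoped Classical
set_option linter.unusedSectionVars false

namespace ZS

section Rigid
variable {Z : Type*} [AddCommGroup Z] [Fintype Z] {κ : Type*} [Fintype κ]

def fam (h w : Z) (e : κ → Z) : Option (Option κ) → Z := fun o => o.elim h (fun o' => o'.elim w e)
def vec (c0 c1 : ℕ) (c : κ → ℕ) : Option (Option κ) → ℕ := fun o => o.elim c0 (fun o' => o'.elim c1 c)

noncomputable def M3 (h w : Z) (e : κ → Z) (c0 c1 : ℕ) (c : κ → ℕ) : Multiset Z :=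
  c0 • {h} + (c1 • {w} + ∑ i, c i • {e i})

lemma cm_fam (h w : Z) (e : κ → Z) (c0 c1 : ℕ) (c : κ → ℕ) :
    cm (fam h w e) (vec c0 c1 c) = M3 h w e c0 c1 c := by
  simp [cm, fam, vec, M3, Fintype.sum_option]

lemma dvd_small {N : ℕ} {X : ℤ} (h : (N : ℤ) ∣ X) (h1 : -(N : ℤ) < X) (h2 : X < N) : X = 0 :=
  Int.eq_zero_of_abs_lt_dvd h (abs_lt.2 ⟨h1, h2⟩)

lemma dvd_mid {N : ℕ} {X : ℤ} (h : (N : ℤ) ∣ X) (h1 : 0 < X) (h2 : X < 2 * N) : X = N := by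
  have := dvd_small (N := N) (X := X - N) (dvd_sub h (dvd_refl _)) (by linarith) (by linarith)
  linarith

lemma fam_zero {N : ℕ} {e : κ → Z} (hI : ∀ c : κ → ℤ, ∑ i, c i • e i = 0 → ∀ i, (N : ℤ) ∣ c i)
    (ht : ∀ i, (N : ℤ) • e i = 0) {h w : Z} {u : κ → ℕ} (hu : h + ∑ i, u i • e i = 0) {ε : ℤ}
    (hw : w = ε • ∑ i, e i) (v : Option (Option κ) → ℕ) :
    ∑ o, v o • fam h w e o = 0 ↔
      ∀ i, (N : ℤ) ∣ -(v none : ℤ) * u i + ε * v (some none) + v (some (some i)) := by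
  have e1 : ∑ o, v o • fam h w e o =
      ∑ i, (-(v none : ℤ) * u i + ε * v (some none) + v (some (some i))) • e i := by
    simp only [Fintype.sum_option, fam, Option.elim]
    have : h = -∑ i, u i • e i := eq_neg_of_add_eq_zero_left hu
    rw [this, hw]
    simp only [add_smul, Finset.sum_add_distrib, Finset.smul_sum, ← Finset.sum_neg_distrib]
    rw [add_assoc]
    congr 1
    · refine Finset.sum_congr rfl fun i _ => ?_
      simp only [neg_mul, neg_smul, mul_smul, natCast_zsmul, smul_neg]
    congr 1
    · refine Finset.sum_congr rfl fun i _ => ?_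
      rw [mul_comm, mul_smul, natCast_zsmul]
    · simp
  rw [e1]
  refine ⟨fun h1 => hI _ h1, fun h1 => Finset.sum_eq_zero fun i _ => ?_⟩
  obtain ⟨k, hk⟩ := h1 i
  rw [hk, mul_comm, mul_smul, ht, smul_zero]

lemma fam_at {N : ℕ} {e : κ → Z} (hI : ∀ c : κ → ℤ, ∑ i, c i • e i = 0 → ∀ i, (N : ℤ) ∣ c i)
    (ht : ∀ i, (N : ℤ) • e i = 0) {h w : Z} {u : κ → ℕ} (hu : h + ∑ i, u i • e i = 0) (ε : ℤ)
    (hw : w = ε • ∑ i, e i) (hinj : Function.Injective (fam h w e)) {c0 c1 : ℕ} {c : κ → ℕ}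
    (h0 : 0 < c0 ∨ 0 < c1)
    (hz : ∀ i, (N : ℤ) ∣ -(c0 : ℤ) * u i + ε * c1 + c i)
    (hmin : ∀ (a0 a1 : ℕ) (a : κ → ℕ), a0 ≤ c0 → a1 ≤ c1 → (∀ i, a i ≤ c i) →
      (∀ i, (N : ℤ) ∣ -(a0 : ℤ) * u i + ε * a1 + a i) →
      (a0 = 0 ∧ a1 = 0 ∧ ∀ i, a i = 0) ∨ (a0 = c0 ∧ a1 = c1 ∧ ∀ i, a i = c i)) :
    At (M3 h w e c0 c1 c) := by
  rw [← cm_fam]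
  apply cm_at hinj
  · intro hc
    have h1 := congrFun hc none
    have h2 := congrFun hc (some none)
    simp [vec] at h1 h2
    omega
  · rw [fam_zero hI ht hu hw]
    exact hz
  · intro v hv hvs
    rw [fam_zero hI ht hu hw] at hvs
    rcases hmin (v none) (v (some none)) (fun i => v (some (some i))) (hv none) (hv (some none))
      (fun i => hv (some (some i))) hvs with ⟨h1, h2, h3⟩ | ⟨h1, h2, h3⟩
    · left
      rintro (_ | _ | i)
      exacts [h1, h2, h3 i]
    · right
      rintro (_ | _ | i)
      exacts [h1, h2, h3 i]

structure Bs (d : ℕ) (S : Finset Z) (e : κ → Z) : Prop where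
  hd : 2 ≤ d
  hN : ex Z = d + 2
  hS : Struct d S
  hκ : Fintype.card κ = d + 1
  hI : ∀ c : κ → ℤ, ∑ i, c i • e i = 0 → ∀ i, (ex Z : ℤ) ∣ c i
  he : ∀ i, e i ∈ S
  hg : ∑ i, e i ∈ S
  hg' : -∑ i, e i ∈ S
  hn : ∀ i, -e i ∉ S
  ho : ∀ i, addOrderOf (e i) = ex Z

namespace Bs
variable {d : ℕ} {S : Finset Z} {e : κ → Z}

lemma ht (_ : Bs d S e) (i : κ) : (ex Z : ℤ) • e i = 0 := by
  rw [natCast_zsmul]; exact ex_smul _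

lemma ninst (b : Bs d S e) : Nonempty κ := Fintype.card_pos_iff.1 (by rw [b.hκ]; omega)

lemma inj (b : Bs d S e) : Function.Injective e := by
  intro i j hij
  by_contra hne
  have hN := b.hN
  have := b.hI (fun k => if k = i then 1 else if k = j then -1 else 0) (by
    have : ∀ k, (if k = i then (1 : ℤ) else if k = j then -1 else 0) • e k =
        (if k = i then e k else 0) + (if k = j then -e k else 0) := by
      intro k
      by_cases h1 : k = i
      · subst h1; simp [hne]
      · by_cases h2 : k = j
        · subst h2; simp [h1]
        · simp [h1, h2]
    simp only [this, Finset.sum_add_distrib, Finset.sum_ite_eq', Finset.mem_univ, if_true]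
    rw [hij]; simp) i
  simp at this
  have := Int.le_of_dvd (by norm_num) this
  omega

lemma fam_inj (b : Bs d S e) {h w : Z} (hw : w = ∑ i, e i ∨ w = -∑ i, e i) (h1 : h ≠ ∑ i, e i)
    (h2 : h ≠ -∑ i, e i) (h3 : ∀ i, h ≠ e i) : Function.Injective (fam h w e) := by
  have hwe : ∀ i, w ≠ e i := by
    rintro i hi
    apply b.hn i
    rw [← hi]
    rcases hw with rfl | rfl
    · exact b.hg'
    · rw [neg_neg]; exact b.hg
  have hwh : h ≠ w := by rcases hw with rfl | rfl <;> assumption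
  rintro (_ | _ | i) (_ | _ | j) hij <;> simp only [fam, Option.elim] at hij
  · rfl
  · exact absurd hij hwh
  · exact absurd hij (h3 _)
  · exact absurd hij.symm hwh
  · rfl
  · exact absurd hij (hwe _)
  · exact absurd hij.symm (h3 _)
  · exact absurd hij.symm (hwe _)
  · rw [b.inj hij]

lemma m3_over (b : Bs d S e) {h w : Z} (hh : h ∈ S) (hw : w ∈ S) (c0 c1 : ℕ) (c : κ → ℕ) :
    Over S (M3 h w e c0 c1 c) := by
  refine (over_pow hh _).add ((over_pow hw _).add ?_)
  intro x hx
  rw [Multiset.mem_sum] at hx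
  obtain ⟨i, _, hi⟩ := hx
  exact over_pow (b.he i) _ x hi

section H
variable {h : Z} {u : κ → ℕ}

lemma at_x0 (b : Bs d S e) (hu : h + ∑ i, u i • e i = 0) (hlt : ∀ i, u i < ex Z) {w : Z} (ε : ℤ)
    (hw : w = ε • ∑ i, e i) (hinj : Function.Injective (fam h w e)) : At (M3 h w e 1 0 u) := by
  apply fam_at b.hI b.ht hu ε hw hinj (Or.inl one_pos)
  · intro i; simp
  · intro a0 a1 a h0 h1 h2 h3
    obtain rfl : a1 = 0 := by omega
    rcases (by omega : a0 = 0 ∨ a0 = 1) with rfl | rfl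
    · left
      refine ⟨rfl, rfl, fun i => ?_⟩
      have := dvd_small (h3 i) (by have := ex_pos (Z := Z); push_cast; linarith) (by
        have := h2 i; have := hlt i; push_cast; linarith)
      push_cast at this; linarith
    · right
      refine ⟨rfl, rfl, fun i => ?_⟩
      have h4 := h2 i; have h5 := hlt i
      have := dvd_small (h3 i) (by push_cast; linarith) (by push_cast; linarith)
      push_cast at this; omega

lemma at_V (b : Bs d S e) (hu : h + ∑ i, u i • e i = 0)
    (hinj : Function.Injective (fam h (∑ i, e i) e)) {a : ℕ} (ha : 1 ≤ a) (ha' : a < ex Z) :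
    At (M3 h (∑ i, e i) e 0 a (fun _ => ex Z - a)) := by
  obtain ⟨i0⟩ := b.ninst
  apply fam_at b.hI b.ht hu 1 (by simp) hinj (Or.inr ha)
  · intro i
    rw [Nat.cast_sub ha'.le]
    refine ⟨1, by push_cast; ring⟩
  · intro a0 a1 c h0 h1 h2 h3
    obtain rfl : a0 = 0 := by omega
    have h3' : ∀ i, (ex Z : ℤ) ∣ (a1 : ℤ) + c i := fun i => by simpa using h3 i
    rcases Nat.eq_zero_or_pos a1 with rfl | hp
    · left
      refine ⟨rfl, rfl, fun i => ?_⟩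
      have h4 := h2 i
      have := dvd_small (h3' i) (by omega) (by omega)
      omega
    · right
      have h5 : ∀ i, (a1 : ℤ) + c i = ex Z := fun i => by
        have h4 := h2 i
        exact dvd_mid (h3' i) (by omega) (by omega)
      have := h5 i0
      have := h2 i0
      refine ⟨rfl, by omega, fun i => ?_⟩
      have := h5 i
      have := h2 i
      omega

lemma at_W (b : Bs d S e) (hu : h + ∑ i, u i • e i = 0)
    (hinj : Function.Injective (fam h (-∑ i, e i) e)) :
    At (M3 h (-∑ i, e i) e 0 1 (fun _ => 1)) := by
  have hN := b.hN
  apply fam_at b.hI b.ht hu (-1) (by simp) hinj (Or.inr one_pos)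
  · intro i; simp
  · intro a0 a1 c h0 h1 h2 h3
    obtain rfl : a0 = 0 := by omega
    have h5 : ∀ i, c i = a1 := fun i => by
      have h4 := h2 i
      have := dvd_small (h3 i) (by push_cast; omega) (by push_cast; omega)
      push_cast at this
      omega
    rcases (by omega : a1 = 0 ∨ a1 = 1) with rfl | rfl
    · exact Or.inl ⟨rfl, rfl, h5⟩
    · exact Or.inr ⟨rfl, rfl, h5⟩

lemma at_x (b : Bs d S e) (hu : h + ∑ i, u i • e i = 0) (hlt : ∀ i, u i < ex Z)
    (hinj : Function.Injective (fam h (∑ i, e i) e)) {a : ℕ} {i0 : κ} (hi : a ≤ u i0) :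
    At (M3 h (∑ i, e i) e 1 a (fun i => if a ≤ u i then u i - a else u i + ex Z - a)) := by
  apply fam_at b.hI b.ht hu 1 (by simp) hinj (Or.inl one_pos)
  · intro i
    have := hlt i0
    by_cases h1 : a ≤ u i
    · simp only [h1, if_true]
      refine ⟨0, ?_⟩; push_cast [h1]; ring
    · simp only [h1, if_false]
      rw [Nat.cast_sub (by omega)]
      refine ⟨1, ?_⟩; push_cast; ring
  · intro a0 a1 c h0 h1 h2 h3
    have hl0 := hlt i0
    have h20 := h2 i0
    rw [if_pos hi] at h20
    have h30 := h3 i0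
    rcases (by omega : a0 = 0 ∨ a0 = 1) with rfl | rfl
    · left
      have h4 := dvd_small h30 (by push_cast; omega) (by push_cast; omega)
      push_cast at h4
      obtain rfl : a1 = 0 := by omega
      refine ⟨rfl, rfl, fun i => ?_⟩
      have h5 := h2 i
      have h6 := hlt i
      have h7 : c i < ex Z := by split_ifs at h5 <;> omega
      have := dvd_small (h3 i) (by push_cast; omega) (by push_cast; omega)
      push_cast at this
      omega
    · right
      have h4 := dvd_small h30 (by push_cast; omega) (by push_cast; omega)
      push_cast at h4
      obtain rfl : a1 = a := by omega
      refine ⟨rfl, rfl, fun i => ?_⟩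
      have h5 := h2 i
      have h6 := hlt i
      by_cases h7 : a1 ≤ u i
      · rw [if_pos h7] at h5 ⊢
        have := dvd_small (h3 i) (by push_cast; omega) (by push_cast; omega)
        push_cast at this
        omega
      · rw [if_neg h7] at h5 ⊢
        have := dvd_mid (h3 i) (by push_cast; omega) (by push_cast; omega)
        push_cast at this
        omega

lemma at_z (b : Bs d S e) (hu : h + ∑ i, u i • e i = 0) (hlt : ∀ i, u i < ex Z)
    (hinj : Function.Injective (fam h (-∑ i, e i) e)) {c1 : ℕ} {i0 : κ} (hi : u i0 + c1 = ex Z)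
    (hp : 1 ≤ u i0) :
    At (M3 h (-∑ i, e i) e 1 c1 (fun i => if u i + c1 < ex Z then u i + c1 else u i + c1 - ex Z)) := by
  apply fam_at b.hI b.ht hu (-1) (by simp) hinj (Or.inl one_pos)
  · intro i
    by_cases h1 : u i + c1 < ex Z
    · simp only [h1, if_true]
      refine ⟨0, ?_⟩; push_cast; ring
    · simp only [h1, if_false]
      rw [Nat.cast_sub (by omega)]
      refine ⟨-1, ?_⟩; push_cast; ring
  · intro a0 a1 c h0 h1 h2 h3
    have hl0 := hlt i0
    have h20 := h2 i0
    rw [if_neg (by omega)] at h20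
    have h30 := h3 i0
    rcases (by omega : a0 = 0 ∨ a0 = 1) with rfl | rfl
    · left
      have h4 := dvd_small h30 (by push_cast; omega) (by push_cast; omega)
      push_cast at h4
      obtain rfl : a1 = 0 := by omega
      refine ⟨rfl, rfl, fun i => ?_⟩
      have h5 := h2 i
      have h6 := hlt i
      have h7 : c i < ex Z := by split_ifs at h5 <;> omega
      have := dvd_small (h3 i) (by push_cast; omega) (by push_cast; omega)
      push_cast at this
      omega
    · right
      have h4 := dvd_mid ((dvd_neg).2 h30) (by push_cast; omega) (by push_cast; omega)
      push_cast at h4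
      obtain rfl : a1 = c1 := by omega
      refine ⟨rfl, rfl, fun i => ?_⟩
      have h5 := h2 i
      have h6 := hlt i
      by_cases h7 : u i + a1 < ex Z
      · rw [if_pos h7] at h5 ⊢
        have := dvd_small (h3 i) (by push_cast; omega) (by push_cast; omega)
        push_cast at this
        omega
      · rw [if_neg h7] at h5 ⊢
        have := dvd_mid ((dvd_neg).2 (h3 i)) (by push_cast; omega) (by push_cast; omega)
        push_cast at this
        omega

/-- powers of the e_i over a filter -/
noncomputable def pw (e : κ → Z) (F : Finset κ) : Multiset (Multiset Z) :=
  ∑ i ∈ F, {ex Z • ({e i} : Multiset Z)}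

lemma pw_fac (b : Bs d S e) (F : Finset κ) : Fac (pw e F) := by
  intro A hA
  rw [pw, Multiset.mem_sum] at hA
  obtain ⟨i, _, hi⟩ := hA
  rw [Multiset.mem_singleton] at hi
  rw [hi, ← b.ho i]
  exact at_pow (ord_pos _)

lemma pw_card (F : Finset κ) : (pw e F).card = F.card := by
  rw [pw, mcard_finset]; simp

lemma pw_sum (F : Finset κ) : (pw e F).sum = ∑ i, (if i ∈ F then ex Z else 0) • ({e i} : Multiset Z) := by
  rw [pw, msum_finset]
  simp only [Multiset.sum_singleton, ite_smul, zero_smul]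
  rw [Finset.sum_ite_mem, Finset.univ_inter]

lemma X (b : Bs d S e) (hh : h ∈ S) (hu : h + ∑ i, u i • e i = 0) (hlt : ∀ i, u i < ex Z)
    (h1 : h ≠ ∑ i, e i) (h2 : h ≠ -∑ i, e i) (h3 : ∀ i, h ≠ e i) {a : ℕ} (ha : 1 ≤ a) {i0 : κ}
    (hi : a ≤ u i0) : (Finset.univ.filter fun i => a ≤ u i).card ≡ 1 [MOD d] := by
  have hinj := b.fam_inj (Or.inl rfl) h1 h2 h3
  have hl0 := hlt i0
  have := b.hS ({M3 h (∑ i, e i) e 1 0 u} + {M3 h (∑ i, e i) e 0 a (fun _ => ex Z - a)})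
    ({M3 h (∑ i, e i) e 1 a (fun i => if a ≤ u i then u i - a else u i + ex Z - a)} +
      pw e (Finset.univ.filter fun i => a ≤ u i))
    ((Fac.single (b.at_x0 hu hlt 1 (by simp) hinj)).add (Fac.single (b.at_V hu hinj ha (by omega))))
    ((Fac.single (b.at_x hu hlt hinj hi)).add (b.pw_fac _))
    (by
      rw [Multiset.sum_add, Multiset.sum_add, pw_sum]
      simp only [Multiset.sum_singleton, M3, zero_smul, zero_add, Finset.mem_filter,
        Finset.mem_univ, true_and]
      have : ∑ i, u i • ({e i} : Multiset Z) + ∑ i, (ex Z - a) • ({e i} : Multiset Z) =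
          ∑ i, (if a ≤ u i then u i - a else u i + ex Z - a) • ({e i} : Multiset Z) +
          ∑ i, (if a ≤ u i then ex Z else 0) • ({e i} : Multiset Z) := by
        rw [← Finset.sum_add_distrib, ← Finset.sum_add_distrib]
        refine Finset.sum_congr rfl fun i _ => ?_
        rw [← add_smul, ← add_smul]
        congr 1
        split_ifs <;> omega
      calc _ = 1 • {h} + a • {∑ i, e i} + (∑ i, u i • ({e i} : Multiset Z) + ∑ i, (ex Z - a) • ({e i} : Multiset Z)) := by abel
        _ = _ := by rw [this]; abel)
    (by
      rw [Multiset.sum_add, Multiset.sum_singleton, Multiset.sum_singleton]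
      exact (b.m3_over hh b.hg _ _ _).add (b.m3_over hh b.hg _ _ _))
  rw [Multiset.card_add, Multiset.card_add, pw_card] at this
  simp only [Multiset.card_singleton] at this
  exact (Nat.ModEq.add_left_cancel' 1 this).symm

lemma Zc (b : Bs d S e) (hh : h ∈ S) (hu : h + ∑ i, u i • e i = 0) (hlt : ∀ i, u i < ex Z)
    (h1 : h ≠ ∑ i, e i) (h2 : h ≠ -∑ i, e i) (h3 : ∀ i, h ≠ e i) {i0 : κ}
    (hp : 1 ≤ u i0) : ex Z - u i0 ≡ (Finset.univ.filter fun i => u i0 ≤ u i).card [MOD d] := by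
  have hinj := b.fam_inj (Or.inr rfl) h1 h2 h3
  have hl0 := hlt i0
  set c1 := ex Z - u i0 with hc1
  have := b.hS ({M3 h (-∑ i, e i) e 1 0 u} + c1 • {M3 h (-∑ i, e i) e 0 1 (fun _ => 1)})
    ({M3 h (-∑ i, e i) e 1 c1 (fun i => if u i + c1 < ex Z then u i + c1 else u i + c1 - ex Z)} +
      pw e (Finset.univ.filter fun i => u i0 ≤ u i))
    ((Fac.single (b.at_x0 hu hlt (-1) (by simp) hinj)).add ((Fac.single (b.at_W hu hinj)).nsmul _))
    ((Fac.single (b.at_z (i0 := i0) hu hlt hinj (by omega) hp)).add (b.pw_fac _))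
    (by
      rw [Multiset.sum_add, Multiset.sum_add, pw_sum, Multiset.sum_nsmul]
      simp only [Multiset.sum_singleton, M3, zero_smul, zero_add, Finset.mem_filter,
        Finset.mem_univ, true_and, one_smul]
      have : ∑ i, u i • ({e i} : Multiset Z) + ∑ i, c1 • ({e i} : Multiset Z) =
          ∑ i, (if u i + c1 < ex Z then u i + c1 else u i + c1 - ex Z) • ({e i} : Multiset Z) +
          ∑ i, (if u i0 ≤ u i then ex Z else 0) • ({e i} : Multiset Z) := by
        rw [← Finset.sum_add_distrib, ← Finset.sum_add_distrib]
        refine Finset.sum_congr rfl fun i _ => ?_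
        rw [← add_smul, ← add_smul]
        congr 1
        split_ifs <;> omega
      rw [smul_add, Finset.smul_sum]
      calc _ = {h} + c1 • {-∑ i, e i} + (∑ i, u i • ({e i} : Multiset Z) + ∑ i, c1 • ({e i} : Multiset Z)) := by abel
        _ = _ := by rw [this]; abel)
    (by
      rw [Multiset.sum_add, Multiset.sum_singleton, Multiset.sum_nsmul, Multiset.sum_singleton]
      exact (b.m3_over hh b.hg' _ _ _).add ((b.m3_over hh b.hg' _ _ _).nsmul _))
  rw [Multiset.card_add, Multiset.card_add, pw_card, Multiset.card_nsmul] at this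
  simp only [Multiset.card_singleton, mul_one] at this
  exact (Nat.ModEq.add_left_cancel' 1 this)

end H
end Bs
end Rigid
end ZS

open scoped Classical
set_option linter.unusedSectionVars false

namespace ZS

section Rigid2
variable {Z : Type*} [AddCommGroup Z] [Fintype Z] {κ : Type*} [Fintype κ]

namespace Bs
variable {d : ℕ} {S : Finset Z} {e : κ → Z} {h : Z} {u : κ → ℕ}

lemma ord_of_dvd {z : Z} (hz : ex Z ∣ addOrderOf z) : addOrderOf z = ex Z :=
  le_antisymm (ord_le_ex _) (Nat.le_of_dvd (ord_pos _) hz)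

lemma ord_g (b : Bs d S e) : addOrderOf (∑ i, e i) = ex Z := by
  obtain ⟨i0⟩ := b.ninst
  apply ord_of_dvd
  have := b.hI (fun _ => addOrderOf (∑ i, e i)) (by
    rw [← Finset.smul_sum, natCast_zsmul]; exact addOrderOf_nsmul_eq_zero _) i0
  exact_mod_cast this

lemma ord_h (b : Bs d S e) (hu : h + ∑ i, u i • e i = 0) {j : κ} (hj : u j = 1) :
    addOrderOf h = ex Z := by
  apply ord_of_dvd
  have := b.hI (fun i => addOrderOf h * u i) (by
    have h1 : addOrderOf h • (h + ∑ i, u i • e i) = 0 := by rw [hu, smul_zero]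
    rw [smul_add, addOrderOf_nsmul_eq_zero, zero_add, Finset.smul_sum] at h1
    rw [← h1]
    refine Finset.sum_congr rfl fun i _ => ?_
    rw [mul_smul, natCast_zsmul, natCast_zsmul]) j
  rw [hj] at this
  simpa [← Int.natCast_dvd_natCast] using this

lemma pr (b : Bs d S e) : Pr d S (∑ i, e i) := ⟨b.hd, b.hN, b.hS, b.hg, b.hg', b.ord_g⟩

lemma X' (b : Bs d S e) (hh : h ∈ S) (hu : h + ∑ i, u i • e i = 0) (hlt : ∀ i, u i < ex Z)
    (h1 : h ≠ ∑ i, e i) (h2 : h ≠ -∑ i, e i) (h3 : ∀ i, h ≠ e i) {a : ℕ} (ha : 1 ≤ a) {i0 : κ}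
    (hi : a ≤ u i0) : (∀ i, a ≤ u i) ∨ ∀ i, a ≤ u i → i = i0 := by
  have hX := b.X hh hu hlt h1 h2 h3 ha hi
  set F := Finset.univ.filter fun i => a ≤ u i with hF
  have hi0 : i0 ∈ F := by simp [hF, hi]
  have hpos : 0 < F.card := Finset.card_pos.2 ⟨_, hi0⟩
  have hle : F.card ≤ d + 1 := by rw [← b.hκ]; exact Finset.card_le_univ _
  obtain ⟨k, hk⟩ := (Nat.modEq_iff_dvd' hpos).1 hX.symm
  have hd := b.hd
  have hk2 : k < 2 := by
    by_contra hc
    have : d * 2 ≤ d * k := Nat.mul_le_mul_left _ (by omega)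
    omega
  rcases (by omega : k = 0 ∨ k = 1) with rfl | rfl
  · right
    intro i hia
    have : F.card ≤ 1 := by omega
    exact Finset.card_le_one.1 this _ (by simp [hF, hia]) _ hi0
  · left
    intro i
    have : F = Finset.univ := Finset.eq_univ_of_card _ (by rw [b.hκ]; omega)
    have : i ∈ F := by rw [this]; simp
    simpa [hF] using this

lemma val (b : Bs d S e) (hh : h ∈ S) (hu : h + ∑ i, u i • e i = 0) (hlt : ∀ i, u i < ex Z)
    (h1 : h ≠ ∑ i, e i) (h2 : h ≠ -∑ i, e i) (h3 : ∀ i, h ≠ e i) (i : κ) (hp : 1 ≤ u i) :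
    u i = 1 ∨ u i = ex Z - 1 := by
  have hX := (b.Zc hh hu hlt h1 h2 h3 hp).trans (b.X hh hu hlt h1 h2 h3 hp le_rfl)
  have hN := b.hN
  have hl := hlt i
  have hd := b.hd
  obtain ⟨k, hk⟩ := (Nat.modEq_iff_dvd' (by omega)).1 hX.symm
  have hk2 : k < 2 := by
    by_contra hc
    have : d * 2 ≤ d * k := Nat.mul_le_mul_left _ (by omega)
    omega
  rcases (by omega : k = 0 ∨ k = 1) with rfl | rfl <;> omega

lemma sum_single {i0 : κ} (hz : ∀ i, i ≠ i0 → u i = 0) : ∑ i, u i • e i = u i0 • e i0 := by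
  rw [Finset.sum_eq_single i0]
  · intro i _ hi; rw [hz i hi, zero_smul]
  · simp

lemma smul_pred {z : Z} : (ex Z - 1) • z = -z := by
  have : (ex Z - 1) • z + z = 0 := by
    rw [← succ_nsmul, Nat.sub_add_cancel ex_pos]; exact ex_smul _
  exact eq_neg_of_add_eq_zero_left this

lemma at_q (b : Bs d S e) (hu : h + ∑ i, u i • e i = 0)
    (hinj : Function.Injective (fam h (∑ i, e i) e)) {i0 : κ} (hi : u i0 = ex Z - 1)
    (hj : ∀ i, i ≠ i0 → u i = 1) :
    At (M3 h (∑ i, e i) e 2 2 (fun i => if i = i0 then ex Z - 4 else 0)) := by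
  have hN := b.hN
  have hd := b.hd
  obtain ⟨j, hji⟩ : ∃ j, j ≠ i0 := by
    have : 1 < Fintype.card κ := by rw [b.hκ]; omega
    exact (Fintype.exists_ne_of_one_lt_card this i0)
  have hui : (u i0 : ℤ) = ex Z - 1 := by rw [hi, Nat.cast_sub (by omega)]; simp
  apply fam_at b.hI b.ht hu 1 (by simp) hinj (Or.inl two_pos)
  · intro i
    by_cases h1 : i = i0
    · subst h1
      rw [if_pos rfl, hui, Nat.cast_sub (by omega)]
      exact ⟨-1, by push_cast; ring⟩
    · rw [if_neg h1, hj i h1]; simp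
  · intro a0 a1 a h0 h1 h2 h3
    have hj3 := h3 j
    have hj2 := h2 j
    rw [if_neg hji] at hj2
    rw [hj j hji] at hj3
    have e1 := dvd_small hj3 (by push_cast; omega) (by push_cast; omega)
    push_cast at e1
    obtain rfl : a1 = a0 := by omega
    have hi3 := h3 i0
    have hi2 := h2 i0
    rw [if_pos rfl] at hi2
    rw [hui] at hi3
    have hi4 : (ex Z : ℤ) ∣ 2 * a1 + a i0 := by
      have := dvd_add hi3 (dvd_mul_left (ex Z : ℤ) a1)
      have e2 : -(a1 : ℤ) * ((ex Z : ℤ) - 1) + 1 * a1 + a i0 + a1 * (ex Z : ℤ) = 2 * a1 + a i0 := by ring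
      rwa [e2] at this
    have hother : ∀ i, i ≠ i0 → a i = 0 := fun i hi => by
      have := h2 i; rw [if_neg hi] at this; omega
    rcases Nat.eq_zero_or_pos a1 with rfl | hp
    · left
      have := dvd_small hi4 (by push_cast; omega) (by push_cast; omega)
      refine ⟨rfl, rfl, fun i => ?_⟩
      by_cases hii : i = i0
      · subst hii; push_cast at this; omega
      · exact hother i hii
    · right
      have := dvd_mid hi4 (by push_cast; omega) (by push_cast; omega)
      refine ⟨by omega, by omega, fun i => ?_⟩
      by_cases hii : i = i0
      · subst hii; rw [if_pos rfl]; omega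
      · rw [if_neg hii]; exact hother i hii

lemma rigid (b : Bs d S e) (hh : h ∈ S) (hu : h + ∑ i, u i • e i = 0) (hlt : ∀ i, u i < ex Z) :
    h = 0 ∨ h = ∑ i, e i ∨ h = -∑ i, e i ∨ ∃ i, h = e i := by
  by_contra hcon
  push Not at hcon
  obtain ⟨h0, h1, h2, h3⟩ := hcon
  have hN := b.hN
  have hd := b.hd
  have hval := b.val hh hu hlt h1 h2 h3
  have hX := fun {a : ℕ} (ha : 1 ≤ a) {i0 : κ} (hi : a ≤ u i0) => b.X' hh hu hlt h1 h2 h3 ha hi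
  by_cases hz : ∀ i, u i = 0
  · apply h0; simpa [hz] using hu
  push Not at hz
  obtain ⟨i0, hi0⟩ := hz
  rcases hX le_rfl (Nat.one_le_iff_ne_zero.2 hi0) with hall | hone
  · by_cases h22 : ∃ i, 2 ≤ u i
    · obtain ⟨i1, hi1⟩ := h22
      rcases hX one_le_two hi1 with hall2 | hone2
      · apply h1
        have : ∀ i, u i = ex Z - 1 := fun i => by
          have := hval i (hall i); have := hall2 i; omega
        simp only [this, smul_pred, Finset.sum_neg_distrib] at hu
        exact add_neg_eq_zero.1 hu
      · have hi : u i1 = ex Z - 1 := by have := hval i1 (hall i1); omega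
        have hj : ∀ i, i ≠ i1 → u i = 1 := fun i hne => by
          have := hval i (hall i)
          by_contra hc
          exact hne (hone2 i (by have := hall i; omega))
        have hinj := b.fam_inj (Or.inl rfl) h1 h2 h3
        have hA := b.at_q hu hinj hi hj
        obtain ⟨j, hji⟩ : ∃ j, j ≠ i1 := by
          have : 1 < Fintype.card κ := by rw [b.hκ]; omega
          exact (Fintype.exists_ne_of_one_lt_card this i1)
        have hoh := b.ord_h hu (hj j hji)
        have hM : M3 h (∑ i, e i) e 2 2 (fun i => if i = i1 then ex Z - 4 else 0) =
            2 • {∑ i, e i} + (2 • {h} + (ex Z - 4) • {e i1}) := by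
          have : ∑ i, (if i = i1 then ex Z - 4 else 0) • ({e i} : Multiset Z) = (ex Z - 4) • {e i1} := by
            rw [Finset.sum_eq_single i1]
            · rw [if_pos rfl]
            · intro i _ hi; rw [if_neg hi, zero_smul]
            · simp
          rw [M3, this]; abel
        rw [hM] at hA
        have hne1 : ∑ i, e i ≠ e i1 := fun hc => b.hn i1 (by rw [← hc]; exact b.hg')
        have hne2 : -∑ i, e i ≠ e i1 := fun hc => b.hn i1 (by rw [← hc, neg_neg]; exact b.hg)
        have := b.pr.rule le_rfl (by omega) hA ((over_pow hh _).add (over_pow (b.he _) _))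
          (by
            intro hm
            rcases Multiset.mem_add.1 hm with hm | hm
            · exact h1 (Multiset.mem_singleton.1 (Multiset.mem_of_mem_nsmul hm)).symm
            · exact hne1 (Multiset.mem_singleton.1 (Multiset.mem_of_mem_nsmul hm)))
          (by
            intro hm
            rcases Multiset.mem_add.1 hm with hm | hm
            · exact h2 (Multiset.mem_singleton.1 (Multiset.mem_of_mem_nsmul hm)).symm
            · exact hne2 (Multiset.mem_singleton.1 (Multiset.mem_of_mem_nsmul hm)))
        rw [ck_add, ck_add, ck_nsmul, ck_nsmul, ck_nsmul, ck_singleton, ck_singleton, ck_singleton,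
          wt_ex hoh, wt_ex b.ord_g, wt_ex (b.ho i1)] at this
        have : 2 * 2 ≤ d * (ex Z - 2) := Nat.mul_le_mul hd (by omega)
        omega
    · push Not at h22
      apply h2
      have : ∀ i, u i = 1 := fun i => by have := h22 i; have := hall i; omega
      simp only [this, one_smul] at hu
      exact eq_neg_of_add_eq_zero_left hu
  · have hs : ∑ i, u i • e i = u i0 • e i0 := sum_single fun i hi => by
      by_contra hc
      exact hi (hone i (Nat.one_le_iff_ne_zero.2 hc))
    rw [hs] at hu
    rcases hval i0 (Nat.one_le_iff_ne_zero.2 hi0) with hv | hv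
    · rw [hv, one_smul] at hu
      apply b.hn i0
      rw [← eq_neg_of_add_eq_zero_left hu]; exact hh
    · rw [hv, smul_pred] at hu
      exact h3 i0 (add_neg_eq_zero.1 hu)

end Bs

lemma rep_of_indep {N t : ℕ} [NeZero N] {e : Fin t → Z}
    (hI : ∀ c : Fin t → ℤ, ∑ i, c i • e i = 0 → ∀ i, (N : ℤ) ∣ c i)
    (hc : Fintype.card Z ≤ N ^ t) (h : Z) :
    ∃ u : Fin t → ℕ, (∀ i, u i < N) ∧ h + ∑ i, u i • e i = 0 := by
  let f : (Fin t → Fin N) → Z := fun v => ∑ i, (v i : ℕ) • e i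
  have hf : Function.Injective f := by
    intro v w hvw
    have := hI (fun i => (v i : ℤ) - w i) (by
      simp only [sub_smul, Finset.sum_sub_distrib, natCast_zsmul]
      exact sub_eq_zero.2 hvw)
    funext i
    have h1 := (v i).2
    have h2 := (w i).2
    have := dvd_small (this i) (by omega) (by omega)
    exact Fin.ext (by omega)
  have hb : Function.Bijective f := (Fintype.bijective_iff_injective_and_card f).2 ⟨hf, by
    apply le_antisymm (Fintype.card_le_of_injective f hf)
    simpa using hc⟩
  obtain ⟨v, hv⟩ := hb.2 (-h)
  exact ⟨fun i => v i, fun i => (v i).2, by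
    change h + f v = 0
    rw [hv]; simp⟩

lemma ME.bs {d : ℕ} {S E : Finset Z} {g : Z} {s : (Z → ℤ) → ZMod (ex Z)} (m : ME d S g E s) :
    ∃ e : Fin (d + 1) → Z, Bs d S e := by
  obtain ⟨V, hV, ho, hc, hk, h1, h2⟩ := m.basis
  have hcard : (E.erase g).card = d + 1 := by rw [Finset.card_erase_of_mem m.hgE, m.hc]; rfl
  let q := (Finset.equivFinOfCardEq hcard).symm
  let e : Fin (d + 1) → Z := fun i => (q i : Z)
  have hmem : ∀ i, e i ∈ E.erase g := fun i => (q i).2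
  have hinj : Function.Injective e := fun i j hij => q.injective (Subtype.ext hij)
  have hsum : ∀ f : Z → Z, ∑ i, f (e i) = ∑ z ∈ E.erase g, f z := by
    intro f
    rw [← Finset.sum_coe_sort (E.erase g) f]
    exact Equiv.sum_comp q (fun z => f z)
  have hge : ∑ i, e i = g := by rw [h2]; exact hsum id
  refine ⟨e, m.pr.hd, m.pr.hN, m.pr.hS, by simp, ?_, fun i => m.hES (Finset.mem_of_mem_erase (hmem i)),
    by rw [hge]; exact m.pr.hg, by rw [hge]; exact m.pr.hg', fun i => m.no_neg (hmem i),
    fun i => (h1 _ (hmem i)).2⟩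
  intro c hcz i
  have := m.indep (x := Function.extend e c 0) (by
    rw [mem_Q]
    constructor
    · intro z hz
      rw [Function.extend_apply']
      · rfl
      · rintro ⟨i, rfl⟩; exact hz (hmem i)
    · rw [← hcz]
      rw [← Finset.sum_subset (Finset.subset_univ (E.erase g))]
      · rw [← hsum (fun z => Function.extend e c 0 z • z)]
        refine Finset.sum_congr rfl fun i _ => ?_
        rw [hinj.extend_apply]
      · intro z _ hz
        rw [Function.extend_apply']
        · simp
        · rintro ⟨i, rfl⟩; exact hz (hmem i)) (e i) (hmem i)
  rwa [hinj.extend_apply] at this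

lemma linked {d : ℕ} {S : Finset Z} {g : Z} (h : Pr d S g) (hR : RkLe (d + 1) Z)
    {A : Multiset Z} (hA : At A) (ho : Over S A) (hm : g ∈ A)
    (h1 : A ≠ ex Z • {g}) (h2 : A ≠ {g, -g}) :
    ∃ e : Fin (d + 1) → Z, Ind (ex Z) e ∧ S ⊆ insert 0 (Finset.univ.image (std3 e)) := by
  obtain ⟨γ, E, s, m⟩ := h.exists_ME hR hA ho hm h1 h2
  obtain ⟨e, b⟩ := m.bs
  have : NeZero (ex Z) := ⟨(ex_pos (Z := Z)).ne'⟩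
  refine ⟨e, ind_of_int (fun i => ex_smul _) b.hI, fun x hx => ?_⟩
  obtain ⟨u, hu1, hu2⟩ := rep_of_indep b.hI (card_le_of_rk hR) x
  rw [Finset.mem_insert, Finset.mem_image]
  rcases b.rigid hx hu2 hu1 with h | h | h | ⟨i, h⟩
  · exact Or.inl h
  · exact Or.inr ⟨some none, by simp, by simp [std3, std, h]⟩
  · exact Or.inr ⟨none, by simp, by simp [std3, h]⟩
  · exact Or.inr ⟨some (some i), by simp, by simp [std3, std, h]⟩

end Rigid2
end ZS

open scoped Classical
set_option linter.unusedSectionVars false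

namespace ZS

section Main
variable {Z : Type*} [AddCommGroup Z] [Fintype Z]

lemma U_main {d : ℕ} (hd : 2 ≤ d) (hN : ex Z = d + 2) (hR : RkLe (d + 1) Z) {β : ℝ}
    (h1 : 1 ≤ β) (h2 : (ex Z : ℝ) / 2 ≤ β)
    (Hβ : ∀ A : Multiset Z, At A → Struct d A.toFinset → crossNum A ≤ β)
    (h3 : (∃ e : Fin (d + 1) → Z, Ind (ex Z) e) → (d : ℝ) + 3 / (ex Z : ℝ) ≤ β) : Bd Z d β := by
  refine bd_of_weights (by linarith) fun S hS => ?_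
  by_cases hl : ∀ g ∈ S, -g ∈ S → addOrderOf g = ex Z → ∀ A, At A → Over S A → g ∈ A →
      A = ex Z • {g} ∨ A = {g, -g}
  · exact weights_unlinked hS hN h2 h1 Hβ hl
  · push Not at hl
    obtain ⟨g, hg, hg', ho, A, hA, hAo, hgA, n1, n2⟩ := hl
    obtain ⟨e, he, hSe⟩ := linked ⟨hd, hN, hS, hg, hg', ho⟩ hR hA hAo hgA n1 n2
    refine weights_linked he (by omega) (by simp [hN]) ?_ hSe
    have := h3 ⟨e, he⟩
    have hNr : (ex Z : ℝ) = d + 2 := by exact_mod_cast hN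
    linarith

lemma struct_finite (d : ℕ) : {A : Multiset Z | At A ∧ Struct d A.toFinset}.Finite :=
  (at_finite (Z := Z)).subset fun _ hA => hA.1

lemma exists_max (d : ℕ) : (∀ A : Multiset Z, At A → Struct d A.toFinset → False) ∨
    ∃ A : Multiset Z, At A ∧ Struct d A.toFinset ∧
      ∀ B : Multiset Z, At B → Struct d B.toFinset → crossNum B ≤ crossNum A := by
  by_cases h : {A : Multiset Z | At A ∧ Struct d A.toFinset}.Nonempty
  · right
    obtain ⟨A, hA, hm⟩ := Set.exists_max_image _ crossNum (struct_finite (Z := Z) d) h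
    exact ⟨A, hA.1, hA.2, fun B h1 h2 => hm B ⟨h1, h2⟩⟩
  · left
    intro A h1 h2
    exact h ⟨A, h1, h2⟩

lemma gap {d : ℕ} {κ : ℝ} (h : ∀ A : Multiset Z, At A → Struct d A.toFinset → crossNum A < κ) :
    ∃ β < κ, ∀ A : Multiset Z, At A → Struct d A.toFinset → crossNum A ≤ β := by
  rcases exists_max (Z := Z) d with h1 | ⟨A, h1, h2, h3⟩
  · exact ⟨κ - 1, by linarith, fun A hA hS => (h1 A hA hS).elim⟩
  · exact ⟨crossNum A, h A h1 h2, h3⟩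

lemma Bd.cross {d : ℕ} {β : ℝ} (hb : Bd Z d β) {A : Multiset Z} (hA : At A)
    (hS : Struct d A.toFinset) : crossNum A ≤ β := by
  have h1 := hb.ck hA hS
  rw [ck_real] at h1
  have hp := ex_pos_real (Z := Z)
  nlinarith

lemma lcn_max {d : ℕ} (hd : 2 ≤ d) (hN : ex Z ≤ d + 2) {A : Multiset Z} (hA : At A)
    (hS : Struct d A.toFinset) (h1 : 1 ≤ crossNum A) : LCN A.toFinset := by
  rcases Nat.lt_or_ge (ex Z) (d + 2) with h | h
  · exact lcn_of_large (by omega) hS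
  have hN : ex Z = d + 2 := by omega
  intro B hB hBo
  by_contra hc
  push Not at hc
  obtain ⟨x, hx, hxo⟩ := (ck_small hS hB hBo hc).2 hN
  have m1 : x ∈ A := Multiset.mem_toFinset.1 (hBo x (by simp [hx]))
  have m2 : -x ∈ A := Multiset.mem_toFinset.1 (hBo (-x) (by simp [hx]))
  have := hA.neg_pair m1 m2 (ne_neg hxo (by omega))
  rw [one_le_cross, this, ← hx] at h1
  omega

lemma embed_of_atom {d n s : ℕ} (hd : 2 ≤ d) (hn : 0 < n) (hR : RkLe (d + 1) Z) (hN : ex Z ≤ d + 2)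
    (hg : Nat.gcd s n = 1) {A : Multiset Z} (hA : At A) (hS : Struct d A.toFinset)
    (hk : crossNum A = 1 + (s : ℝ) * d / n) :
    ∃ f : (Fin (d + 1) → ZMod n) →+ Z, Function.Injective f := by
  have hn' : (0 : ℝ) < n := by exact_mod_cast hn
  have hL : LCN A.toFinset := lcn_max hd hN hA hS (by rw [hk]; have : 0 ≤ (s : ℝ) * d / n := by positivity
                                                      linarith)
  refine embed_from hn hR (lemmaP (s0 := s) (by omega) rfl hR hA hS hL hn ?_ hg)
  have h1 := ck_real A
  rw [hk] at h1
  have : (ck A : ℝ) * n = ex Z * (n + s * d) := by rw [h1]; field_simp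
  exact_mod_cast this

lemma arith1 {d M σ : ℕ} (hd : 1 ≤ d) (hM : 1 ≤ M) (hMd : M ≤ d + 1)
    (h : ((d : ℝ) + 2) ^ 2 - (d + 2) + 1 ≤ (1 + (σ : ℝ) * d / M) * (d + 2 + 1)) :
    (1 : ℝ) + d ≤ 1 + (σ : ℝ) * d / M := by
  have hM0 : (0 : ℝ) < M := by exact_mod_cast hM
  have hd0 : (1 : ℝ) ≤ d := by exact_mod_cast hd
  have hMd' : (M : ℝ) ≤ d + 1 := by exact_mod_cast hMd
  have hσ : M ≤ σ := by
    by_contra hc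
    have : (σ : ℝ) + 1 ≤ M := by exact_mod_cast (by omega : σ + 1 ≤ M)
    have e1 : (σ : ℝ) * d / M ≤ d - d / (d + 1) := by
      have e2 : (σ : ℝ) * d / M ≤ (M - 1) * d / M := by
        apply div_le_div_of_nonneg_right _ hM0.le
        nlinarith
      have e3 : ((M : ℝ) - 1) * d / M = d - d / M := by field_simp
      have e4 : (d : ℝ) / (d + 1) ≤ d / M := div_le_div_of_nonneg_left (by linarith) hM0 hMd'
      linarith
    have e5 : (d : ℝ) / (d + 1) * (d + 1) = d := by field_simp
    set q := (d : ℝ) / (d + 1)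
    set w := (σ : ℝ) * d / M
    have e6 : (1 + w) * (d + 2 + 1) ≤ (1 + (d - q)) * (d + 3) := by nlinarith
    have e7 : ((d : ℝ) + 2) ^ 2 - (d + 2) + 1 ≤ (1 + d - q) * (d + 3) := by linarith
    have : 2 * q ≤ 1 + d - d - 0 + 0 := by nlinarith
    nlinarith
  have : (M : ℝ) ≤ σ := by exact_mod_cast hσ
  have : (d : ℝ) ≤ (σ : ℝ) * d / M := by
    rw [le_div_iff₀ hM0]; nlinarith
  linarith

end Main
end ZS

open scoped Classical
set_option linter.unusedSectionVars false

namespace ZS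

section Cyc
variable {Z : Type*} [AddCommGroup Z] [Fintype Z]

lemma cyc_rep {a : Z} (ha : addOrderOf a = Fintype.card Z) (b : Z) : ∃ x < addOrderOf a, b = x • a := by
  have h : AddSubgroup.zmultiples a = ⊤ := by
    apply AddSubgroup.eq_top_of_card_eq
    rw [Nat.card_zmultiples, ha, Nat.card_eq_fintype_card]
  have hb : b ∈ AddSubgroup.zmultiples a := by rw [h]; trivial
  have hb' : b ∈ AddSubmonoid.multiples a := by
    rwa [mem_multiples_iff_mem_zmultiples]
  obtain ⟨x, hx⟩ := hb'
  refine ⟨x % addOrderOf a, Nat.mod_lt _ (ord_pos _), ?_⟩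
  rw [mod_addOrderOf_nsmul]; exact hx.symm

/-- `b · a^j` is an atom when `b = x a`, `x + j = ord a`. -/
lemma at_ab {a b : Z} {x j : ℕ} (hx : 0 < x) (hxj : x + j = addOrderOf a) (hb : b = x • a)
    (hne : b ≠ a) : At (({b} : Multiset Z) + j • {a}) := by
  refine ⟨by simp, ?_, ?_⟩
  · rw [Multiset.sum_add, Multiset.sum_singleton, Multiset.sum_nsmul, Multiset.sum_singleton, hb,
      ← add_smul, hxj]; exact addOrderOf_nsmul_eq_zero _
  · intro T hT hs
    have hca : T.count a ≤ j := by
      have := Multiset.count_le_of_le a hT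
      simpa [Multiset.count_singleton, Ne.symm hne] using this
    have hcb : T.count b ≤ 1 := by
      have := Multiset.count_le_of_le b hT
      simpa [Multiset.count_singleton, hne] using this
    have hT' : T = T.count b • {b} + T.count a • {a} := by
      ext z
      by_cases h1 : z = b
      · subst h1; simp [Multiset.count_singleton, hne]
      by_cases h2 : z = a
      · subst h2; simp [Multiset.count_singleton, Ne.symm hne]
      have : T.count z = 0 := by
        rw [Multiset.count_eq_zero]
        intro hz
        have := Multiset.mem_of_le hT hz
        rw [Multiset.mem_add] at this
        rcases this with h | h
        · exact h1 (Multiset.mem_singleton.1 h)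
        · exact h2 (Multiset.mem_singleton.1 (Multiset.mem_of_mem_nsmul h))
      rw [this]; simp [Multiset.count_singleton, h1, h2]
    rw [hT', Multiset.sum_add, Multiset.sum_nsmul, Multiset.sum_nsmul, Multiset.sum_singleton,
      Multiset.sum_singleton, hb, ← mul_smul, ← add_smul] at hs
    rw [← hb] at hs
    have hd := addOrderOf_dvd_of_nsmul_eq_zero hs
    rcases (by omega : T.count b = 0 ∨ T.count b = 1) with h | h
    · left
      rw [h, zero_mul, zero_add] at hd
      have := Nat.eq_zero_of_dvd_of_lt hd (by omega)
      rw [hT', h, this]; simp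
    · right
      rw [h, one_mul] at hd
      have := Nat.le_of_dvd (by omega) hd
      rw [hT', h, (by omega : T.count a = j), one_smul]

lemma cyc_two {d0 : ℕ} (hd : 2 ≤ d0) (hN : ex Z = d0 + 3) (hc : Fintype.card Z = ex Z)
    {S : Finset Z} (hS : Struct d0 S) {a b : Z} (ha : a ∈ S) (hb : b ∈ S)
    (hoa : addOrderOf a = ex Z) (hob : addOrderOf b = ex Z) : b = a ∨ b = -(2 • a) := by
  by_cases hne : b = a
  · exact Or.inl hne
  right
  obtain ⟨x, hx, hxb⟩ := cyc_rep (by rw [hoa, hc]) b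
  have hx0 : 0 < x := by
    rcases Nat.eq_zero_or_pos x with h | h
    · rw [h, zero_smul] at hxb
      rw [hxb, addOrderOf_zero] at hob; omega
    · exact h
  have hA := at_ab hx0 (j := addOrderOf a - x) (by omega) hxb hne
  obtain ⟨σ, hσ⟩ := hS.atom hA (by
    intro z hz
    rw [Multiset.mem_add] at hz
    rcases hz with h | h
    · rwa [Multiset.mem_singleton.1 h]
    · rwa [Multiset.mem_singleton.1 (Multiset.mem_of_mem_nsmul h)])
  rw [ck_add, ck_nsmul, ck_singleton, ck_singleton, wt_ex hoa, wt_ex hob] at hσ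
  rw [hoa] at hσ hx
  push_cast [hx.le] at hσ
  have hx1 : x ≠ 1 := by rintro rfl; rw [one_smul] at hxb; exact hne hxb
  have e : (x : ℤ) - 1 = d0 * (-σ) := by linarith
  have s1 : -σ < 2 := by
    by_contra hcon
    push Not at hcon
    have : (d0 : ℤ) * 2 ≤ d0 * (-σ) := mul_le_mul_of_nonneg_left hcon (by positivity)
    omega
  have s0 : 0 < -σ := by
    by_contra hcon
    push Not at hcon
    have : (d0 : ℤ) * (-σ) ≤ 0 := mul_nonpos_of_nonneg_of_nonpos (by positivity) hcon
    omega
  have s2 : -σ = 1 := by omega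
  rw [s2] at e
  have hx2 : x + 2 = ex Z := by omega
  have : b + 2 • a = 0 := by
    rw [hxb, ← add_smul, hx2]; exact ex_smul _
  exact eq_neg_of_add_eq_zero_left this

lemma cyc_lcn {d0 : ℕ} (hd : 2 ≤ d0) (hN : ex Z = d0 + 3) (hc : Fintype.card Z = ex Z)
    {S : Finset Z} (hS : Struct d0 S) : LCN S := by
  intro A hA ho
  by_contra hcon
  push Not at hcon
  obtain ⟨σ, hσ⟩ := hS.atom hA ho
  have hc2 : 2 ≤ A.card := hA.two_le_card (by
    rintro rfl
    simp [wt, ck_singleton] at hcon)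
  have hcc := card_le_ck A
  have s1 : σ = -1 := by
    by_contra hne
    have h1 : σ < 0 := by
      by_contra h; push Not at h
      have : 0 ≤ (d0 : ℤ) * σ := by positivity
      omega
    have h2 : (d0 : ℤ) * σ ≤ d0 * (-2) := mul_le_mul_of_nonneg_left (by omega) (by positivity)
    omega
  have hk : ck A = 3 := by rw [s1] at hσ; omega
  have key : ∀ a ∈ A, ∀ b ∈ A, addOrderOf a = ex Z → addOrderOf b = ex Z → a = b := by
    intro a ha b hb h1 h2
    have h3a : 3 • a ≠ 0 := fun h => by
      have := Nat.le_of_dvd (by norm_num) (addOrderOf_dvd_of_nsmul_eq_zero h); omega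
    rcases cyc_two hd hN hc hS (ho a ha) (ho b hb) h1 h2 with h | h
    · exact h.symm
    rcases cyc_two hd hN hc hS (ho b hb) (ho a ha) h2 h1 with h' | h'
    · exact h'
    · exfalso; apply h3a
      have : a = 4 • a := by
        conv_lhs => rw [h', h]
        simp only [smul_neg, neg_neg, ← mul_smul]; norm_num
      have e : 3 • a + a = 0 + a := by rw [← succ_nsmul, zero_add]; exact this.symm
      exact add_right_cancel e
  rcases (by omega : A.card = 2 ∨ A.card = 3) with h | h
  · obtain ⟨a, b, rfl⟩ := Multiset.card_eq_two.1 h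
    have hs := hA.2.1
    simp at hs
    have hb : b = -a := (neg_eq_of_add_eq_zero_right hs).symm
    have hw : wt b = wt a := by rw [hb, wt, wt, addOrderOf_neg]
    have : ck ({a, b} : Multiset Z) = wt a + wt b := by simp [Multiset.insert_eq_cons]
    omega
  · obtain ⟨a, b, c, rfl⟩ := Multiset.card_eq_three.1 h
    have hck : ck ({a, b, c} : Multiset Z) = wt a + (wt b + wt c) := by simp [Multiset.insert_eq_cons]
    have wa := wt_pos a
    have wb := wt_pos b
    have wc := wt_pos c
    have hord : ∀ z : Z, wt z = 1 → addOrderOf z = ex Z := fun z hz => by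
      have := ord_mul_wt z; rw [hz, mul_one] at this; exact this
    have oa := hord a (by omega)
    have ob := hord b (by omega)
    have oc := hord c (by omega)
    have e1 := key a (by simp) b (by simp) oa ob
    have e2 := key a (by simp) c (by simp) oa oc
    have hs := hA.2.1
    rw [← e1, ← e2] at hs
    simp at hs
    have h3 : 3 • a = 0 := by rw [← hs]; abel
    have := Nat.le_of_dvd (by norm_num) (addOrderOf_dvd_of_nsmul_eq_zero h3)
    omega

lemma cyc_bd {d0 : ℕ} (hd : 2 ≤ d0) (hN : ex Z = d0 + 3) (hc : Fintype.card Z = ex Z) : Bd Z d0 1 := by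
  apply bd_hf
  intro S hS
  refine hf_of_rank (r := 1) (by omega) (by omega) ?_ (by omega) hS (cyc_lcn hd hN hc hS)
  intro p hp
  obtain ⟨a, ha⟩ := exists_ord_ex (Z := Z)
  have : IsAddCyclic Z := ⟨a, fun b => by
    obtain ⟨x, _, hx⟩ := cyc_rep (by rw [ha, hc]) b
    rw [hx]; exact nsmul_mem (AddSubgroup.mem_zmultiples a) x⟩
  rw [pow_one]
  exact IsAddCyclic.card_nsmul_eq_zero_le hp.pos

/-! ### order four -/

lemma four_eq (hc : Fintype.card Z = 4) {a b : Z} {R : Multiset Z} (hA : At (a ::ₘ b ::ₘ R))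
    (hR : R.card = 2) : b = a := by
  obtain ⟨c, e, rfl⟩ := Multiset.card_eq_two.1 hR
  have hns : ∀ T : Multiset Z, T ≤ (a ::ₘ b ::ₘ {c, e}) → T ≠ 0 → T.card < 4 → T.sum ≠ 0 := by
    intro T hT h0 hcT hs
    rcases hA.2.2 T hT hs with h | h
    · exact h0 h
    · rw [h] at hcT; simp at hcT
  have n1 : a ≠ 0 := by simpa using hns {a} (by simp) (by simp) (by simp)
  have n2 : b ≠ 0 := by simpa using hns {b} (by simp) (by simp) (by simp)
  have n3 : c ≠ 0 := by simpa using hns {c} (by simp) (by simp) (by simp)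
  have n4 : a + b ≠ 0 := by
    simpa using hns (a ::ₘ b ::ₘ 0) (by simp) (by simp) (by simp)
  have n5 : a + c ≠ 0 := by
    simpa using hns (a ::ₘ c ::ₘ 0) (by
      rw [Multiset.cons_le_cons_iff]; 
      exact Multiset.singleton_le.2 (by simp)) (by simp) (by simp)
  have n6 : b + c ≠ 0 := by
    simpa using hns (b ::ₘ c ::ₘ 0) (by
      refine le_trans ?_ (Multiset.le_cons_self _ a)
      rw [Multiset.cons_le_cons_iff]; 
      exact Multiset.singleton_le.2 (by simp)) (by simp) (by simp)
  have n7 : a + b + c ≠ 0 := by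
    have := hns (a ::ₘ b ::ₘ c ::ₘ 0) (by
      rw [Multiset.cons_le_cons_iff, Multiset.cons_le_cons_iff]
      exact Multiset.singleton_le.2 (by simp)) (by simp) (by simp)
    simpa [add_assoc] using this
  have hu : ({0, a, a + b, a + b + c} : Finset Z) = Finset.univ := by
    apply Finset.eq_univ_of_card
    rw [hc, Finset.card_insert_of_notMem, Finset.card_insert_of_notMem, Finset.card_insert_of_notMem,
      Finset.card_singleton]
    · simp [n3]
    · simp only [Finset.mem_insert, Finset.mem_singleton, not_or]
      exact ⟨by simpa using n2, by rw [add_assoc]; simpa using n6⟩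
    · simp only [Finset.mem_insert, Finset.mem_singleton, not_or]
      exact ⟨n1.symm, n4.symm, n7.symm⟩
  have hb : b ∈ ({0, a, a + b, a + b + c} : Finset Z) := by rw [hu]; simp
  simp only [Finset.mem_insert, Finset.mem_singleton] at hb
  rcases hb with h | h | h | h
  · exact (n2 h).elim
  · exact h
  · exact (n1 (by simpa using h)).elim
  · exfalso; apply n5
    have : b + (a + c) = b + 0 := by rw [add_zero]; nth_rw 2 [h]; abel
    exact add_left_cancel this

lemma four_pow (hc : Fintype.card Z = 4) {A : Multiset Z} (hA : At A) (h4 : A.card = 4) :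
    ∃ h, A = 4 • {h} := by
  obtain ⟨a, ha⟩ := Multiset.card_pos_iff_exists_mem.1 (by omega : 0 < A.card)
  obtain ⟨R, rfl⟩ := Multiset.exists_cons_of_mem ha
  have hR : R.card = 3 := by simpa using h4
  refine ⟨a, ?_⟩
  rw [Multiset.nsmul_singleton, Multiset.replicate_succ]
  congr 1
  rw [Multiset.eq_replicate]
  refine ⟨hR, fun b hb => ?_⟩
  obtain ⟨R', rfl⟩ := Multiset.exists_cons_of_mem hb
  exact four_eq hc hA (by simpa using hR)

lemma card_le_of_fac {f : Multiset (Multiset Z)} {D : ℕ} (hf : ∀ A ∈ f, A.card ≤ D) :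
    f.sum.card ≤ D * f.card := by
  induction f using Multiset.induction with
  | empty => simp
  | cons A f ih =>
    have h1 := hf A (by simp)
    have h2 := ih fun B hB => hf B (by simp [hB])
    simp only [Multiset.sum_cons, Multiset.card_add, Multiset.card_cons]
    nlinarith

lemma all_eq {f : Multiset (Multiset Z)} (hf : ∀ A ∈ f, A.card ≤ 4) (h : f.sum.card = 4 * f.card) :
    ∀ A ∈ f, A.card = 4 := by
  intro A hA
  obtain ⟨g, rfl⟩ := Multiset.exists_cons_of_mem hA
  have h1 := hf A (by simp)
  have h2 := card_le_of_fac (f := g) (D := 4) fun B hB => hf B (by simp [hB])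
  simp only [Multiset.sum_cons, Multiset.card_add, Multiset.card_cons] at h
  omega

lemma all_eq2 {f : Multiset (Multiset Z)} (hf : Fac f) (h0 : (0 : Z) ∉ f.sum)
    (h : f.sum.card = 2 * f.card) : ∀ A ∈ f, A.card = 2 := by
  intro A hA
  obtain ⟨g, rfl⟩ := Multiset.exists_cons_of_mem hA
  rw [Multiset.sum_cons, Multiset.mem_add, not_or] at h0
  have h1 := (hf A (by simp)).two_le_card (by rintro rfl; simp at h0)
  have h2 := card_ge_of_fac (f := g) (fun B hB => hf B (by simp [hB])) h0.2
  simp only [Multiset.sum_cons, Multiset.card_add, Multiset.card_cons] at h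
  omega

lemma count_dvd {f : Multiset (Multiset Z)} {x : Z} {m : ℕ} (hf : ∀ A ∈ f, m ∣ A.count x) :
    m ∣ f.sum.count x := by
  induction f using Multiset.induction with
  | empty => simp
  | cons A f ih =>
    rw [Multiset.sum_cons, Multiset.count_add]
    exact dvd_add (hf A (by simp)) (ih fun B hB => hf B (by simp [hB]))

lemma count_one {f : Multiset (Multiset Z)} {x : Z} (hf : ∀ A ∈ f, A.count x = 1) :
    f.sum.count x = f.card := by
  induction f using Multiset.induction with
  | empty => simp
  | cons A f ih =>
    rw [Multiset.sum_cons, Multiset.count_add, hf A (by simp), ih fun B hB => hf B (by simp [hB]),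
      Multiset.card_cons, add_comm]

lemma four_no (hc : Fintype.card Z = 4) (hD : davenport Z ≤ 4) {f f' : Multiset (Multiset Z)}
    (hf : Fac f) (hf' : Fac f') (h3 : f.card = 3) (h6 : f'.card = 6) (h0 : (0 : Z) ∉ f.sum)
    (he : f.sum = f'.sum) : False := by
  have hb : ∀ A ∈ f, A.card ≤ 4 := fun A hA => (hf A hA).card_le_dav.trans hD
  have h1 := card_le_of_fac hb
  have h2 := card_ge_of_fac hf' (by rwa [← he])
  rw [← he] at h2
  have h12 : f.sum.card = 12 := by omega
  have hall := all_eq hb (by omega)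
  have hall2 := all_eq2 hf' (by rwa [← he]) (by rw [← he]; omega)
  have hpow : ∀ A ∈ f, ∃ h, A = 4 • {h} := fun A hA => four_pow hc (hf A hA) (hall A hA)
  have hord : ∀ h : Z, At (4 • ({h} : Multiset Z)) → addOrderOf h = 4 := by
    intro h hA
    have h4 : 4 • h = 0 := by rw [← hc]; exact card_nsmul_eq_zero
    have hle := Nat.le_of_dvd (by norm_num) (addOrderOf_dvd_of_nsmul_eq_zero h4)
    have := hA.eq_pow (h := h) (by simpa using hle)
    have := congrArg Multiset.card this
    simp at this
    omega
  obtain ⟨A0, hA0⟩ := Multiset.card_pos_iff_exists_mem.1 (by omega : 0 < f.card)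
  obtain ⟨g, rfl⟩ := hpow A0 hA0
  have hg := hord g (hf _ hA0)
  have hgg : g ≠ -g := by
    intro h
    have : 2 • g = 0 := by rw [two_nsmul]; nth_rw 2 [h]; simp
    have := Nat.le_of_dvd (by norm_num) (addOrderOf_dvd_of_nsmul_eq_zero this)
    omega
  have hmem : ∀ x ∈ f.sum, x = g ∨ x = -g := by
    intro x hx
    obtain ⟨A, hA, hxA⟩ := Multiset.mem_join.1 hx
    obtain ⟨h, rfl⟩ := hpow A hA
    obtain rfl := Multiset.mem_singleton.1 (Multiset.mem_of_mem_nsmul hxA)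
    have ho := hord x (hf _ hA)
    obtain ⟨j, hj, rfl⟩ := cyc_rep (by rw [hg, hc]) x
    rw [hg] at hj
    have h4 : 4 • g = 0 := by rw [← hg]; exact addOrderOf_nsmul_eq_zero g
    interval_cases j
    · simp at ho
    · left; simp
    · exfalso
      have : 2 • (2 • g) = 0 := by rw [← mul_smul]; exact h4
      have := Nat.le_of_dvd (by norm_num) (addOrderOf_dvd_of_nsmul_eq_zero this)
      omega
    · right
      apply eq_neg_of_add_eq_zero_left
      rw [← succ_nsmul]; exact h4
  have hc1 : f'.sum.count g = f'.card := count_one fun A hA => by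
    obtain ⟨a, b, rfl⟩ := Multiset.card_eq_two.1 (hall2 A hA)
    have hs := (hf' _ hA).2.1
    simp at hs
    have hb : b = -a := (neg_eq_of_add_eq_zero_right hs).symm
    have ham : a ∈ f.sum := by
      rw [he]; exact Multiset.mem_join.2 ⟨_, hA, by simp⟩
    rcases hmem a ham with rfl | rfl
    · rw [hb]; simp [hgg, Multiset.insert_eq_cons, Multiset.count_cons]
    · rw [hb]; simp [hgg, Multiset.insert_eq_cons, Multiset.count_cons]
  have hc2 : 4 ∣ f.sum.count g := count_dvd fun A hA => by
    obtain ⟨h, rfl⟩ := hpow A hA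
    rw [Multiset.count_nsmul]; exact dvd_mul_right _ _
  rw [he, hc1, h6] at hc2
  omega

lemma four_no' (hc : Fintype.card Z = 4) (hD : davenport Z ≤ 4) {B : Multiset Z}
    (h3 : Len B 3) (h6 : Len B 6) : False := by
  have step : ∀ k l : ℕ, 4 * k < 2 * l → (∀ B : Multiset Z, 0 ∈ B → Len B k → Len B l → False) →
      ∀ B : Multiset Z, Len B k → Len B l → False := by
    rintro k l hkl hz B ⟨f, hf, rfl, hfc⟩ ⟨f', hf', he, hfc'⟩
    by_cases h0 : (0 : Z) ∈ f.sum
    · exact hz _ h0 ⟨f, hf, rfl, hfc⟩ ⟨f', hf', he, hfc'⟩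
    · have h1 := card_le_of_fac (f := f) (D := 4) fun A hA => (hf A hA).card_le_dav.trans hD
      have h2 := card_ge_of_fac hf' (by rwa [he])
      rw [he] at h2
      omega
  have red : ∀ k l : ℕ, (∀ B : Multiset Z, Len B k → Len B l → False) →
      ∀ B : Multiset Z, 0 ∈ B → Len B (k + 1) → Len B (l + 1) → False := by
    rintro k l hz B h0 ⟨f, hf, rfl, hfc⟩ ⟨f', hf', he, hfc'⟩
    obtain ⟨g, rfl⟩ := zero_mem_fac hf h0
    obtain ⟨g', rfl⟩ := zero_mem_fac hf' (by rwa [he])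
    refine hz g.sum ⟨g, fun A hA => hf A (by simp [hA]), rfl, by simpa using hfc⟩
      ⟨g', fun A hA => hf' A (by simp [hA]), ?_, by simpa using hfc'⟩
    simpa using he
  have hz : ∀ B : Multiset Z, Len B 0 → Len B 3 → False := by
    rintro B ⟨f, hf, rfl, hfc⟩ ⟨f', hf', he, hfc'⟩
    rw [Multiset.card_eq_zero] at hfc
    subst hfc
    obtain ⟨A, hA⟩ := Multiset.card_pos_iff_exists_mem.1 (by omega : 0 < f'.card)
    obtain ⟨g', rfl⟩ := Multiset.exists_cons_of_mem hA
    have := congrArg Multiset.card he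
    simp at this
    exact (hf' A hA).1 this.1
  have h14 := step 1 4 (by norm_num) (red 0 3 hz)
  have h25 := step 2 5 (by norm_num) (red 1 4 h14)
  by_cases h0 : (0 : Z) ∈ B
  · exact red 2 5 h25 B h0 h3 h6
  · obtain ⟨f, hf, rfl, hfc⟩ := h3
    obtain ⟨f', hf', he, hfc'⟩ := h6
    exact four_no hc hD hf hf' hfc hfc' h0 he.symm

/-- four distinct nonzero elements with zero sum in an elementary 2-group form an atom. -/
lemma at4 (h2 : ∀ z : Z, z + z = 0) {A : Multiset Z} (h4 : A.card = 4) (hs : A.sum = 0)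
    (h0 : (0 : Z) ∉ A) (hnd : A.Nodup) : At A := by
  refine ⟨by rintro rfl; simp at h4, hs, fun T hT hTs => ?_⟩
  have hc := Multiset.card_le_card hT
  obtain ⟨R, rfl⟩ := Multiset.le_iff_exists_add.1 hT
  have hRs : R.sum = 0 := by rw [Multiset.sum_add, hTs, zero_add] at hs; exact hs
  have no1 : ∀ T : Multiset Z, (0 : Z) ∉ T → T.sum = 0 → T.card ≠ 1 := by
    intro T hT0 hTs h1
    obtain ⟨x, rfl⟩ := Multiset.card_eq_one.1 h1
    simp at hT0 hTs
    exact hT0 hTs.symm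
  rw [Multiset.mem_add, not_or] at h0
  rw [Multiset.card_add] at h4
  have a1 := no1 T h0.1 hTs
  have a2 := no1 R h0.2 hRs
  have a3 : T.card ≠ 2 := by
    intro h
    obtain ⟨x, y, rfl⟩ := Multiset.card_eq_two.1 h
    simp at hTs
    have hxy : x = y := by
      have := h2 y
      exact add_right_cancel (hTs.trans this.symm)
    have := (Multiset.nodup_add.1 hnd).1
    simp [hxy] at this
  rcases (by omega : T.card = 0 ∨ R.card = 0) with h | h
  · left; exact Multiset.card_eq_zero.1 h
  · right; rw [Multiset.card_eq_zero.1 h, add_zero]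

lemma len36 {G : Type*} [AddCommGroup G] [Fintype G] (φ : (Fin 3 → ZMod 2) ≃+ G) :
    ∃ B : Multiset G, B.sum = 0 ∧ Len B 3 ∧ Len B 6 := by
  have h2 : ∀ z : G, z + z = 0 := fun z => by
    obtain ⟨v, rfl⟩ := φ.surjective z
    rw [← map_add]
    have : ∀ v : Fin 3 → ZMod 2, v + v = 0 := by decide
    rw [this, map_zero]
  have key : ∀ l : List (Fin 3 → ZMod 2), l.length = 4 → l.sum = 0 → 0 ∉ l → l.Nodup →
      At ((l : Multiset (Fin 3 → ZMod 2)).map φ) := by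
    intro l a1 a2 a3 a4
    apply at4 h2
    · simpa using a1
    · have : (Multiset.map φ (l : Multiset (Fin 3 → ZMod 2))).sum = φ (l : Multiset (Fin 3 → ZMod 2)).sum :=
        (map_multiset_sum φ _).symm
      rw [this, Multiset.sum_coe, a2, map_zero]
    · intro hm
      obtain ⟨v, hv, hv0⟩ := Multiset.mem_map.1 hm
      have : v = 0 := φ.injective (by rw [hv0, map_zero])
      exact a3 (by rw [← this]; exact hv)
    · exact Multiset.Nodup.map φ.injective a4
  let l1 : List (Fin 3 → ZMod 2) := [![1,0,0], ![0,1,0], ![0,0,1], ![1,1,1]]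
  let l2 : List (Fin 3 → ZMod 2) := [![1,0,0], ![0,1,0], ![0,1,1], ![1,0,1]]
  let l3 : List (Fin 3 → ZMod 2) := [![0,0,1], ![1,1,1], ![0,1,1], ![1,0,1]]
  let l : List (Fin 3 → ZMod 2) := [![1,0,0], ![0,1,0], ![0,0,1], ![1,1,1], ![0,1,1], ![1,0,1]]
  have A1 := key l1 rfl (by decide) (by decide) (by decide)
  have A2 := key l2 rfl (by decide) (by decide) (by decide)
  have A3 := key l3 rfl (by decide) (by decide) (by decide)
  have hsum : (l1 : Multiset (Fin 3 → ZMod 2)) + (l2 + l3) = l + l := by decide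
  let M : Multiset G := (l : Multiset (Fin 3 → ZMod 2)).map φ
  have h0 : (0 : G) ∉ M := by
    intro hm
    obtain ⟨v, hv, hv0⟩ := Multiset.mem_map.1 hm
    have : v = 0 := φ.injective (by rw [hv0, map_zero])
    rw [this] at hv
    exact absurd hv (by decide)
  obtain ⟨f, hf, hfs, hfc⟩ := pairs_fac M h0
  have hM : M.map Neg.neg = M := by
    conv_rhs => rw [← Multiset.map_id M]
    exact Multiset.map_congr rfl fun z _ => neg_eq_of_add_eq_zero_left (h2 z)
  rw [hM] at hfs
  refine ⟨M + M, ?_, ⟨{(l1 : Multiset (Fin 3 → ZMod 2)).map φ, (l2 : Multiset (Fin 3 → ZMod 2)).map φ,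
    (l3 : Multiset (Fin 3 → ZMod 2)).map φ}, ?_, ?_, rfl⟩, ⟨f, hf, hfs, by rw [hfc]; simp [M, l]⟩⟩
  · rw [Multiset.sum_add]; exact h2 _
  · intro A hA
    simp only [Multiset.insert_eq_cons, Multiset.mem_cons, Multiset.mem_singleton] at hA
    rcases hA with rfl | rfl | rfl <;> assumption
  · simp only [Multiset.insert_eq_cons, Multiset.sum_cons, Multiset.sum_singleton, M]
    rw [← Multiset.map_add, ← Multiset.map_add, ← Multiset.map_add, hsum]

end Cyc
end ZS

open scoped Classical
set_option linter.unusedSectionVars false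

namespace ZS

section Fin'
variable {G G' : Type*} [AddCommGroup G] [Fintype G] [AddCommGroup G'] [Fintype G']

lemma ind_std {n r : ℕ} (φ : G ≃+ (Fin r → ZMod n)) {t : ℕ} (ht : t ≤ r) :
    Ind n (fun i : Fin t => φ.symm (Pi.single (Fin.castLE ht i) 1)) := by
  constructor
  · intro i
    rw [← map_nsmul, ← Pi.single_smul]
    simp
  · intro c hc i
    have h1 : φ.symm (∑ i, c i • Pi.single (Fin.castLE ht i) (1 : ZMod n)) = φ.symm 0 := by
      rw [map_sum, map_zero, ← hc]
      simp only [map_nsmul]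
    have h2 := congrFun (φ.symm.injective h1) (Fin.castLE ht i)
    rw [Finset.sum_apply, Finset.sum_eq_single i] at h2
    · simp only [Pi.smul_apply, Pi.single_eq_same, nsmul_eq_mul, mul_one, Pi.zero_apply] at h2
      exact (ZMod.natCast_eq_zero_iff _ _).1 h2
    · intro j _ hj
      rw [Pi.smul_apply, Pi.single_eq_of_ne, smul_zero]
      intro h
      exact hj (Fin.castLE_injective ht h).symm
    · simp

lemma ex_std {n r : ℕ} (hr : 1 ≤ r) (φ : G ≃+ (Fin r → ZMod n)) : ex G = n := by
  apply Nat.dvd_antisymm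
  · apply AddMonoid.exponent_dvd_of_forall_nsmul_eq_zero
    intro g
    apply φ.injective
    rw [map_nsmul, map_zero]
    funext i; simp
  · have := (ind_std φ hr).ind (fun _ => ex G) (by simp [ex_smul]) 0
    exact this

lemma dav_trivial [Subsingleton G] : davenport G ≤ 1 := by
  obtain ⟨A, hA, hc⟩ := exists_dav (Z := G)
  obtain ⟨a, ha⟩ := Multiset.exists_mem_of_ne_zero hA.1
  have := hA.zero_mem (by rwa [Subsingleton.elim a 0] at ha)
  rw [← hc, this]; simp

lemma cyc_card (hD : davenport G ≤ ex G) : Fintype.card G = ex G := by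
  obtain ⟨g, hg⟩ := exists_ord_ex (Z := G)
  let H := AddSubgroup.zmultiples g
  have hs : Function.Surjective H.subtype := surj_of_dav H.subtype Subtype.val_injective (by
    refine hD.trans ?_
    have hx : addOrderOf (⟨g, AddSubgroup.mem_zmultiples g⟩ : H) = ex G := by
      rw [← hg, ← AddSubgroup.addOrderOf_coe]
    have := (at_pow (h := (⟨g, AddSubgroup.mem_zmultiples g⟩ : H)) (ord_pos _)).card_le_dav
    rw [hx] at this
    simpa using this)
  have hb : Function.Bijective H.subtype := ⟨Subtype.val_injective, hs⟩
  rw [← Nat.card_eq_fintype_card, ← Nat.card_eq_of_bijective _ hb, Nat.card_zmultiples, hg]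

theorem main {n r : ℕ} (φ : G ≃+ (Fin r → ZMod n)) (hD : 4 ≤ davenport G) (hrn : n - 1 ≤ r)
    {s : ℕ} (hs : 0 < s) (hg : Nat.gcd s n = 1)
    (hK : KGd G (r - 1) = 1 + (s : ℝ) * ((r : ℝ) - 1) / (n : ℝ))
    (h1 : SameL G G') (h2 : SameL G' G) : Nonempty (G ≃+ G') := by
  -- trivial cases
  have hr : 1 ≤ r := by
    by_contra hc
    obtain rfl : r = 0 := by omega
    have : Subsingleton G := φ.injective.subsingleton
    have := dav_trivial (G := G)
    omega
  have hn0 : n ≠ 0 := by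
    rintro rfl
    have := ex_std hr φ
    have := ex_pos (Z := G)
    omega
  have hn1 : n ≠ 1 := by
    rintro rfl
    have : Subsingleton G := φ.injective.subsingleton
    have := dav_trivial (G := G)
    omega
  have : NeZero n := ⟨hn0⟩
  have hexG := ex_std hr φ
  have hRG : RkLe r G := rkLe_of_equiv (fun _ => n) (fun _ => by omega) φ
  have hDD : davenport G = davenport G' := by
    have e1 := dav_le_of_sameL h1 (by omega)
    exact le_antisymm e1 (dav_le_of_sameL h2 (by omega))
  have two : n = 2 → davenport G ≤ r + 1 := by
    rintro rfl
    refine dav_two (fun z => ?_) hr ?_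
    · have := ex_smul z; rw [hexG, two_nsmul] at this; exact this
    · have := card_le_of_rk hRG; rwa [hexG] at this
  have hr2 : 2 ≤ r := by
    by_contra hc
    have := two (by omega)
    omega
  -- step A
  have hA : ∀ d, r ≤ d → Bd G' d 1 := fun d hd => (stepA hr hRG (by omega) hd).transfer h2
  have hex' := ex_le_of_bd hr hA
  have hR' := rk_of_bd hr hA
  -- finishing tools
  have fin1 : (∃ f : (Fin r → ZMod n) →+ G', Function.Injective f) → Nonempty (G ≃+ G') := by
    rintro ⟨f, hf⟩
    let f' : G →+ G' := f.comp φ.toAddMonoidHom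
    have hi : Function.Injective f' := hf.comp φ.injective
    exact ⟨AddEquiv.ofBijective f' ⟨hi, surj_of_dav f' hi hDD.ge⟩⟩
  have fin2 : ex G' = n → Nonempty (G ≃+ G') := by
    intro he
    obtain ⟨f, hf⟩ := embed_into (n := n) (by omega) hR' (by rw [he])
    let f' : G' →+ G := φ.symm.toAddMonoidHom.comp f
    have hi : Function.Injective f' := φ.symm.injective.comp hf
    exact ⟨(AddEquiv.ofBijective f' ⟨hi, surj_of_dav f' hi hDD.le⟩).symm⟩
  -- r = 2
  rcases Nat.lt_or_ge r 3 with hr3 | hr3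
  · obtain rfl : r = 2 := by omega
    have hn3 : n = 3 := by
      by_contra hc
      have := two (by omega)
      omega
    by_cases he : ex G' = 3
    · exact fin2 (by rw [he, hn3])
    · exfalso
      have hp := ex_pos (Z := G')
      have hle : ex G' ≤ 2 := by omega
      have : davenport G' ≤ 2 + 1 := dav_two (fun z => by
        have hz := ex_smul z
        rcases (by omega : ex G' = 1 ∨ ex G' = 2) with h | h
        · rw [h, one_smul] at hz; simp [hz]
        · rw [h, two_nsmul] at hz; exact hz) (by norm_num)
        ((card_le_of_rk hR').trans (Nat.pow_le_pow_left hle 2))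
      omega
  obtain ⟨d, rfl⟩ : ∃ d, r = d + 1 := ⟨r - 1, by omega⟩
  have hd : 2 ≤ d := by omega
  have hd' : (2 : ℝ) ≤ d := by exact_mod_cast hd
  have hn' : (2 : ℝ) ≤ n := by exact_mod_cast (by omega : 2 ≤ n)
  have hs' : (1 : ℝ) ≤ s := by exact_mod_cast hs
  rw [Nat.add_sub_cancel] at hK
  set κ := KGd G d with hκ
  have hκe : κ = 1 + (s : ℝ) * d / n := by rw [hK]; push_cast; ring
  have hpos : 0 < (s : ℝ) * d / n := by positivity
  have hκ1 : 1 < κ := by rw [hκe]; linarith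
  obtain ⟨A0, hA0, hS0, hk0⟩ := KGd_attained (Z := G) (d := d) (by rw [← hκ]; linarith)
  have hup : ∀ A : Multiset G, At A → Struct d A.toFinset → crossNum A ≤ κ :=
    fun A hA hS => KGd_upper (by rw [← hκ]; linarith) hA hS
  have finP : (∃ A : Multiset G', At A ∧ Struct d A.toFinset ∧ crossNum A = κ) →
      Nonempty (G ≃+ G') := by
    rintro ⟨A, hA, hS, hk⟩
    exact fin1 (embed_of_atom hd (by omega) hR' (by omega) hg hA hS (by rw [hk, hκe]))
  by_contra hnot
  have hne : ∀ A : Multiset G', At A → Struct d A.toFinset → crossNum A ≠ κ :=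
    fun A hA hS hk => hnot (finP ⟨A, hA, hS, hk⟩)
  rcases Nat.lt_or_ge (d + 1) n with hcase | hcase
  · -- r = n - 1
    have hnd : n = d + 2 := by omega
    have hN' : ex G' ≤ d + 1 := by
      by_contra hc
      exact hnot (fin2 (by omega))
    have hLC : ∀ S : Finset G', Struct d S → LCN S := fun S hS => lcn_of_large hN' hS
    have hI := ind_std φ le_rfl
    have hN3 : ∀ β : ℝ, Bd G d β → ((d : ℝ) + 2) ^ 2 - (d + 2) + 1 ≤ β * (d + 2 + 1) := by
      intro β hb
      have := Bd.third hI (by omega) (by simp; omega) (β := β) (by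
        rw [hnd]; exact hb)
      rw [hnd] at this
      push_cast at this
      exact this
    rcases exists_max (Z := G') d with hno | ⟨A, hA, hS, hm⟩
    · have hb : Bd G' d 0 := bd_lcn le_rfl hLC fun A hA hS => (hno A hA hS).elim
      have := hN3 0 (hb.transfer h1)
      nlinarith
    · have hge1 : 1 ≤ crossNum A := one_le_cross.2 (hLC _ hS A hA (over_toFinset A))
      have hb : Bd G' d (crossNum A) := bd_lcn (by linarith) hLC hm
      have hbG := hb.transfer h1
      have h3 := hN3 _ hbG
      have hκle : κ ≤ crossNum A := by rw [hκ, ← hk0]; exact hbG.cross hA0 hS0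
      have hκlt : κ < crossNum A := lt_of_le_of_ne hκle (hne A hA hS).symm
      have hbig : 1 + (d : ℝ) ≤ crossNum A := by
        obtain ⟨σ, hσ⟩ := hS.atom hA (over_toFinset A)
        have hck := hLC _ hS A hA (over_toFinset A)
        have hσ0 : 0 ≤ σ := by
          by_contra hc
          have : (d : ℤ) * σ < 0 := mul_neg_of_pos_of_neg (by omega) (by omega)
          omega
        obtain ⟨σ, rfl⟩ := Int.eq_ofNat_of_zero_le hσ0
        have hp := ex_pos_real (Z := G')
        have hcr : crossNum A = 1 + (σ : ℝ) * d / (ex G' : ℝ) := by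
          have e1 := ck_real A
          have e2 : (ck A : ℝ) = ex G' + d * σ := by exact_mod_cast hσ
          rw [e2] at e1
          field_simp
          linarith
        rw [hcr] at h3 ⊢
        exact arith1 (by omega) ex_pos hN' h3
      have hexGr : (ex G : ℝ) = d + 2 := by rw [hexG, hnd]; push_cast; ring
      have h34 : 3 / ((d : ℝ) + 2) < 1 := by rw [div_lt_one (by linarith)]; linarith
      let β := max κ (max ((ex G : ℝ) / 2) (d + 3 / (ex G : ℝ)))
      have hβ : β < crossNum A := by
        refine max_lt hκlt (max_lt ?_ ?_)
        · rw [hexGr]; linarith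
        · rw [hexGr]; linarith
      have hU : Bd G d β := U_main hd (by omega) hRG (by
          have : κ ≤ β := le_max_left _ _
          linarith) ((le_max_left _ _).trans (le_max_right _ _))
        (fun A hA hS => (hup A hA hS).trans (le_max_left _ _))
        (fun _ => (le_max_right _ _).trans (le_max_right _ _))
      have := (hU.transfer h2).cross hA hS
      linarith
  · -- r ≥ n
    have hbG : Bd G d κ := bd_lcn (by linarith) (fun S hS => lcn_of_large (by omega) hS) hup
    have hbG' := hbG.transfer h2
    have hlt : ∀ A : Multiset G', At A → Struct d A.toFinset → crossNum A < κ :=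
      fun A hA hS => lt_of_le_of_ne (hbG'.cross hA hS) (hne A hA hS)
    obtain ⟨β0, hβ0, hβ⟩ := gap hlt
    have contra : ∀ β : ℝ, β < κ → Bd G' d β → False := by
      intro β hβ hb
      have := (hb.transfer h1).cross hA0 hS0
      rw [hk0] at this
      linarith
    rcases Nat.lt_or_ge (ex G') (d + 2) with hN | hN
    · refine contra (max β0 0) (max_lt hβ0 (by linarith)) (bd_lcn (le_max_right _ _)
        (fun S hS => lcn_of_large (by omega) hS) fun A hA hS => (hβ A hA hS).trans (le_max_left _ _))
    have hN : ex G' = d + 2 := by omega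
    have hNr : (ex G' : ℝ) = d + 2 := by rw [hN]; push_cast; ring
    rcases Nat.lt_or_ge n 3 with hn3 | hn3
    · -- n = 2
      obtain rfl : n = 2 := by omega
      have hcard : Fintype.card G' = ex G' := cyc_card (by
        have := two rfl
        omega)
      rcases Nat.lt_or_ge d 3 with hd3 | hd3
      · obtain rfl : d = 2 := by omega
        obtain ⟨B, hB, l3, l6⟩ := len36 φ.symm
        obtain ⟨B', hB', hL⟩ := h1 B hB
        exact four_no' (by rw [hcard, hN]) (by have := two rfl; omega) ((hL 3).1 l3) ((hL 6).1 l6)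
      · obtain ⟨d0, rfl⟩ : ∃ d0, d = d0 + 1 := ⟨d - 1, by omega⟩
        have hb := (cyc_bd (d0 := d0) (by omega) (by omega) hcard).transfer h1
        have := Bd.std (ind_std φ (t := d0 + 1) (by omega)) le_rfl (by simp; omega) (β := 1)
          (by simpa using hb)
        simp only [Fintype.card_fin] at this
        push_cast at this hd'
        linarith
    · have hn3' : (3 : ℝ) ≤ n := by exact_mod_cast hn3
      have hstd := Bd.std (ind_std φ le_rfl) (by omega) (by simp; omega) (β := κ) (by simpa using hbG)
      simp only [Fintype.card_fin] at hstd
      push_cast at hstd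
      have hhalf : 1 + (d : ℝ) / 2 < κ := by
        by_contra hc
        push Not at hc
        nlinarith
      have h34 : 3 / ((d : ℝ) + 2) < 1 := by rw [div_lt_one (by linarith)]; linarith
      have hHalf : (ex G' : ℝ) / 2 < κ := by rw [hNr]; linarith
      by_cases hbas : ∃ e : Fin (d + 1) → G', Ind (ex G') e
      · have hbig : 1 + (d : ℝ) ≤ κ := by
          obtain ⟨e, he⟩ := hbas
          have := Bd.third he (by omega) (by simp [hN]) (β := κ) (by rw [hN]; exact hbG')
          rw [hNr, hκe] at this
          rw [hκe]
          exact arith1 (by omega) (by omega) hcase this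
        refine contra (max (max β0 1) (max ((ex G' : ℝ) / 2) (d + 3 / (ex G' : ℝ)))) ?_ ?_
        · refine max_lt (max_lt hβ0 hκ1) (max_lt hHalf ?_)
          rw [hNr]; linarith
        · exact U_main hd hN hR' ((le_max_right _ _).trans (le_max_left _ _))
            ((le_max_left _ _).trans (le_max_right _ _))
            (fun A hA hS => (hβ A hA hS).trans ((le_max_left _ _).trans (le_max_left _ _)))
            (fun _ => (le_max_right _ _).trans (le_max_right _ _))
      · refine contra (max (max β0 1) ((ex G' : ℝ) / 2)) (max_lt (max_lt hβ0 hκ1) hHalf) ?_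
        exact U_main hd hN hR' ((le_max_right _ _).trans (le_max_left _ _)) (le_max_right _ _)
            (fun A hA hS => (hβ A hA hS).trans ((le_max_left _ _).trans (le_max_left _ _)))
            (fun h => absurd h hbas)

end Fin'
end ZS

/-- Let `G ≅ C_n^r` with `D(G) ≥ 4` and `r ≥ n − 1`. Assume
`K(G, r−1) = 1 + s(r−1)/n` for some `s ∈ ℕ` with `gcd(s, n) = 1`. If `G'` is
a finite abelian group with `𝓛(G') = 𝓛(G)`, then `G ≅ G'`. -/
theorem stmt19 {G G' : Type*} [AddCommGroup G] [Fintype G] [AddCommGroup G'] [Fintype G']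
    (n r : ℕ) (hG : Nonempty (G ≃+ (Fin r → ZMod n)))
    (hD : 4 ≤ davenport G)
    (hrn : n - 1 ≤ r)
    (hK : ∃ s : ℕ, 0 < s ∧ Nat.gcd s n = 1 ∧
      KGd G (r - 1) = 1 + (s : ℝ) * ((r : ℝ) - 1) / (n : ℝ))
    (hL : systemL (Set.univ : Set G') = systemL (Set.univ : Set G)) :
    Nonempty (G ≃+ G') := by
  obtain ⟨φ⟩ := hG
  obtain ⟨s, hs, hg, hk⟩ := hK
  exact ZS.main φ hD hrn hs hg hk (ZS.sameL_of hL.symm) (ZS.sameL_of hL)
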